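/- arXiv:math/0505020 — 4 statements merged into one kernel-verified Lean document; each statement's English description precedes it below -/
import Mathlib

section
/- For every positive integer n, the number of permutations π ∈ S_n with d_−(π) = ⌊n²/4⌋ equals n if n is odd, and n/2 if n is even. -/
open Equiv Finset

/-- Number of inversions (Coxeter length) of a permutation of `Fin n`. -/
def invNum {n : ℕ} (π : Equiv.Perm (Fin n)) : ℕ :=
  (Finset.univ.filter (fun p : Fin n × Fin n => p.1 < p.2 ∧ π p.2 < π p.1)).card

/-- Down degree: number of transpositions `t_{a,b}` with `ℓ(t_{a,b} π) = ℓ(π) - 1`. -/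
def downDeg {n : ℕ} (π : Equiv.Perm (Fin n)) : ℕ :=
  (Finset.univ.filter (fun p : Fin n × Fin n =>
    p.1 < p.2 ∧ invNum (Equiv.swap p.1 p.2 * π) + 1 = invNum π)).card

/-- Total degree: number of transpositions `t_{a,b}` with `ℓ(t_{a,b} π) = ℓ(π) ± 1`. -/
def totalDeg {n : ℕ} (π : Equiv.Perm (Fin n)) : ℕ :=
  (Finset.univ.filter (fun p : Fin n × Fin n =>
    p.1 < p.2 ∧ (invNum (Equiv.swap p.1 p.2 * π) + 1 = invNum π ∨
      invNum (Equiv.swap p.1 p.2 * π) = invNum π + 1))).card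



/-- `x` lies north-west of `y` in the diagram of `σ`. -/
def NW {n : ℕ} (σ : Equiv.Perm (Fin n)) (x y : Fin n) : Prop := x < y ∧ σ y < σ x

/-- Covering inversion. -/
def Cov {n : ℕ} (σ : Equiv.Perm (Fin n)) (x y : Fin n) : Prop :=
  NW σ x y ∧ ∀ z, ¬ (NW σ x z ∧ NW σ z y)

theorem invNum_inv' {n : ℕ} (π : Equiv.Perm (Fin n)) : invNum π⁻¹ = invNum π := by
  unfold invNum
  refine Finset.card_nbij' (fun p => (π⁻¹ p.2, π⁻¹ p.1)) (fun p => (π p.2, π p.1)) ?_ ?_ ?_ ?_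
  · intro p hp; simp at hp ⊢; tauto
  · intro p hp; simp at hp ⊢; tauto
  · intro p hp; simp
  · intro p hp; simp

theorem sum_split_two {n : ℕ} (g : Fin n → Fin n → ℕ) (a b : Fin n) (hab : a ≠ b) :
    ∑ i, ∑ j, g i j = g a a + g a b + g b a + g b b
      + ∑ c ∈ univ.filter (fun c => c ≠ a ∧ c ≠ b), (g a c + g c a + g b c + g c b)
      + ∑ c ∈ univ.filter (fun c => c ≠ a ∧ c ≠ b),
          ∑ d ∈ univ.filter (fun c => c ≠ a ∧ c ≠ b), g c d := by
  set S : Finset (Fin n) := univ.filter (fun c => c ≠ a ∧ c ≠ b) with hS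
  have hu : (univ : Finset (Fin n)) = insert a (insert b S) := by
    ext x; simp [hS]; tauto
  have h1 : b ∉ S := by simp [hS]
  have h2 : a ∉ insert b S := by simp [hS, hab]
  rw [hu]
  simp only [Finset.sum_insert h1, Finset.sum_insert h2, Finset.sum_add_distrib]
  ring

theorem invNum_eq_sum {n : ℕ} (σ : Equiv.Perm (Fin n)) :
    invNum σ = ∑ i, ∑ j, if i < j ∧ σ j < σ i then 1 else 0 := by
  unfold invNum
  rw [Finset.card_filter, Fintype.sum_prod_type]

open Classical in
theorem invNum_swap {n : ℕ} (σ : Equiv.Perm (Fin n)) (a b : Fin n) (hab : a < b)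
    (h : σ b < σ a) :
    invNum σ = invNum (σ * Equiv.swap a b) + 1 +
      2 * (univ.filter (fun c => NW σ a c ∧ NW σ c b)).card := by
  rw [invNum_eq_sum, invNum_eq_sum, sum_split_two _ a b hab.ne, sum_split_two _ a b hab.ne]
  set S : Finset (Fin n) := univ.filter (fun c => c ≠ a ∧ c ≠ b) with hS
  have hd : ∀ c ∈ S, (σ * Equiv.swap a b) c = σ c := by
    intro c hc
    simp [hS] at hc
    simp [Equiv.swap_apply_of_ne_of_ne hc.1 hc.2]
  have ha : (σ * Equiv.swap a b) a = σ b := by simp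
  have hb : (σ * Equiv.swap a b) b = σ a := by simp
  have e2 : (∑ c ∈ S, ∑ d ∈ S, if c < d ∧ (σ * Equiv.swap a b) d < (σ * Equiv.swap a b) c then 1 else 0)
      = ∑ c ∈ S, ∑ d ∈ S, if c < d ∧ σ d < σ c then 1 else 0 := by
    refine Finset.sum_congr rfl fun c hc => Finset.sum_congr rfl fun d hd' => ?_
    rw [hd c hc, hd d hd']
  have e3 : (univ.filter (fun c => NW σ a c ∧ NW σ c b)).card
      = ∑ c ∈ S, if a < c ∧ c < b ∧ σ b < σ c ∧ σ c < σ a then 1 else 0 := by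
    rw [← Finset.card_filter]
    congr 1
    ext c
    simp only [hS, Finset.mem_filter, Finset.mem_univ, true_and]
    simp only [NW]
    constructor
    · rintro ⟨⟨h1, h2⟩, h3, h4⟩
      exact ⟨⟨h1.ne', h3.ne⟩, h1, h3, h4, h2⟩
    · rintro ⟨-, h1, h3, h4, h2⟩
      exact ⟨⟨h1, h2⟩, h3, h4⟩
  rw [e2, e3, Finset.mul_sum, ha, hb]
  have e1 : ∀ c ∈ S,
      ((if a < c ∧ σ c < σ a then 1 else 0) + (if c < a ∧ σ a < σ c then 1 else 0)
        + (if b < c ∧ σ c < σ b then 1 else 0) + (if c < b ∧ σ b < σ c then 1 else 0))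
      = ((if a < c ∧ (σ * Equiv.swap a b) c < σ b then 1 else 0)
        + (if c < a ∧ σ b < (σ * Equiv.swap a b) c then 1 else 0)
        + (if b < c ∧ (σ * Equiv.swap a b) c < σ a then 1 else 0)
        + (if c < b ∧ σ a < (σ * Equiv.swap a b) c then 1 else 0))
        + 2 * (if a < c ∧ c < b ∧ σ b < σ c ∧ σ c < σ a then 1 else 0) := by
    intro c hc
    rw [hd c hc]
    simp [hS] at hc
    have h1 : σ c ≠ σ a := fun h => hc.1 (σ.injective h)
    have h2 : σ c ≠ σ b := fun h => hc.2 (σ.injective h)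
    obtain ⟨h3, h4⟩ := hc
    generalize σ c = x at *
    generalize σ a = y at *
    generalize σ b = z at *
    rcases lt_or_gt_of_ne h1 with h1 | h1 <;> rcases lt_or_gt_of_ne h2 with h2 | h2 <;>
    rcases lt_or_gt_of_ne h3 with h3 | h3 <;> rcases lt_or_gt_of_ne h4 with h4 | h4 <;>
    simp [h1, h2, h3, h4, h1.not_gt, h2.not_gt, h3.not_gt, h4.not_gt] <;> omega
  rw [Finset.sum_congr rfl e1, Finset.sum_add_distrib]
  simp [hab, h, hab.not_gt, h.not_gt]
  ring

open Classical in
theorem invNum_swap_iff {n : ℕ} (π : Equiv.Perm (Fin n)) (a b : Fin n) (hab : a < b) :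
    invNum (Equiv.swap a b * π) + 1 = invNum π ↔ Cov π⁻¹ a b := by
  rw [← invNum_inv' π, ← invNum_inv' (Equiv.swap a b * π), mul_inv_rev, Equiv.swap_inv]
  generalize π⁻¹ = σ
  rcases lt_trichotomy (σ b) (σ a) with h | h | h
  · have := invNum_swap σ a b hab h
    have h2 : invNum (σ * Equiv.swap a b) + 1 = invNum σ ↔
      (univ.filter (fun c => NW σ a c ∧ NW σ c b)).card = 0 := by omega
    rw [h2, Finset.card_eq_zero, Finset.filter_eq_empty_iff]
    simp [Cov, NW, hab, h]
  · exact absurd (σ.injective h) hab.ne'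
  · have := invNum_swap (σ * Equiv.swap a b) a b hab (by simpa using h)
    rw [mul_assoc, Equiv.swap_mul_self, mul_one] at this
    constructor
    · intro h; omega
    · intro hc; exact absurd hc.1.2 h.not_gt

open Classical in
theorem downDeg_eq {n : ℕ} (π : Equiv.Perm (Fin n)) :
    downDeg π = (univ.filter (fun p : Fin n × Fin n => Cov π⁻¹ p.1 p.2)).card := by
  unfold downDeg
  congr 1
  ext p
  simp only [Finset.mem_filter, Finset.mem_univ, true_and]
  constructor
  · rintro ⟨h1, h2⟩; exact (invNum_swap_iff π _ _ h1).1 h2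
  · intro h; exact ⟨h.1.1, (invNum_swap_iff π _ _ h.1.1).2 h⟩

/-- Level of `i` with respect to the block sizes `p`, `q`. -/
def lev (p q i : ℕ) : ℕ := if i < p then 0 else if i < p + q then 1 else 2

theorem lev_spec (p q i : ℕ) : (i < p ∧ lev p q i = 0) ∨ (p ≤ i ∧ i < p + q ∧ lev p q i = 1) ∨
    (p ≤ i ∧ p + q ≤ i ∧ lev p q i = 2) := by
  unfold lev; split_ifs <;> omega

/-- The block function. -/
def blockFun (n p q : ℕ) (h : p + q ≤ n) (i : Fin n) : Fin n :=
  ⟨if i.1 < p then n - p + i else if i.1 < p + q then n - p - q + (i - p) else i - (p + q), by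
    have := i.2; split_ifs <;> omega⟩

/-- The block permutation. -/
noncomputable def blockPerm (n p q : ℕ) (h : p + q ≤ n) : Equiv.Perm (Fin n) :=
  Equiv.ofBijective (blockFun n p q h) (Finite.injective_iff_bijective.1 (by
    intro i j hij
    have hi := i.2
    have hj := j.2
    simp only [blockFun, Fin.mk.injEq] at hij
    ext
    split_ifs at hij <;> omega))

theorem blockPerm_val (n p q : ℕ) (h : p + q ≤ n) (i : Fin n) :
    (blockPerm n p q h i).1 =
      if i.1 < p then n - p + i else if i.1 < p + q then n - p - q + (i - p) else i - (p + q) := rfl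

theorem blockPerm_NW (n p q : ℕ) (h : p + q ≤ n) (i j : Fin n) :
    NW (blockPerm n p q h) i j ↔ lev p q i < lev p q j := by
  have hi := i.2
  have hj := j.2
  simp only [NW, Fin.lt_def, blockPerm_val, lev]
  split_ifs <;> omega

theorem perm_eq_of_NW {n : ℕ} (σ τ : Equiv.Perm (Fin n)) (h : ∀ i j, NW σ i j ↔ NW τ i j) :
    σ = τ := by
  have key : ∀ i j, σ i < σ j ↔ τ i < τ j := by
    intro i j
    have h1 := h i j
    have h2 := h j i
    simp only [NW] at h1 h2
    rcases lt_trichotomy i j with hl | hl | hl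
    · have a1 : σ i ≠ σ j := fun e => hl.ne (σ.injective e)
      have a2 : τ i ≠ τ j := fun e => hl.ne (τ.injective e)
      simp only [hl, true_and] at h1
      rw [← not_le, ← not_le, not_iff_not, le_iff_lt_or_eq, le_iff_lt_or_eq]
      simp [a1.symm, a2.symm, h1]
    · simp [hl]
    · simpa only [hl, true_and] using h2
  let e : Fin n ≃o Fin n := ⟨σ.symm.trans τ, by
    intro a b
    have := key (σ.symm b) (σ.symm a)
    simp at this
    simpa using (not_congr this).symm⟩
  have he : e = OrderIso.refl _ := Subsingleton.elim _ _
  ext i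
  have := congrArg (fun f : Fin n ≃o Fin n => f (σ i)) he
  simp [e] at this
  rw [this]

theorem Cov_block (n p q : ℕ) (h : p + q ≤ n) (h0 : 0 < q ∨ p = 0) (i j : Fin n) :
    Cov (blockPerm n p q h) i j ↔ lev p q j = lev p q i + 1 := by
  simp only [Cov, blockPerm_NW]
  have hi := i.2
  have hj := j.2
  constructor
  · rintro ⟨h1, h2⟩
    by_contra hne
    have h3 : lev p q i = 0 ∧ lev p q j = 2 := by
      unfold lev at *; split_ifs at * <;> omega
    have hp : i.1 < p := by
      have := h3.1; unfold lev at this; split_ifs at this; assumption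
    have hq : 0 < q := by omega
    have h4 := h2 ⟨p, by omega⟩
    have h5 : lev p q p = 1 := by unfold lev; split_ifs <;> omega
    simp only [h5, h3] at h4
    omega
  · intro h; refine ⟨by omega, fun z => by omega⟩

theorem card_levs (n p q : ℕ) (h : p + q ≤ n) :
    (univ.filter (fun i : Fin n => lev p q i = 0)).card = p ∧
    (univ.filter (fun i : Fin n => lev p q i = 1)).card = q ∧
    (univ.filter (fun i : Fin n => lev p q i = 2)).card = n - (p + q) := by
  have h0 : (univ.filter (fun i : Fin n => lev p q i = 0)).card = p := by
    have : (univ.filter (fun i : Fin n => lev p q i = 0)) = univ.filter (fun i : Fin n => i.1 < p) := by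
      ext i; have := lev_spec p q i; simp; omega
    rw [this, Fin.card_filter_val_lt]; omega
  have h1 : (univ.filter (fun i : Fin n => lev p q i = 0)).card
      + (univ.filter (fun i : Fin n => lev p q i = 1)).card = p + q := by
    rw [← Finset.card_union_of_disjoint]
    · have : (univ.filter (fun i : Fin n => lev p q i = 0)) ∪ (univ.filter (fun i : Fin n => lev p q i = 1))
        = univ.filter (fun i : Fin n => i.1 < p + q) := by
        ext i; have := lev_spec p q i; simp; omega
      rw [this, Fin.card_filter_val_lt]; omega
    · rw [Finset.disjoint_filter]; intro x _ h; omega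
  have h2 : (univ.filter (fun i : Fin n => i.1 < p + q)).card
      + (univ.filter (fun i : Fin n => lev p q i = 2)).card = n := by
    rw [← Finset.card_union_of_disjoint]
    · have : (univ.filter (fun i : Fin n => i.1 < p + q)) ∪ (univ.filter (fun i : Fin n => lev p q i = 2))
        = univ := by
        ext i; have := lev_spec p q i; simp; omega
      rw [this]; simp
    · rw [Finset.disjoint_filter]; intro x _ h; have := lev_spec p q x; omega
  rw [Fin.card_filter_val_lt] at h2
  omega

open Classical in
theorem covNum_block (n p q : ℕ) (h : p + q ≤ n) (h0 : 0 < q ∨ p = 0) :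
    (univ.filter (fun x : Fin n × Fin n => Cov (blockPerm n p q h) x.1 x.2)).card = q * (n - q) := by
  obtain ⟨c0, c1, c2⟩ := card_levs n p q h
  have : (univ.filter (fun x : Fin n × Fin n => Cov (blockPerm n p q h) x.1 x.2))
      = ((univ.filter (fun i : Fin n => lev p q i = 0)) ×ˢ (univ.filter (fun i : Fin n => lev p q i = 1)))
      ∪ ((univ.filter (fun i : Fin n => lev p q i = 1)) ×ˢ (univ.filter (fun i : Fin n => lev p q i = 2))) := by
    ext ⟨i, j⟩
    simp only [Cov_block n p q h h0, Finset.mem_filter, Finset.mem_univ, true_and,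
      Finset.mem_union, Finset.mem_product]
    have := lev_spec p q i; have := lev_spec p q j; omega
  rw [this, Finset.card_union_of_disjoint, Finset.card_product, Finset.card_product, c0, c1, c2]
  · obtain ⟨r, rfl⟩ := Nat.exists_eq_add_of_le h
    have e1 : p + q + r - (p + q) = r := by omega
    have e2 : p + q + r - q = p + r := by omega
    rw [e1, e2]; ring
  · rw [Finset.disjoint_left]
    rintro ⟨i, j⟩ h1 h2
    simp at h1 h2
    omega

theorem NW.trans {n : ℕ} {σ : Equiv.Perm (Fin n)} {x y z : Fin n} (h : NW σ x y) (h' : NW σ y z) :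
    NW σ x z := ⟨h.1.trans h'.1, h'.2.trans h.2⟩

theorem NW.asymm {n : ℕ} {σ : Equiv.Perm (Fin n)} {x y : Fin n} (h : NW σ x y) (h' : NW σ y x) :
    False := h.1.not_gt h'.1

theorem exists_cov {n : ℕ} {σ : Equiv.Perm (Fin n)} {x y : Fin n} (h : NW σ x y)
    (h' : ¬ Cov σ x y) : ∃ z, Cov σ x z ∧ NW σ z y := by
  classical
  have hne : (univ.filter (fun z => NW σ x z ∧ NW σ z y)).Nonempty := by
    by_contra hcon
    rw [Finset.not_nonempty_iff_eq_empty, Finset.filter_eq_empty_iff] at hcon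
    exact h' ⟨h, fun z => hcon (Finset.mem_univ z)⟩
  obtain ⟨z, hz, hmin⟩ := Finset.exists_min_image _ (fun z => z) hne
  simp only [Finset.mem_filter, Finset.mem_univ, true_and] at hz hmin
  refine ⟨z, ⟨hz.1, fun w hw => ?_⟩, hz.2⟩
  exact absurd (hmin w ⟨hw.1, hw.2.trans hz.2⟩) (not_le.2 hw.2.1)

/-- The cover graph. -/
def covGraph {n : ℕ} (σ : Equiv.Perm (Fin n)) : SimpleGraph (Fin n) where
  Adj x y := Cov σ x y ∨ Cov σ y x
  symm := ⟨fun _ _ h => h.symm⟩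
  loopless := ⟨fun _ h => h.elim (fun h => h.1.1.false) (fun h => h.1.1.false)⟩

theorem covGraph_cliqueFree {n : ℕ} (σ : Equiv.Perm (Fin n)) : (covGraph σ).CliqueFree 3 := by
  intro s hs
  obtain ⟨a, b, c, h1, h2, h3, -⟩ := SimpleGraph.is3Clique_iff.1 hs
  rcases h1 with h1 | h1 <;> rcases h2 with h2 | h2 <;> rcases h3 with h3 | h3
  · exact h2.2 b ⟨h1.1, h3.1⟩
  · exact h1.2 c ⟨h2.1, h3.1⟩
  · exact (h1.1.trans h3.1).asymm h2.1
  · exact h3.2 a ⟨h2.1, h1.1⟩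
  · exact h3.2 a ⟨h1.1, h2.1⟩
  · exact (h3.1.trans h1.1).asymm h2.1
  · exact h1.2 c ⟨h3.1, h2.1⟩
  · exact h2.2 b ⟨h3.1, h1.1⟩

open Classical in
theorem card_edge_covGraph {n : ℕ} (σ : Equiv.Perm (Fin n)) :
    (covGraph σ).edgeFinset.card
      = (univ.filter (fun x : Fin n × Fin n => Cov σ x.1 x.2)).card := by
  symm
  refine Finset.card_bij (fun x _ => s(x.1, x.2)) ?_ ?_ ?_
  · rintro ⟨a, b⟩ h
    simp only [Finset.mem_filter, Finset.mem_univ, true_and] at h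
    rw [SimpleGraph.mem_edgeFinset, SimpleGraph.mem_edgeSet]
    exact Or.inl h
  · rintro ⟨a, b⟩ h ⟨c, d⟩ h' he
    simp only [Finset.mem_filter, Finset.mem_univ, true_and] at h h'
    simp only [Sym2.eq_iff] at he
    rcases he with ⟨rfl, rfl⟩ | ⟨rfl, rfl⟩
    · rfl
    · exact (h.1.asymm h'.1).elim
  · intro e
    induction e using Sym2.ind with
    | _ a b =>
      intro h
      rw [SimpleGraph.mem_edgeFinset, SimpleGraph.mem_edgeSet] at h
      rcases h with h | h
      · exact ⟨(a, b), by simpa using h, rfl⟩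
      · exact ⟨(b, a), by simpa using h, Sym2.eq_swap⟩

theorem turan_num (n : ℕ) : (n ^ 2 - (n % 2) ^ 2) * (2 - 1) / (2 * 2) + (n % 2).choose 2 = n ^ 2 / 4 := by
  rcases Nat.even_or_odd' n with ⟨m, rfl | rfl⟩
  · simp
  · have h1 : (2 * m + 1) % 2 = 1 := by omega
    rw [h1]
    have : (2 * m + 1) ^ 2 = 4 * (m ^ 2 + m) + 1 := by ring
    rw [this]
    norm_num
    omega

open Classical in
theorem exists_coloring {n : ℕ} (σ : Equiv.Perm (Fin n))
    (h : (univ.filter (fun x : Fin n × Fin n => Cov σ x.1 x.2)).card = n ^ 2 / 4) :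
    ∃ c : Fin n → ℕ, (∀ v, c v < 2) ∧ ∀ x y, c x ≠ c y ↔ (Cov σ x y ∨ Cov σ y x) := by
  have hT : (covGraph σ).IsTuranMaximal 2 := by
    refine ⟨covGraph_cliqueFree σ, ?_⟩
    intro H _ hH
    have := hH.card_edgeFinset_le
    simp only [Fintype.card_fin] at this
    rw [turan_num, ← h, ← card_edge_covGraph] at this
    convert this
  obtain ⟨f⟩ := hT.nonempty_iso_turanGraph
  refine ⟨fun v => (f v).1 % 2, fun v => Nat.mod_lt _ (by norm_num), fun x y => ?_⟩
  have := f.map_rel_iff (a := x) (b := y)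
  rw [SimpleGraph.turanGraph_adj] at this
  exact this

theorem exists_level {n : ℕ} (σ : Equiv.Perm (Fin n)) (c : Fin n → ℕ) (hc2 : ∀ v, c v < 2)
    (hc : ∀ x y, c x ≠ c y ↔ (Cov σ x y ∨ Cov σ y x)) (x0 y0 : Fin n) (h0 : Cov σ x0 y0) :
    ∃ k : Fin n → ℕ, (∃ v, k v = 1) ∧ (∀ v, k v < 3) ∧ ∀ x y, NW σ x y ↔ k x < k y := by
  classical
  have chain : ∀ a b a', Cov σ a b → Cov σ b a' → ∀ b', c b' = c b → Cov σ a b' ∧ Cov σ b' a' := by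
    intro a b a' h1 h2 b' hb
    have h3 := (hc a b).2 (Or.inl h1)
    have h4 := (hc b a').2 (Or.inl h2)
    rcases (hc a b').1 (by rwa [hb]) with h5 | h5
    · rcases (hc b' a').1 (by rwa [hb]) with h6 | h6
      · exact ⟨h5, h6⟩
      · exact (h5.2 b ⟨h1.1, h2.1.trans h6.1⟩).elim
    · rcases (hc b' a').1 (by rwa [hb]) with h6 | h6
      · exact (h6.2 b ⟨h5.1.trans h1.1, h2.1⟩).elim
      · exact ((h1.1.trans h2.1).asymm (h6.1.trans h5.1)).elim
  obtain ⟨b, H⟩ : ∃ b, ∀ v b', c v ≠ c b → c b' = c b →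
      (Cov σ v b → Cov σ v b') ∧ (Cov σ b v → Cov σ b' v) := by
    by_cases hch : ∃ a b a', Cov σ a b ∧ Cov σ b a'
    · obtain ⟨a, b, a', h1, h2⟩ := hch
      exact ⟨b, fun v b' hv hb => ⟨fun h => (chain v b a' h h2 b' hb).1,
        fun h => (chain a b v h1 h b' hb).2⟩⟩
    · push Not at hch
      refine ⟨y0, fun v b' hv hb => ⟨fun h => ?_, fun h => (hch _ _ _ h0 h).elim⟩⟩
      rcases (hc v b').1 (by rwa [hb]) with h5 | h5
      · exact h5
      · exact (hch _ _ _ h5 h).elim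
  have col : ∀ x y, c x ≠ c b → c y ≠ c b → c x = c y := by
    intro x y h1 h2
    have := hc2 x; have := hc2 y; have := hc2 b
    omega
  set k : Fin n → ℕ := fun v => if c v = c b then 1 else if Cov σ v b then 0 else 2 with hk
  have kspec : ∀ v, (c v = c b ∧ k v = 1) ∨ (c v ≠ c b ∧ Cov σ v b ∧ k v = 0) ∨
      (c v ≠ c b ∧ Cov σ b v ∧ k v = 2) := by
    intro v
    by_cases h1 : c v = c b
    · left; simp [hk, h1]
    · by_cases h2 : Cov σ v b
      · right; left; simp [hk, h1, h2]
      · right; right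
        exact ⟨h1, ((hc v b).1 h1).resolve_left h2, by simp [hk, h1, h2]⟩
  refine ⟨k, ⟨b, by simp [hk]⟩, ?_, ?_⟩
  · intro v; rcases kspec v with h | h | h <;> omega
  intro x y
  constructor
  · intro hxy
    rcases kspec x with ⟨x1, x3⟩ | ⟨x1, x2, x3⟩ | ⟨x1, x2, x3⟩ <;>
    rcases kspec y with ⟨y1, y3⟩ | ⟨y1, y2, y3⟩ | ⟨y1, y2, y3⟩ <;>
    rw [x3, y3] <;> try norm_num
    · have hne : ¬ Cov σ x y := fun h => (hc x y).2 (Or.inl h) (by omega)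
      obtain ⟨z, hz, hzy⟩ := exists_cov hxy hne
      have hzc := (hc x z).2 (Or.inl hz)
      rcases (hc z y).1 (by omega) with h4 | h4
      · rcases kspec z with ⟨z1, z3⟩ | ⟨z1, z2, z3⟩ | ⟨z1, z2, z3⟩
        · omega
        · exact ((H z x z1 x1).1 z2).1.asymm hz.1
        · exact ((H z y z1 y1).2 z2).1.asymm h4.1
      · exact hzy.asymm h4.1
    · exact ((H y x y1 x1).1 y2).1.asymm hxy
    · have hne : ¬ Cov σ x y := fun h => (hc x y).2 (Or.inl h) (col x y x1 y1)
      obtain ⟨z, hz, hzy⟩ := exists_cov hxy hne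
      have hzc := (hc x z).2 (Or.inl hz)
      have hzb : c z = c b := by by_contra h; exact hzc (col x z x1 h)
      exact ((H y z y1 hzb).1 y2).1.asymm hzy
    · exact ((H x y x1 y1).2 x2).1.asymm hxy
    · exact (hxy.trans y2.1).asymm x2.1
    · have hne : ¬ Cov σ x y := fun h => (hc x y).2 (Or.inl h) (col x y x1 y1)
      obtain ⟨z, hz, hzy⟩ := exists_cov hxy hne
      have hzc := (hc x z).2 (Or.inl hz)
      have hzb : c z = c b := by by_contra h; exact hzc (col x z x1 h)
      exact ((H x z x1 hzb).2 x2).1.asymm hz.1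
  · intro hxy
    rcases kspec x with ⟨x1, x3⟩ | ⟨x1, x2, x3⟩ | ⟨x1, x2, x3⟩ <;>
    rcases kspec y with ⟨y1, y3⟩ | ⟨y1, y2, y3⟩ | ⟨y1, y2, y3⟩ <;>
    rw [x3, y3] at hxy <;> try (exfalso; omega)
    · exact ((H y x y1 x1).2 y2).1
    · exact ((H x y x1 y1).1 x2).1
    · exact x2.1.trans y2.1

theorem initial_segment {n : ℕ} (S : Finset (Fin n)) (hS : ∀ i j, i ≤ j → j ∈ S → i ∈ S)
    (i : Fin n) : i ∈ S ↔ i.1 < S.card := by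
  constructor
  · intro hi
    have : Finset.Iic i ⊆ S := fun j hj => hS j i (Finset.mem_Iic.1 hj) hi
    have := Finset.card_le_card this
    rw [Fin.card_Iic] at this
    omega
  · intro hi
    by_contra hcon
    have : S ⊆ Finset.Iio i := fun j hj => Finset.mem_Iio.2 (by
      by_contra h; exact hcon (hS i j (not_lt.1 h) hj))
    have := Finset.card_le_card this
    rw [Fin.card_Iio] at this
    omega

theorem block_of_level {n : ℕ} (σ : Equiv.Perm (Fin n)) (k : Fin n → ℕ) (hk1 : ∃ v, k v = 1)
    (hk3 : ∀ v, k v < 3) (hk : ∀ x y, NW σ x y ↔ k x < k y) :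
    ∃ p q, ∃ h : p + q ≤ n, 0 < q ∧ σ = blockPerm n p q h := by
  have hmono : ∀ i j, i ≤ j → k i ≤ k j := by
    intro i j hij
    by_contra hcon
    exact absurd ((hk j i).2 (not_le.1 hcon)).1 (not_lt.2 hij)
  have h1 := initial_segment (univ.filter (fun i => k i < 1)) (by
    intro i j hij hj
    have := hmono i j hij
    simp at hj ⊢; omega)
  have h2 := initial_segment (univ.filter (fun i => k i < 2)) (by
    intro i j hij hj
    have := hmono i j hij
    simp only [Finset.mem_filter, Finset.mem_univ, true_and] at hj ⊢; omega)
  simp only [Finset.mem_filter, Finset.mem_univ, true_and] at h1 h2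
  have hs : (univ.filter (fun i => k i < 1)) ⊆ (univ.filter (fun i => k i < 2)) := by
    intro i; simp only [Finset.mem_filter, Finset.mem_univ, true_and]; omega
  have hle := Finset.card_le_card hs
  have hle2 := Finset.card_le_univ (univ.filter (fun i => k i < 2))
  rw [Fintype.card_fin] at hle2
  generalize (univ.filter (fun i => k i < 1)).card = p at *
  generalize (univ.filter (fun i => k i < 2)).card = r at *
  obtain ⟨q, rfl⟩ := Nat.exists_eq_add_of_le hle
  refine ⟨p, q, hle2, ?_, ?_⟩
  · obtain ⟨v, hv⟩ := hk1
    have := h1 v; have := h2 v; omega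
  · apply perm_eq_of_NW
    intro i j
    rw [hk, blockPerm_NW]
    have hl : ∀ i, k i = lev p q i := by
      intro i
      have := h1 i; have := h2 i; have := hk3 i; have := lev_spec p q i; omega
    rw [hl, hl]

theorem q_eq (n q : ℕ) (h : q ≤ n) : q * (n - q) = n ^ 2 / 4 ↔ q = n / 2 ∨ q = (n + 1) / 2 := by
  obtain ⟨r, rfl⟩ := Nat.exists_eq_add_of_le h
  have e : q + r - q = r := by omega
  rw [e]
  constructor
  · intro h
    have h2 : (q + r) ^ 2 < 4 * (q * r) + 4 := by omega
    have h3 : ((q : ℤ) - r) ^ 2 < 4 := by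
      zify at h2; nlinarith
    have h4 : (q : ℤ) - r < 2 := by nlinarith
    have h5 : -2 < (q : ℤ) - r := by nlinarith
    omega
  · intro h
    have h4 : q = r ∨ q = r + 1 ∨ r = q + 1 := by omega
    rcases h4 with rfl | rfl | rfl
    · have : (q + q) ^ 2 = 4 * (q * q) := by ring
      omega
    · have : (r + 1 + r) ^ 2 = 4 * ((r + 1) * r) + 1 := by ring
      omega
    · have : (q + (q + 1)) ^ 2 = 4 * (q * (q + 1)) + 1 := by ring
      omega

theorem block_norm (n p : ℕ) (h : p + (n - p) ≤ n) (h' : 0 + p ≤ n) :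
    blockPerm n p (n - p) h = blockPerm n 0 p h' := by
  apply perm_eq_of_NW
  intro i j
  rw [blockPerm_NW, blockPerm_NW]
  have := lev_spec p (n - p) i
  have := lev_spec p (n - p) j
  have := lev_spec 0 p i
  have := lev_spec 0 p j
  have := i.2
  have := j.2
  omega

theorem block_inj (n p q p' q' : ℕ) (h : p + q < n) (h' : p' + q' < n)
    (hq : q = n / 2 ∨ q = (n + 1) / 2) (hq' : q' = n / 2 ∨ q' = (n + 1) / 2)
    (he : blockPerm n p q h.le = blockPerm n p' q' h'.le) : p = p' ∧ q = q' := by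
  have key : ∀ i (hi : i < n), (if i < p then n - p + i else if i < p + q then n - p - q + (i - p) else i - (p + q))
      = (if i < p' then n - p' + i else if i < p' + q' then n - p' - q' + (i - p') else i - (p' + q')) := by
    intro i hi
    have := congrArg (fun f : Equiv.Perm (Fin n) => (f ⟨i, hi⟩).1) he
    simpa only [blockPerm_val] using this
  have h1 := key (n - 1) (by omega)
  have h2 := key p (by omega)
  have h3 := key p' (by omega)
  have e : p + q = p' + q' := by
    rw [if_neg (by omega), if_neg (by omega), if_neg (by omega), if_neg (by omega)] at h1
    omega
  split_ifs at h2 h3 <;> omega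

open Classical in
theorem main_iff {n : ℕ} (hn : 0 < n) (σ : Equiv.Perm (Fin n)) :
    (univ.filter (fun x : Fin n × Fin n => Cov σ x.1 x.2)).card = n ^ 2 / 4 ↔
    ∃ p q, ∃ h : p + q < n, (q = n / 2 ∨ q = (n + 1) / 2) ∧ blockPerm n p q h.le = σ := by
  constructor
  · intro h
    rcases Nat.lt_or_ge 1 n with h1 | h1
    · obtain ⟨c, hc2, hc⟩ := exists_coloring σ h
      have hpos : 0 < (univ.filter (fun x : Fin n × Fin n => Cov σ x.1 x.2)).card := by
        rw [h]; apply Nat.div_pos _ (by norm_num); nlinarith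
      obtain ⟨⟨x0, y0⟩, hxy⟩ := Finset.card_pos.1 hpos
      simp only [Finset.mem_filter, Finset.mem_univ, true_and] at hxy
      obtain ⟨k, hk1, hk3, hk⟩ := exists_level σ c hc2 hc x0 y0 hxy
      obtain ⟨p, q, hpq, hq, rfl⟩ := block_of_level σ k hk1 hk3 hk
      rw [covNum_block n p q hpq (Or.inl hq), q_eq n q (by omega)] at h
      rcases Nat.lt_or_ge (p + q) n with hlt | hge
      · exact ⟨p, q, hlt, h, rfl⟩
      · obtain rfl : q = n - p := by omega
        refine ⟨0, p, by omega, by omega, (block_norm n p _ _).symm⟩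
    · obtain rfl : n = 1 := by omega
      exact ⟨0, 0, by norm_num, by norm_num, Subsingleton.elim _ _⟩
  · rintro ⟨p, q, h, hq, rfl⟩
    rw [covNum_block n p q h.le (by omega)]
    exact (q_eq n q (by omega)).2 hq

/-- Index set for the maximisers. -/
def idx (n : ℕ) : Finset (ℕ × ℕ) :=
  (Finset.range n ×ˢ {n / 2, (n + 1) / 2}).filter (fun x => x.1 + x.2 < n)

theorem mem_idx (n p q : ℕ) : (p, q) ∈ idx n ↔ p + q < n ∧ (q = n / 2 ∨ q = (n + 1) / 2) := by
  simp only [idx, Finset.mem_filter, Finset.mem_product, Finset.mem_range, Finset.mem_insert,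
    Finset.mem_singleton]
  omega

theorem card_idx (n : ℕ) : (idx n).card = if n % 2 = 1 then n else n / 2 := by
  have h1 : idx n = (Finset.range (n - n / 2)).image (fun p => (p, n / 2)) ∪
      (Finset.range (n - (n + 1) / 2)).image (fun p => (p, (n + 1) / 2)) := by
    ext ⟨p, q⟩
    rw [mem_idx]
    simp only [Finset.mem_union, Finset.mem_image, Finset.mem_range, Prod.mk.injEq]
    constructor
    · rintro ⟨h1, rfl | rfl⟩
      · left; exact ⟨p, by omega, rfl, rfl⟩
      · right; exact ⟨p, by omega, rfl, rfl⟩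
    · rintro (⟨a, h, rfl, rfl⟩ | ⟨a, h, rfl, rfl⟩) <;> omega
  have inj : ∀ m : ℕ, Function.Injective (fun p : ℕ => (p, m)) := by
    intro m a b h; exact (Prod.mk.inj h).1
  split_ifs with h
  · rw [h1, Finset.card_union_of_disjoint, Finset.card_image_of_injective _ (inj _),
      Finset.card_image_of_injective _ (inj _), Finset.card_range, Finset.card_range]
    · omega
    · rw [Finset.disjoint_left]
      rintro ⟨p, q⟩ h1 h2
      simp only [Finset.mem_image, Finset.mem_range, Prod.mk.injEq] at h1 h2
      omega
  · have e : (n + 1) / 2 = n / 2 := by omega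
    rw [h1, e, Finset.union_self, Finset.card_image_of_injective _ (inj _), Finset.card_range]
    omega

theorem card_max_downDeg {n : ℕ} (hn : 0 < n) :
    (Finset.univ.filter
        (fun π : Equiv.Perm (Fin n) => downDeg π = n ^ 2 / 4)).card =
      if n % 2 = 1 then n else n / 2 := by
  rw [← card_idx]
  symm
  refine Finset.card_bij
    (fun x hx => (blockPerm n x.1 x.2 ((mem_idx n x.1 x.2).1 hx).1.le)⁻¹) ?_ ?_ ?_
  · rintro ⟨p, q⟩ hx
    have := (mem_idx n p q).1 hx
    simp only [Finset.mem_filter, Finset.mem_univ, true_and]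
    rw [downDeg_eq, inv_inv]
    exact (main_iff hn _).2 ⟨p, q, this.1, this.2, rfl⟩
  · rintro ⟨p, q⟩ hx ⟨p', q'⟩ hx' he
    have h1 := (mem_idx n p q).1 hx
    have h2 := (mem_idx n p' q').1 hx'
    obtain ⟨rfl, rfl⟩ := block_inj n p q p' q' h1.1 h2.1 h1.2 h2.2 (inv_injective he)
    rfl
  · intro π hπ
    simp only [Finset.mem_filter, Finset.mem_univ, true_and] at hπ
    rw [downDeg_eq] at hπ
    obtain ⟨p, q, h, hq, he⟩ := (main_iff hn _).1 hπ
    exact ⟨(p, q), (mem_idx n p q).2 ⟨h, hq⟩, by simp only [he, inv_inv]⟩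
end

section
/- For every n ≥ 2 and every π ∈ S_n, the total degree satisfies d(π) ≤ ⌊n²/4⌋ + n − 2. -/
open Equiv Finset

/-- The rectangle spanned by `i < j` in the graph of `f` has no point of `S` in its interior. -/
def EmpRect {α : Type*} [LinearOrder α] (f : α → ℤ) (S : Finset α) (i j : α) : Prop :=
  i < j ∧ ∀ k ∈ S, i < k → k < j → ¬ (f i < f k ∧ f k < f j) ∧ ¬ (f j < f k ∧ f k < f i)

def ConsecIn {α : Type*} [LinearOrder α] (S : Finset α) (i j : α) : Prop :=
  i ∈ S ∧ j ∈ S ∧ i < j ∧ ∀ k ∈ S, k ≤ i ∨ j ≤ k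

theorem jump_aux {α : Type*} [LinearOrder α] (f : α → ℤ) (S : Finset α) (v w : α)
    (hv : v ∈ S) (hw : w ∈ S) (h : EmpRect f S v w) (hlt : f w < f v) :
    ∃ x y, ConsecIn S x y ∧ |f v - f w| ≤ |f x - f y| := by
  classical
  obtain ⟨hvw, he⟩ := h
  have h1 : (S.filter (fun k => v ≤ k ∧ k < w ∧ f v ≤ f k)).Nonempty :=
    ⟨v, by simp [hv, hvw]⟩
  obtain ⟨x, hx, hxm⟩ := Finset.exists_max_image _ id h1
  simp only [Finset.mem_filter, id] at hx hxm
  have h2 : (S.filter (fun k => x < k)).Nonempty := ⟨w, by simp [hw, hx.2.2.1]⟩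
  obtain ⟨y, hy, hym⟩ := Finset.exists_min_image _ id h2
  simp only [Finset.mem_filter, id] at hy hym
  refine ⟨x, y, ⟨hx.1, hy.1, hy.2, ?_⟩, ?_⟩
  · intro k hk
    by_cases hkx : k ≤ x
    · exact Or.inl hkx
    · exact Or.inr (hym k ⟨hk, not_le.mp hkx⟩)
  · have hyw : y ≤ w := hym w ⟨hw, hx.2.2.1⟩
    have hfy : f y ≤ f w := by
      rcases eq_or_lt_of_le hyw with h | h
      · rw [h]
      · have hvy : v < y := lt_of_le_of_lt hx.2.1 hy.2
        have h3 := (he y hy.1 hvy h).2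
        by_contra hc
        push Not at hc
        have h4 : f v ≤ f y := by
          by_contra h5
          exact h3 ⟨hc, not_le.mp h5⟩
        exact absurd (hxm y ⟨hy.1, hvy.le, h, h4⟩) (not_le.mpr hy.2)
    have := hx.2.2.2
    rw [abs_of_pos (by omega), abs_of_pos (by omega)]
    omega

theorem jump {α : Type*} [LinearOrder α] (f : α → ℤ) (hf : Function.Injective f)
    (S : Finset α) (v w : α)
    (hv : v ∈ S) (hw : w ∈ S) (h : EmpRect f S v w) :
    ∃ x y, ConsecIn S x y ∧ |f v - f w| ≤ |f x - f y| := by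
  rcases lt_trichotomy (f w) (f v) with h1 | h1 | h1
  · exact jump_aux f S v w hv hw h h1
  · exact absurd (hf h1) h.1.ne'
  · obtain ⟨x, y, hxy, hle⟩ := jump_aux (fun a => - f a) S v w hv hw
      ⟨h.1, fun k hk h2 h3 => by have := h.2 k hk h2 h3; beta_reduce; omega⟩ (by omega)
    refine ⟨x, y, hxy, ?_⟩
    rw [abs_sub_comm (f v), abs_sub_comm (f x)]
    convert hle using 2 <;> ring

theorem exists_good {α : Type*} [LinearOrder α] (f : α → ℤ) (hf : Function.Injective f)
    (S : Finset α) (hS : 2 ≤ S.card) :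
    ∃ u v, ConsecIn S u v ∧
      (∀ w ∈ S, v < w → EmpRect f S u w → EmpRect f S v w →
        (f u < f w ∧ f w < f v) ∨ (f v < f w ∧ f w < f u)) ∧
      (∀ w ∈ S, w < u → EmpRect f S w u → EmpRect f S w v →
        (f u < f w ∧ f w < f v) ∨ (f v < f w ∧ f w < f u)) := by
  classical
  have hne : ((S ×ˢ S).filter (fun p => ConsecIn S p.1 p.2)).Nonempty := by
    obtain ⟨a, ha, b, hb, hab⟩ := Finset.one_lt_card.mp hS
    wlog hlt : a < b generalizing a b
    · exact this b hb a ha hab.symm (lt_of_le_of_ne (not_lt.mp hlt) hab.symm)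
    have h2 : (S.filter (fun k => a < k)).Nonempty := ⟨b, by simp [hb, hlt]⟩
    obtain ⟨y, hy, hym⟩ := Finset.exists_min_image _ id h2
    simp only [Finset.mem_filter, id] at hy hym
    refine ⟨(a, y), ?_⟩
    simp only [Finset.mem_filter, Finset.mem_product]
    refine ⟨⟨ha, hy.1⟩, ha, hy.1, hy.2, fun k hk => ?_⟩
    by_cases hkx : k ≤ a
    · exact Or.inl hkx
    · exact Or.inr (hym k ⟨hk, not_le.mp hkx⟩)
  obtain ⟨⟨u, v⟩, huv, hmax⟩ := Finset.exists_max_image _ (fun p => |f p.1 - f p.2|) hne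
  simp only [Finset.mem_filter, Finset.mem_product] at huv hmax
  obtain ⟨-, hc⟩ := huv
  have key : ∀ x ∈ S, ∀ y ∈ S, EmpRect f S x y → |f x - f y| ≤ |f u - f v| := by
    intro x hx y hy h
    obtain ⟨p, q, hpq, hle⟩ := jump f hf S x y hx hy h
    exact hle.trans (hmax (p, q) ⟨⟨hpq.1, hpq.2.1⟩, hpq⟩)
  obtain ⟨huS, hvS, huv, hcon⟩ := hc
  have hfuv : f u ≠ f v := fun h => huv.ne (hf h)
  refine ⟨u, v, ⟨huS, hvS, huv, hcon⟩, ?_, ?_⟩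
  · intro w hw hvw h1 h2
    have h3 := h1.2 v hvS huv hvw
    have h4 := key v hvS w hw h2
    have h5 : f u ≠ f w := fun h => (huv.trans hvw).ne (hf h)
    have h6 : f v ≠ f w := fun h => hvw.ne (hf h)
    rw [abs_le] at h4
    rcases abs_cases (f u - f v) with ⟨h7, h8⟩ | ⟨h7, h8⟩ <;> omega
  · intro w hw hwu h1 h2
    have h3 := h2.2 u huS hwu huv
    have h4 := key w hw u huS h1
    have h5 : f u ≠ f w := fun h => hwu.ne' (hf h)
    have h6 : f v ≠ f w := fun h => (hwu.trans huv).ne' (hf h)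
    rw [abs_le] at h4
    rcases abs_cases (f u - f v) with ⟨h7, h8⟩ | ⟨h7, h8⟩ <;> omega

open Classical in
noncomputable def edgesIn {α : Type*} [LinearOrder α] (f : α → ℤ) (S : Finset α) :
    Finset (α × α) :=
  (S ×ˢ S).filter (fun p => EmpRect f S p.1 p.2)

theorem edges_step {α : Type*} [LinearOrder α] (f : α → ℤ) (hf : Function.Injective f)
    (S : Finset α) (hS : 2 ≤ S.card) :
    ∃ T ⊆ S, T.card + 2 = S.card ∧ (edgesIn f S).card ≤ (edgesIn f T).card + T.card + 3 := by
  classical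
  obtain ⟨u, v, ⟨huS, hvS, huv, hcon⟩, hR, hL⟩ := exists_good f hf S hS
  set T := (S.erase u).erase v with hT
  have hTS : T ⊆ S := (Finset.erase_subset _ _).trans (Finset.erase_subset _ _)
  have hcard : T.card + 2 = S.card := by
    rw [hT, Finset.card_erase_of_mem (by simp [hvS, huv.ne']), Finset.card_erase_of_mem huS]
    omega
  refine ⟨T, hTS, hcard, ?_⟩
  let N : α → Finset α := fun x => T.filter (fun w => EmpRect f S w x ∨ EmpRect f S x w)
  let m : α → α → α × α := fun x w => if w < x then (w, x) else (x, w)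
  have hmemT : ∀ w, w ∈ T ↔ w ∈ S ∧ w ≠ u ∧ w ≠ v := by
    intro w; simp [hT]; tauto
  have hsub : edgesIn f S ⊆ edgesIn f T ∪ {(u, v)} ∪ (N u).image (m u) ∪ (N v).image (m v) := by
    rintro ⟨i, j⟩ hij
    simp only [edgesIn, Finset.mem_filter, Finset.mem_product] at hij
    obtain ⟨⟨hi, hj⟩, hE⟩ := hij
    have hlt := hE.1
    simp only [Finset.mem_union, Finset.mem_singleton, Finset.mem_image]
    by_cases hiT : i ∈ T
    · by_cases hjT : j ∈ T
      · left; left; left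
        simp only [edgesIn, Finset.mem_filter, Finset.mem_product]
        exact ⟨⟨hiT, hjT⟩, hE.1, fun k hk => hE.2 k (hTS hk)⟩
      · have : j = u ∨ j = v := by
          rw [hmemT] at hjT; tauto
        rcases this with rfl | rfl
        · left; right
          exact ⟨i, by simp [N, hiT, hE], by simp [m, hlt]⟩
        · right
          exact ⟨i, by simp [N, hiT, hE], by simp [m, hlt]⟩
    · have hi' : i = u ∨ i = v := by
        rw [hmemT] at hiT; tauto
      by_cases hjT : j ∈ T
      · rcases hi' with rfl | rfl
        · left; right
          exact ⟨j, by simp [N, hjT, hE], by simp [m, hlt.not_gt]⟩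
        · right
          exact ⟨j, by simp [N, hjT, hE], by simp [m, hlt.not_gt]⟩
      · have hj' : j = u ∨ j = v := by
          rw [hmemT] at hjT; tauto
        left; left; right
        rcases hi' with rfl | rfl <;> rcases hj' with rfl | rfl
        · exact absurd hlt (lt_irrefl _)
        · rfl
        · exact absurd hlt huv.not_gt
        · exact absurd hlt (lt_irrefl _)
  have hcommon : (N u ∩ N v).card ≤ 2 := by
    have hs : N u ∩ N v ⊆ (N u ∩ N v).filter (fun w => v < w) ∪
        (N u ∩ N v).filter (fun w => w < u) := by
      intro w hw
      have hwT : w ∈ T := by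
        simp only [N, Finset.mem_inter, Finset.mem_filter] at hw; exact hw.1.1
      rw [hmemT] at hwT
      simp only [Finset.mem_union, Finset.mem_filter, hw, true_and]
      rcases hcon w hwT.1 with h | h
      · right; exact lt_of_le_of_ne h hwT.2.1
      · left; exact lt_of_le_of_ne h (Ne.symm hwT.2.2)
    have cR : ((N u ∩ N v).filter (fun w => v < w)).card ≤ 1 := by
      have aux : ∀ w ∈ (N u ∩ N v).filter (fun w => v < w), w ∈ S ∧ v < w ∧
          EmpRect f S u w ∧ EmpRect f S v w := by
        intro w hw
        simp only [N, Finset.mem_inter, Finset.mem_filter] at hw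
        obtain ⟨⟨⟨h1, h2⟩, -, h3⟩, h4⟩ := hw
        refine ⟨hTS h1, h4, h2.resolve_left fun h => ?_, h3.resolve_left fun h => ?_⟩
        · exact absurd h.1 (huv.trans h4).not_gt
        · exact absurd h.1 h4.not_gt
      have main : ∀ w w', w ∈ (N u ∩ N v).filter (fun w => v < w) →
          w' ∈ (N u ∩ N v).filter (fun w => v < w) → ¬ w < w' := by
        intro w w' hw hw' hlt
        obtain ⟨a1, a2, a3, a4⟩ := aux w hw
        obtain ⟨b1, b2, b3, b4⟩ := aux w' hw'
        have c1 := hR w a1 a2 a3 a4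
        have c2 := hR w' b1 b2 b3 b4
        have c3 := b3.2 w a1 (huv.trans a2) hlt
        have c4 := b4.2 w a1 a2 hlt
        have c5 : f w ≠ f w' := fun h => hlt.ne (hf h)
        omega
      rw [Finset.card_le_one]
      intro w hw w' hw'
      exact le_antisymm (not_lt.mp (main _ _ hw' hw)) (not_lt.mp (main _ _ hw hw'))
    have cL : ((N u ∩ N v).filter (fun w => w < u)).card ≤ 1 := by
      have aux : ∀ w ∈ (N u ∩ N v).filter (fun w => w < u), w ∈ S ∧ w < u ∧
          EmpRect f S w u ∧ EmpRect f S w v := by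
        intro w hw
        simp only [N, Finset.mem_inter, Finset.mem_filter] at hw
        obtain ⟨⟨⟨h1, h2⟩, -, h3⟩, h4⟩ := hw
        refine ⟨hTS h1, h4, h2.resolve_right fun h => ?_, h3.resolve_right fun h => ?_⟩
        · exact absurd h.1 h4.not_gt
        · exact absurd h.1 (h4.trans huv).not_gt
      have main : ∀ w w', w ∈ (N u ∩ N v).filter (fun w => w < u) →
          w' ∈ (N u ∩ N v).filter (fun w => w < u) → ¬ w < w' := by
        intro w w' hw hw' hlt
        obtain ⟨a1, a2, a3, a4⟩ := aux w hw
        obtain ⟨b1, b2, b3, b4⟩ := aux w' hw'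
        have c1 := hL w a1 a2 a3 a4
        have c2 := hL w' b1 b2 b3 b4
        have c3 := a3.2 w' b1 hlt b2
        have c4 := a4.2 w' b1 hlt (b2.trans huv)
        have c5 : f w ≠ f w' := fun h => hlt.ne (hf h)
        omega
      rw [Finset.card_le_one]
      intro w hw w' hw'
      exact le_antisymm (not_lt.mp (main _ _ hw' hw)) (not_lt.mp (main _ _ hw hw'))
    have := (Finset.card_le_card hs).trans (Finset.card_union_le _ _)
    omega
  have hun : (N u ∪ N v).card ≤ T.card :=
    Finset.card_le_card (Finset.union_subset (Finset.filter_subset _ _) (Finset.filter_subset _ _))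
  have hie := Finset.card_union_add_card_inter (N u) (N v)
  have e1 := Finset.card_le_card hsub
  have e2 := Finset.card_union_le (edgesIn f T ∪ {(u, v)} ∪ (N u).image (m u)) ((N v).image (m v))
  have e3 := Finset.card_union_le (edgesIn f T ∪ {(u, v)}) ((N u).image (m u))
  have e4 := Finset.card_union_le (edgesIn f T) {(u, v)}
  have e5 := Finset.card_image_le (s := N u) (f := m u)
  have e6 := Finset.card_image_le (s := N v) (f := m v)
  rw [Finset.card_singleton] at e4
  omega

theorem edges_small {α : Type*} [LinearOrder α] (f : α → ℤ) (S : Finset α) :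
    2 * (edgesIn f S).card + S.card ≤ S.card * S.card := by
  classical
  have h1 : (edgesIn f S).card = ((edgesIn f S).image Prod.swap).card :=
    (Finset.card_image_of_injective _ Prod.swap_injective).symm
  have h2 : Disjoint (edgesIn f S) ((edgesIn f S).image Prod.swap) := by
    rw [Finset.disjoint_left]
    rintro ⟨i, j⟩ h h'
    simp only [edgesIn, Finset.mem_filter, Finset.mem_image, Prod.exists, Prod.swap_prod_mk,
      Prod.mk.injEq] at h h'
    obtain ⟨a, b, hab, rfl, rfl⟩ := h'
    exact absurd hab.2.1 h.2.1.not_gt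
  have h3 : edgesIn f S ∪ (edgesIn f S).image Prod.swap ⊆ S.offDiag := by
    rintro ⟨i, j⟩ h
    simp only [edgesIn, Finset.mem_union, Finset.mem_filter, Finset.mem_image, Prod.exists,
      Prod.swap_prod_mk, Prod.mk.injEq, Finset.mem_product] at h
    rw [Finset.mem_offDiag]
    rcases h with h | ⟨a, b, hab, rfl, rfl⟩
    · exact ⟨h.1.1, h.1.2, h.2.1.ne⟩
    · exact ⟨hab.1.2, hab.1.1, hab.2.1.ne'⟩
  have h4 := Finset.card_le_card h3
  rw [Finset.card_union_of_disjoint h2, ← h1, Finset.offDiag_card] at h4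
  have : S.card ≤ S.card * S.card := Nat.le_mul_self _
  omega

theorem edges_bound {α : Type*} [LinearOrder α] (f : α → ℤ) (hf : Function.Injective f) (n : ℕ) :
    ∀ S : Finset α, S.card = n + 2 → (edgesIn f S).card + 2 ≤ (n + 2) ^ 2 / 4 + (n + 2) := by
  induction n using Nat.strong_induction_on with
  | _ n ih =>
    intro S hS
    rcases Nat.lt_or_ge n 2 with h | h
    · have := edges_small f S
      rw [hS] at this
      interval_cases n <;> omega
    · obtain ⟨k, rfl⟩ := Nat.exists_eq_add_of_le' h
      obtain ⟨T, -, hT, hle⟩ := edges_step f hf S (by omega)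
      have := ih k (by omega) T (by omega)
      have e : (k + 2 + 2) ^ 2 = (k + 2) ^ 2 + (k + 3) * 4 := by ring
      rw [e, Nat.add_mul_div_right _ _ (by norm_num)]
      omega

theorem inv_grow {n : ℕ} (g g' : Fin n → Fin n) (hg : Function.Injective g) (A B C : Fin n)
    (hAC : A < C) (hCB : C < B) (gAC : g A < g C) (gCB : g C < g B)
    (hA : g' A = g B) (hB : g' B = g A) (ho : ∀ x, x ≠ A → x ≠ B → g' x = g x) :
    (Finset.univ.filter (fun p : Fin n × Fin n => p.1 < p.2 ∧ g p.2 < g p.1)).card + 2 ≤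
    (Finset.univ.filter (fun p : Fin n × Fin n => p.1 < p.2 ∧ g' p.2 < g' p.1)).card := by
  classical
  let φ : Fin n × Fin n → Fin n × Fin n := fun p =>
    if p.1 = B ∧ g A < g p.2 then (A, p.2) else
    if p.2 = A ∧ g p.1 < g B then (p.1, B) else p
  set I := Finset.univ.filter (fun p : Fin n × Fin n => p.1 < p.2 ∧ g p.2 < g p.1) with hI
  set I' := Finset.univ.filter (fun p : Fin n × Fin n => p.1 < p.2 ∧ g' p.2 < g' p.1) with hI'
  have hAB := hAC.trans hCB
  have gAB := gAC.trans gCB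
  have hgC := ho C hAC.ne' hCB.ne
  have hinj : Set.InjOn φ I := by
    rintro ⟨p, q⟩ h ⟨p', q'⟩ h' he
    simp only [hI, Finset.coe_filter, Finset.mem_univ, true_and, Set.mem_ofPred_eq] at h h'
    simp only [φ] at he
    grind
  have hmaps : ∀ p ∈ I, φ p ∈ (I'.erase (A, B)).erase (A, C) := by
    rintro ⟨p, q⟩ h
    simp only [hI, Finset.mem_filter, Finset.mem_univ, true_and] at h
    obtain ⟨h1, h2⟩ := h
    simp only [hI', Finset.mem_erase, Finset.mem_filter, Finset.mem_univ, true_and, φ]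
    have e1 := ho p
    have e2 := ho q
    clear hinj ho hI hI'
    have i1 := @hg p A
    have i2 := @hg q A
    have i3 := @hg p B
    have i4 := @hg q B
    clear hg
    split_ifs with c1 c2
    · simp only [ne_eq, Prod.mk.injEq, true_and]
      grind
    · simp only [ne_eq, Prod.mk.injEq]
      grind
    · simp only [ne_eq, Prod.mk.injEq]
      by_cases p = A <;> by_cases p = B <;> by_cases q = A <;> by_cases q = B <;> grind
  have hle := Finset.card_le_card_of_injOn φ hmaps hinj
  have m1 : (A, B) ∈ I' := by simp [hI', hAB, hA, hB, gAB]
  have m2 : (A, C) ∈ I'.erase (A, B) := by simp [hI', hAC, hA, hgC, gCB, hCB.ne]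
  have c1 := Finset.card_erase_add_one m1
  have c2 := Finset.card_erase_add_one m2
  omega

theorem inv_perm {n : ℕ} (π : Equiv.Perm (Fin n)) (a b c : Fin n) (hac : a < c) (hcb : c < b)
    (h1 : π.symm a < π.symm c) (h2 : π.symm c < π.symm b) :
    invNum π + 2 ≤ invNum (Equiv.swap a b * π) := by
  apply inv_grow π (Equiv.swap a b * π : Equiv.Perm (Fin n)) π.injective _ _ _ h1 h2
  · simpa using hac
  · simpa using hcb
  · simp
  · simp
  · intro x hxa hxb
    rw [Equiv.Perm.mul_apply]
    apply Equiv.swap_apply_of_ne_of_ne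
    · rintro rfl; simp at hxa
    · rintro rfl; simp at hxb

theorem inv_perm' {n : ℕ} (π : Equiv.Perm (Fin n)) (a b c : Fin n) (hac : a < c) (hcb : c < b)
    (h1 : π.symm b < π.symm c) (h2 : π.symm c < π.symm a) :
    invNum (Equiv.swap a b * π) + 2 ≤ invNum π := by
  have hs : ∀ x, (Equiv.swap a b * π).symm x = π.symm (Equiv.swap a b x) := by
    intro x
    rw [Equiv.symm_apply_eq]
    simp
  have hc : Equiv.swap a b c = c := Equiv.swap_apply_of_ne_of_ne hac.ne' hcb.ne
  have := inv_perm (Equiv.swap a b * π) a b c hac hcb (by simpa [hs, hc] using h1)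
    (by simpa [hs, hc] using h2)
  rwa [← mul_assoc, Equiv.swap_mul_self, one_mul] at this

theorem totalDeg_le {n : ℕ} (hn : 2 ≤ n) (π : Equiv.Perm (Fin n)) :
    totalDeg π ≤ n ^ 2 / 4 + n - 2 := by
  classical
  have hf : Function.Injective (fun i : Fin n => ((π.symm i : ℕ) : ℤ)) := by
    intro i j h
    have h' : ((π.symm i : ℕ) : ℤ) = ((π.symm j : ℕ) : ℤ) := h
    exact π.symm.injective (Fin.ext (by exact_mod_cast h'))
  obtain ⟨k, rfl⟩ := Nat.exists_eq_add_of_le' hn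
  have hb := edges_bound _ hf k Finset.univ (by simp)
  have hle : totalDeg π ≤
      (edgesIn (fun i : Fin (k + 2) => ((π.symm i : ℕ) : ℤ)) Finset.univ).card := by
    apply Finset.card_le_card
    rintro ⟨a, b⟩ h
    simp only [Finset.mem_filter, Finset.mem_univ, true_and] at h
    obtain ⟨hab, h⟩ := h
    simp only [edgesIn, Finset.mem_filter, Finset.mem_product, Finset.mem_univ, true_and]
    refine ⟨hab, fun c _ hac hcb => ⟨?_, ?_⟩⟩
    · rintro ⟨h1, h2⟩
      beta_reduce at h1 h2
      have := inv_perm π a b c hac hcb (by exact_mod_cast h1) (by exact_mod_cast h2)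
      omega
    · rintro ⟨h1, h2⟩
      beta_reduce at h1 h2
      have := inv_perm' π a b c hac hcb (by exact_mod_cast h1) (by exact_mod_cast h2)
      omega
  omega
end

section
/- For n ≥ 2 and m = ⌊n/2⌋, the permutation π = [m+1, m+2, ..., n, 1, 2, ..., m] satisfies d(π) = ⌊n²/4⌋ + n − 2; hence the maximum total degree in the Hasse diagram of the strong Bruhat order on S_n equals ⌊n²/4⌋ + n − 2. -/
open Equiv Finset

/-- Strictly between, in either order. -/
def StrBtw {α : Type*} [LT α] (x k y : α) : Prop := (x < k ∧ k < y) ∨ (y < k ∧ k < x)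

/-- Empty-rectangle adjacency inside `S`. -/
def RAdj {n : ℕ} (f : Fin n → Fin n) (S : Finset (Fin n)) (x y : Fin n) : Prop :=
  ∀ k ∈ S, ¬ (StrBtw x k y ∧ StrBtw (f x) (f k) (f y))

open Classical in
/-- Edges of the empty-rectangle graph. -/
noncomputable def redges {n : ℕ} (f : Fin n → Fin n) (S : Finset (Fin n)) :
    Finset (Fin n × Fin n) :=
  (S ×ˢ S).filter (fun p => p.1 < p.2 ∧ RAdj f S p.1 p.2)

theorem radj_symm {n : ℕ} {f : Fin n → Fin n} {S : Finset (Fin n)} {x y : Fin n}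
    (h : RAdj f S x y) : RAdj f S y x := by
  intro k hk
  have := h k hk
  unfold StrBtw at *
  tauto

theorem no_two {n : ℕ} {u v w w' fu fv fw fw' : Fin n} (hwu : w ≠ u) (hwu' : w' ≠ u)
    (hwv : w ≠ v) (hwv' : w' ≠ v) (hvu : v ≠ u) (c5 : fw ≠ fw') (heq : w < u ↔ w' < u)
    (l1 : fw < fv) (l2 : fw' < fv) (l3 : fu < fw) (l4 : fu < fw') (q : w < w')
    (d1 : ¬ (StrBtw u w v ∧ StrBtw fu fw fv)) (d2 : ¬ (StrBtw u w' v ∧ StrBtw fu fw' fv))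
    (d3 : ¬ (StrBtw u w' w ∧ StrBtw fu fw' fw)) (d4 : ¬ (StrBtw v w' w ∧ StrBtw fv fw' fw))
    (d5 : ¬ (StrBtw u w w' ∧ StrBtw fu fw fw')) (d6 : ¬ (StrBtw v w w' ∧ StrBtw fv fw fw')) :
    False := by
  have e1 : ¬ StrBtw u w v := fun h => d1 ⟨h, Or.inl ⟨l3, l1⟩⟩
  have e2 : ¬ StrBtw u w' v := fun h => d2 ⟨h, Or.inl ⟨l4, l2⟩⟩
  clear d1 d2
  rcases lt_or_gt_of_ne c5 with r | r
  · have e5 : ¬ StrBtw u w w' := fun h => d5 ⟨h, Or.inl ⟨l3, r⟩⟩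
    have e4 : ¬ StrBtw v w' w := fun h => d4 ⟨h, Or.inr ⟨r, l2⟩⟩
    clear d3 d4 d5 d6
    unfold StrBtw at *
    omega
  · have e3 : ¬ StrBtw u w' w := fun h => d3 ⟨h, Or.inl ⟨l4, r⟩⟩
    have e6 : ¬ StrBtw v w w' := fun h => d6 ⟨h, Or.inr ⟨r, l1⟩⟩
    clear d3 d4 d5 d6
    unfold StrBtw at *
    omega

open Classical in
theorem good_pair {n : ℕ} (f : Fin n → Fin n) (hf : Function.Injective f)
    (S : Finset (Fin n)) (hS : 2 ≤ S.card) :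
    ∃ u ∈ S, ∃ v ∈ S, u ≠ v ∧
      (((S.erase u).erase v).filter (fun w => RAdj f S u w ∧ RAdj f S v w)).card ≤ 2 := by
  obtain ⟨u, hu, hmin⟩ := Finset.exists_min_image S f (Finset.card_pos.1 (by omega))
  have hne : (S.erase u).Nonempty := by
    rw [← Finset.card_pos, Finset.card_erase_of_mem hu]; omega
  obtain ⟨t, ht, htmin⟩ := Finset.exists_min_image (S.erase u) f hne
  have hN : ((S.erase u).filter (fun w => RAdj f S u w)).Nonempty := by
    refine ⟨t, Finset.mem_filter.2 ⟨ht, ?_⟩⟩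
    intro k hk hb
    have h1 := hmin k hk
    have h3 := hmin t (Finset.mem_of_mem_erase ht)
    by_cases hku : k = u
    · subst hku; unfold StrBtw at hb; omega
    · have h2 := htmin k (Finset.mem_erase.2 ⟨hku, hk⟩)
      unfold StrBtw at hb; omega
  obtain ⟨v, hv, hmax⟩ := Finset.exists_max_image _ f hN
  rw [Finset.mem_filter, Finset.mem_erase] at hv
  obtain ⟨⟨hvu, hvS⟩, huv⟩ := hv
  refine ⟨u, hu, v, hvS, hvu.symm, ?_⟩
  have hinj : Set.InjOn (fun w => decide (w < u))
      ((((S.erase u).erase v).filter (fun w => RAdj f S u w ∧ RAdj f S v w) : Finset (Fin n)) :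
        Set (Fin n)) := by
    intro w hw w' hw' heq
    simp only [Finset.coe_filter, Set.mem_ofPred_eq, Finset.mem_erase] at hw hw'
    obtain ⟨⟨hwv, hwu, hwS⟩, huw, hvw⟩ := hw
    obtain ⟨⟨hwv', hwu', hwS'⟩, huw', hvw'⟩ := hw'
    by_contra hne
    have a1 := hmax w (by simp [hwu, hwS, huw])
    have a2 := hmax w' (by simp [hwu', hwS', huw'])
    have b1 := hmin w hwS
    have b2 := hmin w' hwS'
    have b3 := hmin v hvS
    have c1 : f w ≠ f u := fun h => hwu (hf h)
    have c2 : f w' ≠ f u := fun h => hwu' (hf h)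
    have c3 : f w ≠ f v := fun h => hwv (hf h)
    have c4 : f w' ≠ f v := fun h => hwv' (hf h)
    have c5 : f w ≠ f w' := fun h => hne (hf h)
    have c6 : f v ≠ f u := fun h => hvu (hf h)
    have heq' : w < u ↔ w' < u := by simpa using heq
    have l1 := lt_of_le_of_ne a1 c3
    have l2 := lt_of_le_of_ne a2 c4
    have l3 := lt_of_le_of_ne b1 c1.symm
    have l4 := lt_of_le_of_ne b2 c2.symm
    rcases lt_or_gt_of_ne hne with q | q
    · exact no_two hwu hwu' hwv hwv' hvu c5 heq' l1 l2 l3 l4 q (huv w hwS) (huv w' hwS')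
        (huw w' hwS') (hvw w' hwS') (huw' w hwS) (hvw' w hwS)
    · exact no_two hwu' hwu hwv' hwv hvu c5.symm heq'.symm l2 l1 l4 l3 q (huv w' hwS')
        (huv w hwS) (huw' w hwS) (hvw' w hwS) (huw w' hwS') (hvw w' hwS')
  have := Finset.card_le_card_of_injOn (t := (Finset.univ : Finset Bool)) _
    (fun _ _ => Finset.mem_coe.2 (Finset.mem_univ _)) hinj
  simpa using this

open Classical in
theorem edges_step_s11 {n : ℕ} (f : Fin n → Fin n) (S : Finset (Fin n)) (u v : Fin n)
    (hu : u ∈ S) (hv : v ∈ S) (huv : u ≠ v)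
    (h : (((S.erase u).erase v).filter (fun w => RAdj f S u w ∧ RAdj f S v w)).card ≤ 2) :
    (redges f S).card ≤ (redges f ((S.erase u).erase v)).card + 1 + (S.card - 2)
      + min 2 (S.card - 2) := by
  set T := (S.erase u).erase v with hT
  have hTc : T.card = S.card - 2 := by
    rw [hT, Finset.card_erase_of_mem (by simp [hv, huv.symm]), Finset.card_erase_of_mem hu]
    omega
  have hTS : T ⊆ S := (Finset.erase_subset _ _).trans (Finset.erase_subset _ _)
  set A := T.filter (fun w => RAdj f S u w)
  set B := T.filter (fun w => RAdj f S v w)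
  let pr : Fin n → Fin n → Fin n × Fin n := fun a b => (min a b, max a b)
  have hsub : redges f S ⊆ redges f T ∪ {pr u v} ∪ (A.image (pr u) ∪ B.image (pr v)) := by
    rintro ⟨x, y⟩ hxy
    simp only [redges, Finset.mem_filter, Finset.mem_product] at hxy
    obtain ⟨⟨hx, hy⟩, hlt, hadj⟩ := hxy
    have hadj' := radj_symm hadj
    have m1 : x ≠ u → x ≠ v → x ∈ T := fun h1 h2 => by simp [hT, h1, h2, hx]
    have m2 : y ≠ u → y ≠ v → y ∈ T := fun h1 h2 => by simp [hT, h1, h2, hy]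
    have pxy : pr x y = (x, y) := by simp [pr, hlt.le]
    have pyx : pr y x = (x, y) := by simp [pr, hlt.le]
    by_cases hxu : x = u
    · by_cases hyv : y = v
      · simp [← hxu, ← hyv, pxy]
      · have : y ∈ A := by
          refine Finset.mem_filter.2 ⟨m2 (fun h => by omega) hyv, hxu ▸ hadj⟩
        refine Finset.mem_union_right _ (Finset.mem_union_left _ (Finset.mem_image.2 ⟨y, this, ?_⟩))
        rw [← hxu, pxy]
    by_cases hxv : x = v
    · by_cases hyu : y = u
      · simp [← hxv, ← hyu, pyx]
      · have : y ∈ B := by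
          refine Finset.mem_filter.2 ⟨m2 hyu (fun h => by omega), hxv ▸ hadj⟩
        refine Finset.mem_union_right _ (Finset.mem_union_right _ (Finset.mem_image.2 ⟨y, this, ?_⟩))
        rw [← hxv, pxy]
    have hxT := m1 hxu hxv
    by_cases hyu : y = u
    · have : x ∈ A := Finset.mem_filter.2 ⟨hxT, hyu ▸ hadj'⟩
      refine Finset.mem_union_right _ (Finset.mem_union_left _ (Finset.mem_image.2 ⟨x, this, ?_⟩))
      rw [← hyu, pyx]
    by_cases hyv : y = v
    · have : x ∈ B := Finset.mem_filter.2 ⟨hxT, hyv ▸ hadj'⟩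
      refine Finset.mem_union_right _ (Finset.mem_union_right _ (Finset.mem_image.2 ⟨x, this, ?_⟩))
      rw [← hyv, pyx]
    refine Finset.mem_union_left _ (Finset.mem_union_left _ ?_)
    simp only [redges, Finset.mem_filter, Finset.mem_product]
    exact ⟨⟨hxT, m2 hyu hyv⟩, hlt, fun k hk => hadj k (hTS hk)⟩
  have h1 := Finset.card_le_card hsub
  have h2 := Finset.card_union_le (redges f T ∪ {pr u v}) (A.image (pr u) ∪ B.image (pr v))
  have h3 := Finset.card_union_le (redges f T) {pr u v}
  have h4 := Finset.card_union_le (A.image (pr u)) (B.image (pr v))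
  have h5 : (A.image (pr u)).card ≤ A.card := Finset.card_image_le
  have h6 : (B.image (pr v)).card ≤ B.card := Finset.card_image_le
  have h7 := Finset.card_union_add_card_inter A B
  have h8 : (A ∪ B).card ≤ T.card :=
    Finset.card_le_card (Finset.union_subset (Finset.filter_subset _ _) (Finset.filter_subset _ _))
  have h9 : (A ∩ B).card ≤ T.card :=
    Finset.card_le_card (Finset.inter_subset_left.trans (Finset.filter_subset _ _))
  have h10 : (A ∩ B).card ≤ 2 := by
    rw [← Finset.filter_and]; exact h
  rw [Finset.card_singleton] at h3
  omega

theorem redges_small {n : ℕ} (f : Fin n → Fin n) (S : Finset (Fin n)) (hS : S.card ≤ 1) :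
    (redges f S).card = 0 := by
  rw [Finset.card_eq_zero, Finset.eq_empty_iff_forall_notMem]
  rintro ⟨x, y⟩ hxy
  simp only [redges, Finset.mem_filter, Finset.mem_product] at hxy
  have := Finset.card_le_one.1 hS x hxy.1.1 y hxy.1.2
  exact absurd hxy.2.1 (by simp [this])

theorem edges_le {n : ℕ} (f : Fin n → Fin n) (hf : Function.Injective f)
    (S : Finset (Fin n)) (hS : 2 ≤ S.card) :
    (redges f S).card ≤ S.card ^ 2 / 4 + S.card - 2 := by
  induction hc : S.card using Nat.strong_induction_on generalizing S with
  | _ c ih =>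
    obtain ⟨u, hu, v, hv, huv, h⟩ := good_pair f hf S hS
    have hst := edges_step_s11 f S u v hu hv huv h
    set T := (S.erase u).erase v with hT
    have hTc : T.card = S.card - 2 := by
      rw [hT, Finset.card_erase_of_mem (by simp [hv, huv.symm]), Finset.card_erase_of_mem hu]
      omega
    by_cases h4 : 4 ≤ c
    · have h5 := ih (c - 2) (by omega) T (by omega) (by omega)
      obtain ⟨d, rfl⟩ : ∃ d, c = d + 2 := ⟨c - 2, by omega⟩
      have e : (d + 2) ^ 2 = d ^ 2 + 4 * (d + 1) := by ring
      rw [e, Nat.add_mul_div_left _ _ (by norm_num)]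
      simp only [Nat.add_sub_cancel] at h5
      omega
    · have h5 := redges_small f T (by omega)
      have : c = 2 ∨ c = 3 := by omega
      rcases this with rfl | rfl <;> norm_num <;> omega

/-- Inversion indicator. -/
def hInv {n : ℕ} (σ : Equiv.Perm (Fin n)) (x y : Fin n) : ℕ :=
  if x < y ∧ σ y < σ x then 1 else 0

theorem invNum_split {n : ℕ} (σ : Equiv.Perm (Fin n)) (i j : Fin n) (hij : i ≠ j) :
    invNum σ = (∑ x ∈ (Finset.univ.erase i).erase j, ∑ y ∈ (Finset.univ.erase i).erase j,
        hInv σ x y) +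
      (∑ c ∈ (Finset.univ.erase i).erase j,
        (hInv σ i c + hInv σ c i + hInv σ j c + hInv σ c j)) +
      (hInv σ i j + hInv σ j i) := by
  have h0 : invNum σ = ∑ x, ∑ y, hInv σ x y := by
    unfold invNum hInv
    rw [Finset.card_filter, ← Finset.univ_product_univ, Finset.sum_product]
  have hs : ∀ g : Fin n → ℕ, ∑ x, g x =
      (∑ x ∈ (Finset.univ.erase i).erase j, g x) + g j + g i := by
    intro g
    rw [Finset.sum_erase_add _ _ (by simp [hij.symm]), Finset.sum_erase_add _ _ (by simp)]
  have hd : ∀ x, hInv σ x x = 0 := by simp [hInv]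
  rw [h0, hs]
  simp only [hs (hInv σ _), hd, Finset.sum_add_distrib]
  ring

open Classical in
theorem invNum_swap_s11 {n : ℕ} (σ : Equiv.Perm (Fin n)) (i j : Fin n) (hij : i < j)
    (hs : σ i < σ j) :
    invNum (σ * Equiv.swap i j) = invNum σ + 1 +
      2 * (Finset.univ.filter (fun k => i < k ∧ k < j ∧ σ i < σ k ∧ σ k < σ j)).card := by
  have hset : (Finset.univ.filter (fun k => i < k ∧ k < j ∧ σ i < σ k ∧ σ k < σ j)) =
      ((Finset.univ.erase i).erase j).filter
        (fun k => i < k ∧ k < j ∧ σ i < σ k ∧ σ k < σ j) := by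
    ext k
    simp only [Finset.mem_filter, Finset.mem_erase, Finset.mem_univ, true_and, and_true]
    constructor
    · intro h; exact ⟨⟨h.2.1.ne, h.1.ne'⟩, h⟩
    · exact fun h => h.2
  rw [hset, Finset.card_filter, Finset.mul_sum, invNum_split _ i j hij.ne,
    invNum_split σ i j hij.ne]
  have e1 : ∀ x ∈ (Finset.univ.erase i).erase j, (σ * Equiv.swap i j) x = σ x := by
    intro x hx
    simp only [Finset.mem_erase, Finset.mem_univ, and_true] at hx
    simp [Equiv.swap_apply_of_ne_of_ne hx.2 hx.1]
  have ei : (σ * Equiv.swap i j) i = σ j := by simp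
  have ej : (σ * Equiv.swap i j) j = σ i := by simp
  have t1 : (∑ x ∈ (Finset.univ.erase i).erase j, ∑ y ∈ (Finset.univ.erase i).erase j,
        hInv (σ * Equiv.swap i j) x y) = (∑ x ∈ (Finset.univ.erase i).erase j,
        ∑ y ∈ (Finset.univ.erase i).erase j, hInv σ x y) := by
    refine Finset.sum_congr rfl fun x hx => Finset.sum_congr rfl fun y hy => ?_
    unfold hInv
    rw [e1 x hx, e1 y hy]
  have t2 : (∑ c ∈ (Finset.univ.erase i).erase j,
        (hInv (σ * Equiv.swap i j) i c + hInv (σ * Equiv.swap i j) c i +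
          hInv (σ * Equiv.swap i j) j c + hInv (σ * Equiv.swap i j) c j)) =
      (∑ c ∈ (Finset.univ.erase i).erase j,
        (hInv σ i c + hInv σ c i + hInv σ j c + hInv σ c j)) +
      ∑ c ∈ (Finset.univ.erase i).erase j,
        2 * (if i < c ∧ c < j ∧ σ i < σ c ∧ σ c < σ j then 1 else 0) := by
    rw [← Finset.sum_add_distrib]
    refine Finset.sum_congr rfl fun c hc => ?_
    unfold hInv
    rw [e1 c hc, ei, ej]
    simp only [Finset.mem_erase, Finset.mem_univ, and_true] at hc
    have n1 : σ c ≠ σ i := fun h => hc.2 (σ.injective h)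
    have n2 : σ c ≠ σ j := fun h => hc.1 (σ.injective h)
    obtain ⟨c1, c2⟩ := hc
    clear e1 ei ej hset t1
    generalize σ c = sc at *
    generalize σ i = si at *
    generalize σ j = sj at *
    rcases lt_or_gt_of_ne c1 with q1 | q1 <;> rcases lt_or_gt_of_ne c2 with q2 | q2 <;>
      rcases lt_or_gt_of_ne n1 with q3 | q3 <;> rcases lt_or_gt_of_ne n2 with q4 | q4 <;>
      first
      | omega
      | simp [q1, q2, q3, q4, not_lt_of_gt q1, not_lt_of_gt q2,
          not_lt_of_gt q3, not_lt_of_gt q4]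
  have t3 : hInv (σ * Equiv.swap i j) i j + hInv (σ * Equiv.swap i j) j i = 1 := by
    unfold hInv; rw [ei, ej]; simp [hij, hs, hij.le]
  have t4 : hInv σ i j + hInv σ j i = 0 := by
    unfold hInv; simp [hs.le, hij.le]
  rw [t1, t2, t3, t4]
  ring

open Classical in
theorem cover_iff {n : ℕ} (σ : Equiv.Perm (Fin n)) (a b : Fin n) (hab : a < b) :
    (invNum (Equiv.swap a b * σ) + 1 = invNum σ ∨ invNum (Equiv.swap a b * σ) = invNum σ + 1) ↔
      RAdj (fun x => σ.symm x) Finset.univ a b := by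
  obtain ⟨i, rfl⟩ := σ.surjective a
  obtain ⟨j, rfl⟩ := σ.surjective b
  have hsw : Equiv.swap (σ i) (σ j) * σ = σ * Equiv.swap i j := by
    rw [Equiv.mul_swap_eq_swap_mul]
  rw [hsw]
  have hne : i ≠ j := fun h => by simp [h] at hab
  have hR : RAdj (fun x => σ.symm x) Finset.univ (σ i) (σ j) ↔
      ∀ k, ¬ (StrBtw i k j ∧ StrBtw (σ i) (σ k) (σ j)) := by
    unfold RAdj
    constructor
    · intro h k hk
      exact h (σ k) (Finset.mem_univ _) ⟨hk.2, by simpa using hk.1⟩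
    · intro h k _ hk
      refine h (σ.symm k) ⟨by simpa using hk.2, by simpa using hk.1⟩
  rw [hR]
  rcases lt_or_gt_of_ne hne with hij | hij
  · have := invNum_swap_s11 σ i j hij hab
    have hz : (invNum (σ * Equiv.swap i j) + 1 = invNum σ ∨
        invNum (σ * Equiv.swap i j) = invNum σ + 1) ↔
        (Finset.univ.filter (fun k => i < k ∧ k < j ∧ σ i < σ k ∧ σ k < σ j)).card = 0 := by
      omega
    rw [hz, Finset.card_eq_zero, Finset.filter_eq_empty_iff]
    refine forall_congr' fun k => ?_
    simp only [Finset.mem_univ, true_imp_iff, StrBtw]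
    omega
  · have := invNum_swap_s11 (σ * Equiv.swap i j) j i hij (by simpa using hab)
    have hcanc : σ * Equiv.swap i j * Equiv.swap j i = σ := by
      rw [Equiv.swap_comm j i, mul_assoc, Equiv.swap_mul_self, mul_one]
    rw [hcanc] at this
    have hz : (invNum (σ * Equiv.swap i j) + 1 = invNum σ ∨
        invNum (σ * Equiv.swap i j) = invNum σ + 1) ↔
        (Finset.univ.filter (fun k => j < k ∧ k < i ∧
          (σ * Equiv.swap i j) j < (σ * Equiv.swap i j) k ∧
          (σ * Equiv.swap i j) k < (σ * Equiv.swap i j) i)).card = 0 := by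
      omega
    rw [hz, Finset.card_eq_zero, Finset.filter_eq_empty_iff]
    refine forall_congr' fun k => ?_
    simp only [Finset.mem_univ, true_imp_iff, StrBtw]
    by_cases hk : j < k ∧ k < i
    · have : Equiv.swap i j k = k := Equiv.swap_apply_of_ne_of_ne hk.2.ne hk.1.ne'
      simp only [Equiv.Perm.mul_apply, this, Equiv.swap_apply_left, Equiv.swap_apply_right]
      have h2 : ¬ (σ j < σ k ∧ σ k < σ i) := fun h => absurd (h.1.trans h.2) (not_lt_of_gt hab)
      simp only [h2, hk.1, hk.2, true_and, or_false, or_true]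
    · have h1 : ¬ (i < k ∧ k < j ∨ j < k ∧ k < i) := by omega
      constructor
      · intro _ h
        exact h1 h.1
      · intro _ h
        exact hk ⟨h.1, h.2.1⟩

theorem totalDeg_eq {n : ℕ} (σ : Equiv.Perm (Fin n)) :
    totalDeg σ = (redges (fun x => σ.symm x) Finset.univ).card := by
  unfold totalDeg redges
  congr 1
  ext ⟨a, b⟩
  simp only [Finset.mem_filter, Finset.mem_univ, true_and, Finset.mem_product]
  exact and_congr_right fun h => cover_iff σ a b h

theorem lower {n : ℕ} (hn : 2 ≤ n) (π : Equiv.Perm (Fin n))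
    (hπ : ∀ i : Fin n, (π i : ℕ) = ((i : ℕ) + n / 2) % n) :
    n ^ 2 / 4 + n - 2 ≤ totalDeg π := by
  rw [totalDeg_eq]
  set m := n / 2 with hm
  have hinv : ∀ a : Fin n, ((a : ℕ) < m ∧ (π.symm a : ℕ) = a + n - m) ∨
      (m ≤ (a : ℕ) ∧ (π.symm a : ℕ) + m = a) := by
    intro a
    have h := hπ (π.symm a)
    rw [Equiv.apply_symm_apply] at h
    have hlt := (π.symm a).isLt
    have hlt2 := a.isLt
    by_cases hc : (π.symm a : ℕ) + m < n
    · rw [Nat.mod_eq_of_lt hc] at h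
      right; omega
    · rw [Nat.mod_eq_sub_mod (by omega), Nat.mod_eq_of_lt (by omega)] at h
      left; omega
  let T : Finset (ℕ × ℕ) := (Finset.range m ×ˢ Finset.Ico m n) ∪
    ((Finset.range (n - 1)).erase (m - 1)).image (fun a => (a, a + 1))
  have hT : T.card = m * (n - m) + (n - 2) := by
    rw [Finset.card_union_of_disjoint, Finset.card_product, Finset.card_image_of_injective,
      Finset.card_erase_of_mem]
    · simp; omega
    · simp; omega
    · intro x y h; simpa using h
    · rw [Finset.disjoint_left]
      rintro ⟨x, y⟩ h1 h2
      simp only [Finset.mem_product, Finset.mem_range, Finset.mem_Ico, Finset.mem_image,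
        Finset.mem_erase, Prod.mk.injEq] at h1 h2
      obtain ⟨c, h3, h4, h5⟩ := h2
      omega
  have hmn : m * (n - m) = n ^ 2 / 4 := by
    rcases Nat.even_or_odd' n with ⟨k, hk | hk⟩
    · have : m = k := by omega
      have h2 : n - m = k := by omega
      have h3 : n ^ 2 = 4 * (k * k) := by rw [hk]; ring
      rw [h2, this, h3]; omega
    · have : m = k := by omega
      have h2 : n - m = k + 1 := by omega
      have h3 : n ^ 2 = 4 * (k * (k + 1)) + 1 := by rw [hk]; ring
      rw [h2, this, h3]; omega
  have : T.card ≤ (redges (fun x => π.symm x) Finset.univ).card := by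
    refine Finset.card_le_card_of_surjOn (fun p : Fin n × Fin n => ((p.1 : ℕ), (p.2 : ℕ))) ?_
    rintro ⟨x, y⟩ hxy
    have hxy' : (x < m ∧ m ≤ y ∧ y < n) ∨ (y = x + 1 ∧ y < n) := by
      simp only [T, Finset.coe_union, Set.mem_union, Finset.mem_coe, Finset.mem_product,
        Finset.mem_range, Finset.mem_Ico, Finset.mem_image,
        Finset.mem_erase, Prod.mk.injEq] at hxy
      rcases hxy with h | ⟨c, h3, h4, h5⟩ <;> omega
    refine ⟨(⟨x, by omega⟩, ⟨y, by omega⟩), ?_, rfl⟩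
    simp only [redges, Finset.mem_coe, Finset.mem_filter, Finset.mem_product, Finset.mem_univ,
      true_and, Fin.mk_lt_mk]
    refine ⟨by omega, ?_⟩
    intro k _ hk
    have hx : x < n := by omega
    have hy : y < n := by omega
    have i1 : (x < m ∧ (π.symm ⟨x, hx⟩ : ℕ) = x + n - m) ∨
      (m ≤ x ∧ (π.symm ⟨x, hx⟩ : ℕ) + m = x) := hinv ⟨x, hx⟩
    have i2 : (y < m ∧ (π.symm ⟨y, hy⟩ : ℕ) = y + n - m) ∨
      (m ≤ y ∧ (π.symm ⟨y, hy⟩ : ℕ) + m = y) := hinv ⟨y, hy⟩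
    have i3 := hinv k
    simp only [StrBtw, Fin.lt_def] at hk
    omega
  omega

/-- The permutation [m+1, ..., n, 1, ..., m] with m = n/2 attains the maximal
total degree n²/4 + n - 2. -/
theorem max_totalDeg {n : ℕ} (hn : 2 ≤ n) (π : Equiv.Perm (Fin n))
    (hπ : ∀ i : Fin n, (π i : ℕ) = ((i : ℕ) + n / 2) % n) :
    totalDeg π = n ^ 2 / 4 + n - 2 ∧
      ∀ σ : Equiv.Perm (Fin n), totalDeg σ ≤ n ^ 2 / 4 + n - 2 := by
  have key : ∀ σ : Equiv.Perm (Fin n), totalDeg σ ≤ n ^ 2 / 4 + n - 2 := by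
    intro σ
    rw [totalDeg_eq]
    have := edges_le (fun x => σ.symm x) σ.symm.injective (Finset.univ : Finset (Fin n))
      (by simpa using hn)
    simpa using this
  exact ⟨le_antisymm (key π) (lower hn π hπ), key⟩
end

section
/- The number of permutations π ∈ S_n attaining the maximal total degree d(π) = ⌊n²/4⌋ + n − 2 equals 2 if n = 2, 4 if n ∈ {3,4}, 8 if n ≥ 6 is even, and 16 if n ≥ 5 is odd. -/
open Equiv Finset

set_option linter.unusedSectionVars false

/-! ### Generic empty-rectangle graphs -/

namespace ERG

open Classical in
/-- indicator -/
noncomputable def ind (p : Prop) : ℕ := if p then 1 else 0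

lemma ind_le_one (p : Prop) : ind p ≤ 1 := by unfold ind; split_ifs <;> simp
lemma ind_true {p : Prop} (h : p) : ind p = 1 := by unfold ind; simp [h]
lemma ind_false {p : Prop} (h : ¬ p) : ind p = 0 := by unfold ind; simp [h]
lemma ind_mono {p q : Prop} (h : p → q) : ind p ≤ ind q := by
  by_cases hp : p
  · rw [ind_true hp, ind_true (h hp)]
  · rw [ind_false hp]; omega
lemma ind_congr {p q : Prop} (h : p ↔ q) : ind p = ind q := by rw [propext h]
lemma of_ind {p : Prop} (h : 1 ≤ ind p) : p := by
  by_contra hp; rw [ind_false hp] at h; omega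

variable {α : Type} [DecidableEq α]

/-- `w` strictly between `u` and `v` -/
def Btw (f : α → ℤ) (u w v : α) : Prop := (f u < f w ∧ f w < f v) ∨ (f v < f w ∧ f w < f u)

/-- empty rectangle adjacency -/
def Adj (x y : α → ℤ) (S : Finset α) (u v : α) : Prop :=
  u ≠ v ∧ ∀ w ∈ S, ¬ (Btw x u w v ∧ Btw y u w v)

lemma Adj.symm {x y : α → ℤ} {S : Finset α} {u v : α} (h : Adj x y S u v) : Adj x y S v u := by
  refine ⟨h.1.symm, fun w hw hb => h.2 w hw ?_⟩
  unfold Btw at *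
  exact ⟨hb.1.symm, hb.2.symm⟩

lemma adj_comm {x y : α → ℤ} {S : Finset α} {u v : α} : Adj x y S u v ↔ Adj x y S v u :=
  ⟨Adj.symm, Adj.symm⟩

lemma adj_neg {x y : α → ℤ} {S : Finset α} {u v : α} :
    Adj (fun a => - x a) y S u v ↔ Adj x y S u v := by
  unfold Adj Btw
  refine and_congr Iff.rfl (forall_congr' fun w => imp_congr Iff.rfl (not_congr (and_congr ?_ Iff.rfl)))
  simp only [neg_lt_neg_iff]
  exact Or.comm.trans (by tauto)

/-- number of ordered adjacent pairs -/
noncomputable def N (x y : α → ℤ) (S : Finset α) : ℕ := ∑ u ∈ S, ∑ v ∈ S, ind (Adj x y S u v)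

lemma N_neg (x y : α → ℤ) (S : Finset α) : N (fun a => - x a) y S = N x y S := by
  unfold N
  exact Finset.sum_congr rfl fun u _ => Finset.sum_congr rfl fun v _ => ind_congr adj_neg

lemma sum_pair_decomp (f : α → α → ℕ) (S : Finset α) (t b : α) (ht : t ∈ S) (hb : b ∈ S)
    (htb : t ≠ b) :
    ∑ u ∈ S, ∑ v ∈ S, f u v =
      ∑ u ∈ (S.erase t).erase b, ∑ v ∈ (S.erase t).erase b, f u v
      + ∑ v ∈ (S.erase t).erase b, ((f t v + f v t) + (f b v + f v b))
      + (f t b + f b t) + (f t t + f b b) := by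
  have hb' : b ∈ S.erase t := Finset.mem_erase.2 ⟨htb.symm, hb⟩
  have key : ∀ g : α → ℕ, ∑ u ∈ S, g u = g t + (g b + ∑ u ∈ (S.erase t).erase b, g u) := by
    intro g
    rw [← Finset.add_sum_erase S g ht, ← Finset.add_sum_erase _ g hb']
  rw [key]
  simp only [key]
  simp only [Finset.sum_add_distrib]
  ring

lemma N_decomp (x y : α → ℤ) (S : Finset α) (t b : α) (ht : t ∈ S) (hb : b ∈ S) (htb : t ≠ b) :
    N x y S = ∑ u ∈ (S.erase t).erase b, ∑ v ∈ (S.erase t).erase b, ind (Adj x y S u v)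
      + 2 * ∑ v ∈ (S.erase t).erase b, (ind (Adj x y S t v) + ind (Adj x y S b v))
      + 2 * ind (Adj x y S t b) := by
  unfold N
  rw [sum_pair_decomp _ S t b ht hb htb]
  have h0 : ∀ a, ind (Adj x y S a a) = 0 := fun a => ind_false (fun h => h.1 rfl)
  rw [h0, h0, ind_congr (adj_comm (u := b) (v := t)), Finset.mul_sum]
  have : ∀ v, ind (Adj x y S t v) + ind (Adj x y S v t) + (ind (Adj x y S b v) + ind (Adj x y S v b))
      = 2 * (ind (Adj x y S t v) + ind (Adj x y S b v)) := by
    intro v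
    rw [ind_congr (adj_comm (u := v) (v := t)), ind_congr (adj_comm (u := v) (v := b))]; ring
  simp only [this]; ring

lemma adj_subset {x y : α → ℤ} {S C : Finset α} (h : C ⊆ S) {u v : α} (ha : Adj x y S u v) :
    Adj x y C u v := ⟨ha.1, fun w hw => ha.2 w (h hw)⟩

/-- the key removable pair -/
structure TopPair (x y : α → ℤ) (S : Finset α) (t b : α) : Prop where
  ht : t ∈ S
  hb : b ∈ S
  hx : x t < x b
  imm : ∀ w ∈ S, x t < x w → x b ≤ x w
  top : ∀ w ∈ S, w ≠ t → y w < y t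
  left : ∀ l ∈ S, x l < x t → (∀ w ∈ S, x w < x t → x w ≤ x l) → y b < y l

lemma exists_imm_left (x : α → ℤ) (S : Finset α) (t l : α) (hl : l ∈ S) (h : x l < x t) :
    ∃ m ∈ S, x m < x t ∧ ∀ w ∈ S, x w < x t → x w ≤ x m := by
  obtain ⟨m, hm, hmax⟩ := Finset.exists_max_image (S.filter fun a => x a < x t) x
    ⟨l, Finset.mem_filter.2 ⟨hl, h⟩⟩
  rw [Finset.mem_filter] at hm
  exact ⟨m, hm.1, hm.2, fun w hw h' => hmax w (Finset.mem_filter.2 ⟨hw, h'⟩)⟩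

lemma exists_imm_right (x : α → ℤ) (S : Finset α) (t l : α) (hl : l ∈ S) (h : x t < x l) :
    ∃ m ∈ S, x t < x m ∧ ∀ w ∈ S, x t < x w → x m ≤ x w := by
  obtain ⟨m, hm, h1, h2⟩ := exists_imm_left (fun a => - x a) S t l hl (by simpa using h)
  exact ⟨m, hm, by simpa using h1, fun w hw hw' => by simpa using h2 w hw (by simpa using hw')⟩

lemma exists_topPair (x y : α → ℤ) (hx : Function.Injective x) (hy : Function.Injective y)
    (S : Finset α) (h2 : 2 ≤ S.card) :
    ∃ t b, TopPair x y S t b ∨ TopPair (fun a => - x a) y S t b := by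
  obtain ⟨t, ht, htop⟩ := Finset.exists_max_image S y (Finset.card_pos.1 (by omega))
  have htop' : ∀ w ∈ S, w ≠ t → y w < y t := fun w hw hne =>
    lt_of_le_of_ne (htop w hw) (fun h => hne (hy h))
  have hne : ∃ s ∈ S, s ≠ t := by
    obtain ⟨a, ha, b, hb, hab⟩ := Finset.one_lt_card.1 (show 1 < S.card by omega)
    by_cases h : a = t
    · exact ⟨b, hb, fun h' => hab (h.trans h'.symm)⟩
    · exact ⟨a, ha, h⟩
  by_cases hr : ∃ r ∈ S, x t < x r
  · obtain ⟨r0, hr0, hr1⟩ := hr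
    obtain ⟨r, hr, hrt, hrm⟩ := exists_imm_right x S t r0 hr0 hr1
    by_cases hl : ∃ l ∈ S, x l < x t
    · obtain ⟨l0, hl0, hl1⟩ := hl
      obtain ⟨l, hl, hlt, hlm⟩ := exists_imm_left x S t l0 hl0 hl1
      have hlr : l ≠ r := by rintro rfl; omega
      rcases lt_or_gt_of_ne (fun h => hlr (hy h)) with h | h
      · refine ⟨t, l, Or.inr ⟨ht, hl, by simpa using hlt, ?_, htop', ?_⟩⟩
        · intro w hw hw'; simpa using hlm w hw (by simpa using hw')
        · intro r' hr' h1 h2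
          have : r' = r := hx (le_antisymm (by simpa using h2 r hr (by simpa using hrt))
            (hrm r' hr' (by simpa using h1)))
          rwa [this]
      · refine ⟨t, r, Or.inl ⟨ht, hr, hrt, hrm, htop', ?_⟩⟩
        intro r' hr' h1 h2
        have : r' = l := hx (le_antisymm (hlm r' hr' h1) (h2 l hl hlt))
        rwa [this]
    · exact ⟨t, r, Or.inl ⟨ht, hr, hrt, hrm, htop', fun l' hl' h => absurd ⟨l', hl', h⟩ hl⟩⟩
  · obtain ⟨s, hs, hst⟩ := hne
    have hlt : x s < x t := by
      rcases lt_trichotomy (x s) (x t) with h | h | h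
      · exact h
      · exact absurd (hx h) hst
      · exact absurd ⟨s, hs, h⟩ hr
    obtain ⟨l, hl, hlt, hlm⟩ := exists_imm_left x S t s hs hlt
    refine ⟨t, l, Or.inr ⟨ht, hl, by simpa using hlt, ?_, htop', ?_⟩⟩
    · intro w hw hw'; simpa using hlm w hw (by simpa using hw')
    · intro r' hr' h1; exact absurd ⟨r', hr', by simpa using h1⟩ hr

section TP
variable {x y : α → ℤ} {S : Finset α} {t b : α}

lemma TopPair.ne (h : TopPair x y S t b) : t ≠ b := by
  intro hh; have := h.hx; rw [hh] at this; omega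

lemma TopPair.adj (h : TopPair x y S t b) : Adj x y S t b := by
  refine ⟨h.ne, fun w hw hb => ?_⟩
  have h1 := h.hx
  have h2 := h.imm w hw
  unfold Btw at hb
  omega

/-- left common neighbours are the immediate left one -/
lemma TopPair.left_common (hy : Function.Injective y) (h : TopPair x y S t b) {c : α} (hc : c ∈ S)
    (h1 : Adj x y S t c) (h2 : Adj x y S b c) (hlt : x c < x t) :
    ∀ w ∈ S, x w < x t → x w ≤ x c := by
  intro w hw hwt
  by_contra hcon
  push Not at hcon
  obtain ⟨m, hm, hmt, hmm⟩ := exists_imm_left x S t w hw hwt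
  have hbm := h.left m hm hmt hmm
  have hwm := hmm w hw hwt
  have htm := h.top m hm (by rintro rfl; omega)
  have htc := h.top c hc (by rintro rfl; omega)
  have := h.hx
  have a1 := h1.2 m hm
  have a2 := h2.2 m hm
  unfold Btw at a1 a2
  by_cases hcm : y c = y m
  · have := hy hcm
    subst this
    omega
  · omega

/-- right common neighbours are above `b` -/
lemma TopPair.right_common (hx : Function.Injective x) (hy : Function.Injective y)
    (h : TopPair x y S t b) {c : α} (hc : c ∈ S)
    (h1 : Adj x y S t c) (h2 : Adj x y S b c) (hlt : ¬ x c < x t) :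
    x b < x c ∧ y b < y c := by
  have e1 : x c ≠ x t := fun e => h1.1 (hx e).symm
  have e2 : x c ≠ x b := fun e => h2.1 (hx e).symm
  have e3 : y c ≠ y b := fun e => h2.1 (hy e).symm
  have i := h.imm c hc (by omega)
  refine ⟨by omega, ?_⟩
  have a1 := h1.2 b h.hb
  have := h.top b h.hb h.ne.symm
  have := h.hx
  unfold Btw at a1
  omega

lemma TopPair.right_unique (hx : Function.Injective x) (hy : Function.Injective y)
    (h : TopPair x y S t b) {c d : α} (hc : c ∈ S) (hd : d ∈ S)
    (h1 : Adj x y S t c) (h2 : Adj x y S b c) (hlt : ¬ x c < x t)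
    (h1' : Adj x y S t d) (h2' : Adj x y S b d) (hlt' : ¬ x d < x t) : c = d := by
  obtain ⟨p1, p2⟩ := h.right_common hx hy hc h1 h2 hlt
  obtain ⟨q1, q2⟩ := h.right_common hx hy hd h1' h2' hlt'
  by_contra hne
  have n1 : x c ≠ x d := fun e => hne (hx e)
  have n2 : y c ≠ y d := fun e => hne (hy e)
  have a1 := h1.2 d hd
  have a2 := h2.2 d hd
  have a3 := h1'.2 c hc
  have a4 := h2'.2 c hc
  have := h.hx
  have := h.top c hc h1.1.symm
  have := h.top d hd h1'.1.symm
  unfold Btw at a1 a2 a3 a4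
  omega

open Classical in
lemma TopPair.common (hx : Function.Injective x) (hy : Function.Injective y)
    (h : TopPair x y S t b) (C : Finset α) (hC : C ⊆ S) :
    (C.filter fun v => (Adj x y S t v ∧ Adj x y S b v) ∧ x v < x t).card ≤ 1 ∧
    (C.filter fun v => (Adj x y S t v ∧ Adj x y S b v) ∧ ¬ x v < x t).card ≤ 1 := by
  constructor
  · rw [Finset.card_le_one]
    intro c hc d hd
    rw [Finset.mem_filter] at hc hd
    have i1 := h.left_common hy (hC hc.1) hc.2.1.1 hc.2.1.2 hc.2.2 d (hC hd.1) hd.2.2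
    have i2 := h.left_common hy (hC hd.1) hd.2.1.1 hd.2.1.2 hd.2.2 c (hC hc.1) hc.2.2
    exact hx (le_antisymm i2 i1)
  · rw [Finset.card_le_one]
    intro c hc d hd
    rw [Finset.mem_filter] at hc hd
    exact h.right_unique hx hy (hC hc.1) (hC hd.1) hc.2.1.1 hc.2.1.2 hc.2.2
      hd.2.1.1 hd.2.1.2 hd.2.2

/-- pointwise split of the two indicators -/
lemma ind_add (p q : Prop) : ind p + ind q = ind (p ∨ q) + ind (p ∧ q) := by
  by_cases hp : p <;> by_cases hq : q <;> simp [ind, hp, hq]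

open Classical in
lemma sum_ind (C : Finset α) (p : α → Prop) : ∑ v ∈ C, ind (p v) = (C.filter p).card := by
  rw [Finset.card_filter]
  exact Finset.sum_congr rfl fun v _ => by unfold ind; congr

open Classical in
lemma TopPair.sum_common (hx : Function.Injective x) (hy : Function.Injective y)
    (h : TopPair x y S t b) (C : Finset α) (hC : C ⊆ S) :
    ∑ v ∈ C, ind (Adj x y S t v ∧ Adj x y S b v) ≤ 2 ∧
    (2 ≤ ∑ v ∈ C, ind (Adj x y S t v ∧ Adj x y S b v) →
      (∃ l ∈ C, x l < x t ∧ (∀ w ∈ S, x w < x t → x w ≤ x l)) ∧ (∃ e ∈ C, x b < x e)) := by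
  obtain ⟨h1, h2⟩ := h.common hx hy C hC
  have key : ∑ v ∈ C, ind (Adj x y S t v ∧ Adj x y S b v) =
      (C.filter fun v => (Adj x y S t v ∧ Adj x y S b v) ∧ x v < x t).card +
      (C.filter fun v => (Adj x y S t v ∧ Adj x y S b v) ∧ ¬ x v < x t).card := by
    have := Finset.card_filter_add_card_filter_not
      (s := C.filter fun v => Adj x y S t v ∧ Adj x y S b v) (fun v => x v < x t)
    rw [Finset.filter_filter, Finset.filter_filter] at this
    rw [sum_ind]
    convert this.symm
  refine ⟨by omega, fun h3 => ⟨?_, ?_⟩⟩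
  · obtain ⟨c, hc⟩ := Finset.card_pos.1 (show 0 <
      (C.filter fun v => (Adj x y S t v ∧ Adj x y S b v) ∧ x v < x t).card by omega)
    rw [Finset.mem_filter] at hc
    exact ⟨c, hc.1, hc.2.2, h.left_common hy (hC hc.1) hc.2.1.1 hc.2.1.2 hc.2.2⟩
  · obtain ⟨c, hc⟩ := Finset.card_pos.1 (show 0 <
      (C.filter fun v => (Adj x y S t v ∧ Adj x y S b v) ∧ ¬ x v < x t).card by omega)
    rw [Finset.mem_filter] at hc
    exact ⟨c, hc.1, (h.right_common hx hy (hC hc.1) hc.2.1.1 hc.2.1.2 hc.2.2).1⟩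

end TP

/-- the maximum -/
def F (n : ℕ) : ℕ := n ^ 2 / 4 + n - 2

lemma F_step (n : ℕ) (hn : 2 ≤ n) : F (n + 2) = F n + (n + 3) := by
  unfold F
  have : (n + 2) ^ 2 = n ^ 2 + (n + 1) * 4 := by ring
  rw [this, Nat.add_mul_div_right _ _ (by norm_num)]
  omega

lemma card_erase2 {S : Finset α} {t b : α} (ht : t ∈ S) (hb : b ∈ S) (htb : t ≠ b) :
    ((S.erase t).erase b).card + 2 = S.card := by
  have hb' : b ∈ S.erase t := Finset.mem_erase.2 ⟨htb.symm, hb⟩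
  have h1 := Finset.card_erase_add_one hb'
  have h2 := Finset.card_erase_add_one ht
  omega

lemma N_small (x y : α → ℤ) (S : Finset α) (h : S.card ≤ 1) : N x y S = 0 := by
  unfold N
  refine Finset.sum_eq_zero fun u hu => Finset.sum_eq_zero fun v hv => ?_
  rw [Finset.card_le_one] at h
  exact ind_false fun ha => ha.1 (h u hu v hv)

lemma sum_sum_le (x y : α → ℤ) {S C : Finset α} (hC : C ⊆ S) :
    ∑ u ∈ C, ∑ v ∈ C, ind (Adj x y S u v) ≤ N x y C :=
  Finset.sum_le_sum fun _ _ => Finset.sum_le_sum fun _ _ => ind_mono (adj_subset hC)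

lemma N_le (x y : α → ℤ) (hx : Function.Injective x) (hy : Function.Injective y) :
    ∀ (n : ℕ) (S : Finset α), S.card = n → 2 ≤ n → N x y S ≤ 2 * F n := by
  intro n
  induction n using Nat.strong_induction_on with
  | _ n ih =>
  intro S hS hn
  obtain ⟨t, b, htp⟩ := exists_topPair x y hx hy S (by omega)
  have main : ∀ x : α → ℤ, Function.Injective x →
      (∀ m < n, ∀ S : Finset α, S.card = m → 2 ≤ m → N x y S ≤ 2 * F m) →
      TopPair x y S t b → N x y S ≤ 2 * F n := by
    clear htp ih hx x
    intro x hx ih h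
    set C := (S.erase t).erase b with hCdef
    have hcard := card_erase2 h.ht h.hb h.ne
    have hCS : C ⊆ S := (Finset.erase_subset _ _).trans (Finset.erase_subset _ _)
    have hd := N_decomp x y S t b h.ht h.hb h.ne
    rw [← hCdef] at hd hcard
    have h1 := sum_sum_le x y hCS
    have h2 := (h.sum_common hx hy C hCS).1
    have h3 : ∑ v ∈ C, (ind (Adj x y S t v) + ind (Adj x y S b v)) =
        ∑ v ∈ C, ind (Adj x y S t v ∨ Adj x y S b v) +
        ∑ v ∈ C, ind (Adj x y S t v ∧ Adj x y S b v) := by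
      rw [← Finset.sum_add_distrib]
      exact Finset.sum_congr rfl fun v _ => ind_add _ _
    have h4 : ∑ v ∈ C, ind (Adj x y S t v ∨ Adj x y S b v) ≤ C.card := by
      rw [Finset.card_eq_sum_ones]; exact Finset.sum_le_sum fun v _ => ind_le_one _
    have h5 : ∑ v ∈ C, ind (Adj x y S t v ∧ Adj x y S b v) ≤ C.card := by
      rw [Finset.card_eq_sum_ones]; exact Finset.sum_le_sum fun v _ => ind_le_one _
    have h6 := ind_le_one (Adj x y S t b)
    by_cases hn4 : 4 ≤ n
    · have i1 := ih C.card (by omega) C rfl (by omega)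
      have i2 := F_step C.card (by omega)
      rw [hcard, hS] at i2
      omega
    · have i1 := N_small x y C (by omega)
      have : n = 2 ∨ n = 3 := by omega
      rcases this with rfl | rfl
      · have : F 2 = 1 := by decide
        omega
      · have : F 3 = 3 := by decide
        omega
  rcases htp with h | h
  · exact main x hx ih h
  · rw [← N_neg]
    refine main _ (fun a b hab => hx (by simpa using hab)) ?_ h
    intro m hm S hS h2
    rw [N_neg]; exact ih m hm S hS h2

end ERG
namespace ERG
variable {α : Type} [DecidableEq α]

/-- removing a pair `t,b` (consecutive in position, `t` top), symmetric under reflection of `x` -/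
structure Ins (x y : α → ℤ) (S C : Finset α) (t b m r : α) : Prop where
  mem : ∀ a, a ∈ S ↔ (a = t ∨ a = b ∨ a ∈ C)
  side : ∀ c ∈ C, (x c < x t ∧ x c < x b) ∨ (x t < x c ∧ x b < x c)
  top : ∀ c ∈ C, y c < y t
  topb : y b < y t
  yne : ∀ c ∈ C, y c ≠ y b
  hm : m ∈ C
  hmt : x m < x t
  imm_m : ∀ c ∈ C, x c < x t → x c ≤ x m
  ym : y b < y m
  hr : r ∈ C
  hrt : x t < x r
  imm_r : ∀ c ∈ C, x t < x c → x r ≤ x c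
  yr : y b < y r
  cover : ∀ c ∈ C, Adj x y S t c ∨ Adj x y S b c
  nost : ∀ u ∈ C, ∀ w ∈ C, Adj x y C u w → x u < x t → x t < x w → (y b < y u ↔ y b < y w)
  card : S.card = C.card + 2

lemma Ins.neg {x y : α → ℤ} {S C : Finset α} {t b m r : α}
    (h : Ins (fun a => - x a) y S C t b m r) : Ins x y S C t b r m where
  mem := h.mem
  side c hc := by have := h.side c hc; simp only [neg_lt_neg_iff] at this; exact this.symm
  top := h.top
  topb := h.topb
  yne := h.yne
  hm := h.hr
  hmt := by simpa using h.hrt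
  imm_m c hc := by simpa using h.imm_r c hc
  ym := h.yr
  hr := h.hm
  hrt := by simpa using h.hmt
  imm_r c hc := by simpa using h.imm_m c hc
  yr := h.ym
  cover c hc := by simpa only [adj_neg] using h.cover c hc
  nost u hu w hw ha h1 h2 :=
    (h.nost w hw u hu (adj_neg.2 ha.symm) (by simpa using h2) (by simpa using h1)).symm
  card := h.card

lemma TopPair.ins {x y : α → ℤ} {S : Finset α} {t b : α} (hx : Function.Injective x)
    (hy : Function.Injective y) (h : TopPair x y S t b) (h4 : 4 ≤ S.card)
    (hN : N x y S = 2 * F S.card) :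
    ∃ C m r, Ins x y S C t b m r ∧ N x y C = 2 * F C.card := by
  set C := (S.erase t).erase b with hCdef
  have hcard := card_erase2 h.ht h.hb h.ne
  have hCS : C ⊆ S := (Finset.erase_subset _ _).trans (Finset.erase_subset _ _)
  have hd := N_decomp x y S t b h.ht h.hb h.ne
  rw [← hCdef] at hd hcard
  have h1 := sum_sum_le x y hCS
  have h2 := h.sum_common hx hy C hCS
  have h3 : ∑ v ∈ C, (ind (Adj x y S t v) + ind (Adj x y S b v)) =
      ∑ v ∈ C, ind (Adj x y S t v ∨ Adj x y S b v) +
      ∑ v ∈ C, ind (Adj x y S t v ∧ Adj x y S b v) := by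
    rw [← Finset.sum_add_distrib]
    exact Finset.sum_congr rfl fun v _ => ind_add _ _
  have h4' : ∑ v ∈ C, ind (Adj x y S t v ∨ Adj x y S b v) ≤ ∑ v ∈ C, 1 :=
    Finset.sum_le_sum fun v _ => ind_le_one _
  have h4c : ∑ v ∈ C, 1 = C.card := (Finset.card_eq_sum_ones _).symm
  have h6 := ind_le_one (Adj x y S t b)
  have i1 := N_le x y hx hy C.card C rfl (by omega)
  have i2 := F_step C.card (by omega)
  rw [hcard] at i2
  have e1 : ∑ v ∈ C, ind (Adj x y S t v ∨ Adj x y S b v) = ∑ v ∈ C, 1 := by omega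
  have e2 : 2 ≤ ∑ v ∈ C, ind (Adj x y S t v ∧ Adj x y S b v) := by omega
  have e3 : N x y C = 2 * F C.card := by omega
  have e4 : ∑ u ∈ C, ∑ v ∈ C, ind (Adj x y S u v) = N x y C := by omega
  have hcov : ∀ c ∈ C, Adj x y S t c ∨ Adj x y S b c := by
    intro c hc
    have := (Finset.sum_eq_sum_iff_of_le (fun v _ => ind_le_one _)).1 e1 c hc
    exact of_ind this.ge
  have hst : ∀ u ∈ C, ∀ w ∈ C, Adj x y C u w → Adj x y S u w := by
    intro u hu w hw ha
    have k1 := (Finset.sum_eq_sum_iff_of_le (fun u _ => Finset.sum_le_sum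
      fun v _ => ind_mono (adj_subset hCS))).1 e4 u hu
    have k2 := (Finset.sum_eq_sum_iff_of_le (fun v _ => ind_mono (adj_subset hCS))).1 k1 w hw
    rw [ind_true ha] at k2
    exact of_ind k2.ge
  obtain ⟨⟨m, hmC, hmt, hmm⟩, ⟨e, heC, hbe⟩⟩ := h2.2 e2
  have hmemC : ∀ a, a ∈ C ↔ a ≠ b ∧ a ≠ t ∧ a ∈ S := by
    intro a; rw [hCdef, Finset.mem_erase, Finset.mem_erase]
  have hxtb := h.hx
  have hside : ∀ c ∈ C, (x c < x t ∧ x c < x b) ∨ (x t < x c ∧ x b < x c) := by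
    intro c hc
    obtain ⟨n1, n2, hcS⟩ := (hmemC c).1 hc
    have n1' : x c ≠ x b := fun e => n1 (hx e)
    have n2' : x c ≠ x t := fun e => n2 (hx e)
    have := h.imm c hcS
    omega
  have hyne : ∀ c ∈ C, y c ≠ y b := fun c hc e => ((hmemC c).1 hc).1 (hy e)
  have htr : x t < x e := by omega
  obtain ⟨r, hrC, hrt, hrm⟩ := exists_imm_right x C t e heC htr
  have hym := h.left m (hCS hmC) hmt hmm
  have hnost : ∀ u ∈ C, ∀ w ∈ C, Adj x y C u w → x u < x t → x t < x w →
      (y b < y u ↔ y b < y w) := by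
    intro u hu w hw ha k1 k2
    have a := (hst u hu w hw ha).2 b h.hb
    have s1 := hside u hu
    have s2 := hside w hw
    have n1 := hyne u hu
    have n2 := hyne w hw
    unfold Btw at a
    omega
  refine ⟨C, m, r, ⟨?_, hside, ?_, h.top b h.hb h.ne.symm, hyne, hmC, hmt, ?_, hym, hrC, hrt, hrm,
    ?_, hcov, hnost, hcard.symm⟩, e3⟩
  · intro a
    rw [hmemC]
    have := h.ht
    have := h.hb
    constructor
    · intro ha; tauto
    · rintro (rfl | rfl | ha) <;> tauto
  · intro c hc; exact h.top c (hCS hc) ((hmemC c).1 hc).2.1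
  · intro c hc; exact hmm c (hCS hc)
  · refine (hnost m hmC r hrC ⟨by rintro rfl; omega, ?_⟩ hmt hrt).1 hym
    intro w hw hbt
    have s := hside w hw
    have k1 := hmm w (hCS hw)
    have k2 := hrm w hw
    unfold Btw at hbt
    omega

lemma exists_ins {x y : α → ℤ} {S : Finset α} (hx : Function.Injective x)
    (hy : Function.Injective y) (h4 : 4 ≤ S.card) (hN : N x y S = 2 * F S.card) :
    ∃ C t b m r, Ins x y S C t b m r ∧ N x y C = 2 * F C.card := by
  obtain ⟨t, b, h | h⟩ := exists_topPair x y hx hy S (by omega)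
  · obtain ⟨C, m, r, h1, h2⟩ := h.ins hx hy h4 hN
    exact ⟨C, t, b, m, r, h1, h2⟩
  · obtain ⟨C, m, r, h1, h2⟩ := h.ins (fun a b hab => hx (by simpa using hab)) hy h4
      (by rw [N_neg]; exact hN)
    exact ⟨C, t, b, r, m, h1.neg, by rw [← N_neg]; exact h2⟩

/-- the extremal structure (decreasing type) -/
structure Dec (x y : α → ℤ) (S : Finset α) (T B L R : α) (P Q : Finset α) : Prop where
  mem : ∀ a, a ∈ S ↔ (a = T ∨ a = B ∨ a = L ∨ a = R ∨ a ∈ P ∨ a ∈ Q)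
  xLT : x L < x T
  xLB : x L < x B
  xTR : x T < x R
  xBR : x B < x R
  yBL : y B < y L
  yBR : y B < y R
  yLT : y L < y T
  yRT : y R < y T
  hP : ∀ p ∈ P, x L < x p ∧ x p < x T ∧ x p < x B ∧ y B < y p ∧ y p < y L ∧ y p < y R
  hQ : ∀ q ∈ Q, x T < x q ∧ x B < x q ∧ x q < x R ∧ y L < y q ∧ y R < y q ∧ y q < y T
  decP : ∀ p ∈ P, ∀ q ∈ P, x p < x q → y q < y p
  decQ : ∀ p ∈ Q, ∀ q ∈ Q, x p < x q → y q < y p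
  card : S.card = P.card + Q.card + 4
  bal1 : P.card ≤ Q.card + 1
  bal2 : Q.card ≤ P.card + 1

/-- up to reflection -/
def Str (x y : α → ℤ) (S : Finset α) : Prop :=
  ∃ T B L R P Q, Dec x y S T B L R P Q ∨ Dec (fun a => - x a) y S T B L R P Q

lemma Str.neg {x y : α → ℤ} {S : Finset α} (h : Str (fun a => - x a) y S) : Str x y S := by
  obtain ⟨T, B, L, R, P, Q, h | h⟩ := h
  · exact ⟨T, B, L, R, P, Q, Or.inr h⟩
  · refine ⟨T, B, L, R, P, Q, Or.inl ?_⟩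
    simpa using h

/-- complete bipartite part -/
lemma Dec.adj {x y : α → ℤ} {S : Finset α} {T B L R : α} {P Q : Finset α}
    (h : Dec x y S T B L R P Q) {a c : α} (ha : a = L ∨ a = B ∨ a ∈ P)
    (hc : c = R ∨ c = T ∨ c ∈ Q) : Adj x y S a c := by
  have h1 := h.xLT
  have h2 := h.xLB
  have h3 := h.xTR
  have h4 := h.xBR
  have h5 := h.yBL
  have h6 := h.yBR
  have h7 := h.yLT
  have h8 := h.yRT
  have ha' : a = L ∨ a = B ∨ (a ∈ P ∧ x L < x a ∧ x a < x T ∧ x a < x B ∧ y B < y a ∧ y a < y L ∧ y a < y R) := by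
    rcases ha with r | r | r
    · exact Or.inl r
    · exact Or.inr (Or.inl r)
    · exact Or.inr (Or.inr ⟨r, h.hP a r⟩)
  have hc' : c = R ∨ c = T ∨ (c ∈ Q ∧ x T < x c ∧ x B < x c ∧ x c < x R ∧ y L < y c ∧ y R < y c ∧ y c < y T) := by
    rcases hc with r | r | r
    · exact Or.inl r
    · exact Or.inr (Or.inl r)
    · exact Or.inr (Or.inr ⟨r, h.hQ c r⟩)
  clear ha hc
  constructor
  · rintro rfl
    rcases ha' with rfl | rfl | ha <;> rcases hc' with rfl | rfl | hc <;> omega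
  · intro w hw hbt
    unfold Btw at hbt
    rcases (h.mem w).1 hw with rfl | rfl | rfl | rfl | hwP | hwQ
    · rcases ha' with rfl | rfl | ha <;> rcases hc' with rfl | rfl | hc <;> omega
    · rcases ha' with rfl | rfl | ha <;> rcases hc' with rfl | rfl | hc <;> omega
    · rcases ha' with rfl | rfl | ha <;> rcases hc' with rfl | rfl | hc <;> omega
    · rcases ha' with rfl | rfl | ha <;> rcases hc' with rfl | rfl | hc <;> omega
    · have := h.hP w hwP
      rcases ha' with rfl | rfl | ⟨haP, ha⟩ <;> rcases hc' with rfl | rfl | hc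
      all_goals try omega
      all_goals
        have := h.decP a haP w hwP
        have := h.decP w hwP a haP
        omega
    · have := h.hQ w hwQ
      rcases ha' with rfl | rfl | ha <;> rcases hc' with rfl | rfl | ⟨hcQ, hc⟩
      all_goals try omega
      all_goals
        have := h.decQ c hcQ w hwQ
        have := h.decQ w hwQ c hcQ
        omega

end ERG
namespace ERG
variable {α : Type} [DecidableEq α]

lemma Ins.blocked {x y : α → ℤ} {S C : Finset α} {t b m r : α} (h : Ins x y S C t b m r)
    {c d e : α} (hc : c ∈ C) (hd : d ∈ C) (he : e ∈ C) (h1 : Btw x t d c ∧ Btw y t d c)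
    (h2 : Btw x b e c ∧ Btw y b e c) : False := by
  rcases h.cover c hc with k | k
  · exact k.2 d ((h.mem d).2 (Or.inr (Or.inr hd))) h1
  · exact k.2 e ((h.mem e).2 (Or.inr (Or.inr he))) h2

lemma Ins.xlt {x y : α → ℤ} {S C : Finset α} {t b m r : α} (h : Ins x y S C t b m r)
    {c : α} (hc : c ∈ C) (h1 : ¬ x t < x c) : x c < x t := by
  have := h.side c hc
  omega

lemma Ins.ylt {x y : α → ℤ} {S C : Finset α} {t b m r : α} (h : Ins x y S C t b m r)
    {c : α} (hc : c ∈ C) (h1 : ¬ y b < y c) : y c < y b := by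
  have := h.yne c hc
  omega

lemma Ins.blockedR {x y : α → ℤ} {S C : Finset α} {t b m r : α} (h : Ins x y S C t b m r)
    {c d e : α} (hc : c ∈ C) (hd : d ∈ C) (he : e ∈ C) (h1 : x t < x d) (h2 : x d < x c)
    (h3 : y c < y d) (h4 : x t < x e) (h5 : x e < x c)
    (h6 : (y b < y e ∧ y e < y c) ∨ (y c < y e ∧ y e < y b)) : False := by
  have t1 := h.top d hd
  have s := h.side e he
  refine h.blocked hc hd he ⟨Or.inl ⟨h1, h2⟩, Or.inr ⟨h3, t1⟩⟩ ⟨Or.inl ⟨?_, h5⟩, h6⟩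
  omega

lemma Ins.blockedL {x y : α → ℤ} {S C : Finset α} {t b m r : α} (h : Ins x y S C t b m r)
    {c d e : α} (hc : c ∈ C) (hd : d ∈ C) (he : e ∈ C) (h1 : x d < x t) (h2 : x c < x d)
    (h3 : y c < y d) (h4 : x e < x t) (h5 : x c < x e)
    (h6 : (y b < y e ∧ y e < y c) ∨ (y c < y e ∧ y e < y b)) : False := by
  have t1 := h.top d hd
  have s := h.side e he
  refine h.blocked hc hd he ⟨Or.inr ⟨h2, h1⟩, Or.inr ⟨h3, t1⟩⟩ ⟨Or.inr ⟨h5, ?_⟩, h6⟩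
  omega

lemma step_low {x y : α → ℤ} {S C : Finset α} {t b m r T B L R : α} {P Q : Finset α}
    (hI : Ins x y S C t b m r) (hD : Dec x y C T B L R P Q) (hx : Function.Injective x) :
    ∀ c ∈ C, y b < y c := by
  have h1 := hD.xLT
  have h2 := hD.xLB
  have h3 := hD.xTR
  have h4 := hD.xBR
  have h5 := hD.yBL
  have h6 := hD.yBR
  have h7 := hD.yLT
  have h8 := hD.yRT
  have mT : T ∈ C := (hD.mem _).2 (by tauto)
  have mB : B ∈ C := (hD.mem _).2 (by tauto)
  have mL : L ∈ C := (hD.mem _).2 (by tauto)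
  have mR : R ∈ C := (hD.mem _).2 (by tauto)
  have mP : ∀ p ∈ P, p ∈ C := fun p hp => (hD.mem _).2 (by tauto)
  have mQ : ∀ p ∈ Q, p ∈ C := fun p hp => (hD.mem _).2 (by tauto)
  have hmt := hI.hmt
  have hrt := hI.hrt
  have hym := hI.ym
  have hyr := hI.yr
  have tT := hI.top T mT
  -- L is leftmost, R rightmost
  have hLm : ∀ c ∈ C, x L ≤ x c := by
    intro c hc
    rcases (hD.mem c).1 hc with rfl | rfl | rfl | rfl | h | h
    · omega
    · omega
    · omega
    · omega
    · have := hD.hP c h; omega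
    · have := hD.hQ c h; omega
  have hRm : ∀ c ∈ C, x c ≤ x R := by
    intro c hc
    rcases (hD.mem c).1 hc with rfl | rfl | rfl | rfl | h | h
    · omega
    · omega
    · omega
    · omega
    · have := hD.hP c h; omega
    · have := hD.hQ c h; omega
  have hLl : x L < x t := by have := hLm m hI.hm; omega
  have hRr : x t < x R := by have := hRm r hI.hr; omega
  -- first, b is below L and R
  have vL : y b < y L := by
    by_contra hv
    have hcon : ¬ (r = R ∨ r = T ∨ r ∈ Q) := by
      intro hr
      exact hv ((hI.nost L mL r hI.hr (hD.adj (by tauto) hr) hLl hrt).2 hyr)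
    rcases (hD.mem r).1 hI.hr with h | h | h | h | h | h
    · tauto
    · subst h; omega
    · subst h; omega
    · tauto
    · have := hD.hP r h; omega
    · tauto
  have vR : y b < y R := (hI.nost L mL R mR (hD.adj (by tauto) (by tauto)) hLl hRr).1 vL
  have key : ∀ z, (z = B ∨ z ∈ P) → y b < y z := by
    intro z hz
    by_contra hv
    have mz : z ∈ C := by
      rcases hz with rfl | hz
      · exact mB
      · exact mP z hz
    have hv' := hI.ylt mz hv
    have hzr : x t < x z := by
      by_contra hl
      exact hv ((hI.nost z mz R mR (hD.adj (by tauto) (by tauto)) (hI.xlt mz hl) hRr).2 vR)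
    have hTr : x t < x T := by
      rcases hz with rfl | hz
      · by_contra hl
        exact hv ((hI.nost T mT z mz (hD.adj (by tauto) (by tauto)).symm (hI.xlt mT hl) hzr).1
          (by omega))
      · have := hD.hP z hz; omega
    have hxTr := hI.imm_r T mT hTr
    have bad : (r ∈ P ∨ r = B) → False := by
      intro hr
      have : y r < y R ∧ x r < x R := by
        rcases hr with h | h
        · have := hD.hP r h; omega
        · subst h; omega
      exact hI.blockedR mR mT hI.hr hTr h3 h8 hrt this.2 (Or.inl ⟨hyr, this.1⟩)
    rcases (hD.mem r).1 hI.hr with h | h | h | h | h | h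
    · subst h
      have hzB : z = B := by
        rcases hz with hz | hz
        · exact hz
        · have := hD.hP z hz
          have := hI.imm_r z mz hzr
          omega
      subst hzB
      have hadj : Adj x y C m z := by
        refine ⟨by rintro rfl; omega, ?_⟩
        intro w hw hbt
        unfold Btw at hbt
        have k1 := hI.imm_m w hw
        have hwx : x t < x w := by
          by_contra hl
          have := hI.xlt hw hl
          omega
        have k2 := hI.imm_r w hw hwx
        clear k1
        have hbt' : x w < x z := by omega
        have hby := hbt.2
        clear hbt
        rcases (hD.mem w).1 hw with h | h | h | h | h | h
        · subst h
          have : y m ≤ y w := by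
            rcases (hD.mem m).1 hI.hm with h | h | h | h | h | h
            · subst h; omega
            · subst h; omega
            · subst h; omega
            · subst h; omega
            · have := hD.hP m h; omega
            · have := hD.hQ m h; omega
          omega
        · subst h; omega
        · subst h; omega
        · subst h; omega
        · have := hD.hP w h; omega
        · have := hD.hQ w h; omega
      exact hv ((hI.nost m hI.hm z mz hadj hmt hzr).1 hym)
    · exact bad (Or.inr h)
    · subst h; omega
    · subst h; omega
    · exact bad (Or.inl h)
    · have := hD.hQ r h; omega
  intro c hc
  rcases (hD.mem c).1 hc with h | h | h | h | h | h
  · subst h; omega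
  · exact key c (Or.inl h)
  · subst h; omega
  · subst h; omega
  · exact key c (Or.inr h)
  · have := hD.hQ c h; omega

lemma step_dec {x y : α → ℤ} {S C : Finset α} {t b m r T B L R : α} {P Q : Finset α}
    (hI : Ins x y S C t b m r) (hD : Dec x y C T B L R P Q) (hx : Function.Injective x) :
    Str x y S := by
  have low := step_low hI hD hx
  have h1 := hD.xLT
  have h2 := hD.xLB
  have h3 := hD.xTR
  have h4 := hD.xBR
  have h5 := hD.yBL
  have h6 := hD.yBR
  have h7 := hD.yLT
  have h8 := hD.yRT
  have mT : T ∈ C := (hD.mem _).2 (by tauto)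
  have mB : B ∈ C := (hD.mem _).2 (by tauto)
  have mL : L ∈ C := (hD.mem _).2 (by tauto)
  have mR : R ∈ C := (hD.mem _).2 (by tauto)
  have mP : ∀ p ∈ P, p ∈ C := fun p hp => (hD.mem _).2 (by tauto)
  have mQ : ∀ p ∈ Q, p ∈ C := fun p hp => (hD.mem _).2 (by tauto)
  have lT := low T mT
  have lB := low B mB
  have lL := low L mL
  have lR := low R mR
  have tT := hI.top T mT
  have tL := hI.top L mL
  have tR := hI.top R mR
  have hnr : ¬ (x t < x T ∧ x t < x B) := by
    rintro ⟨a1, a2⟩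
    exact hI.blockedR mR mT mB a1 h3 h8 a2 h4 (Or.inl ⟨lB, h6⟩)
  have hnl : ¬ (x T < x t ∧ x B < x t) := by
    rintro ⟨a1, a2⟩
    exact hI.blockedL mL mT mB a1 h1 h7 a2 h2 (Or.inl ⟨lB, h5⟩)
  have hmem := hI.mem
  have hcS := hI.card
  have hcC := hD.card
  have hb1 := hD.bal1
  have hb2 := hD.bal2
  by_cases hB : x B < x t
  · have hT : x t < x T := by
      by_contra hl
      exact hnl ⟨hI.xlt mT hl, hB⟩
    have bB : x B < x b := by have := hI.side B mB; omega
    have bT : x b < x T := by have := hI.side T mT; omega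
    clear hnr hnl
    have hBP : B ∉ P := fun h => by have := hD.hP B h; omega
    have hTQ : T ∉ Q := fun h => by have := hD.hQ T h; omega
    refine ⟨t, b, L, R, insert B P, insert T Q, Or.inl ?_⟩
    have cP := Finset.card_insert_of_notMem hBP
    have cQ := Finset.card_insert_of_notMem hTQ
    refine ⟨?_, by omega, by omega, by omega, by omega, by omega, by omega, by omega, by omega,
      ?_, ?_, ?_, ?_, by omega, by omega, by omega⟩
    · intro a
      rw [hmem, hD.mem, Finset.mem_insert, Finset.mem_insert]
      tauto
    · intro p hp
      rcases Finset.mem_insert.1 hp with rfl | hp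
      · omega
      · have := hD.hP p hp
        have := low p (mP p hp)
        omega
    · intro p hp
      rcases Finset.mem_insert.1 hp with rfl | hp
      · omega
      · have := hD.hQ p hp
        have := hI.top p (mQ p hp)
        omega
    · intro p hp q hq hpq
      rcases Finset.mem_insert.1 hp with e1 | hp1
      · rcases Finset.mem_insert.1 hq with e2 | hq1
        · rw [e1, e2] at hpq; omega
        · have := hD.hP q hq1; subst e1; omega
      · rcases Finset.mem_insert.1 hq with e2 | hq1
        · have := hD.hP p hp1; subst e2; omega
        · exact hD.decP p hp1 q hq1 hpq
    · intro p hp q hq hpq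
      rcases Finset.mem_insert.1 hp with e1 | hp1
      · rcases Finset.mem_insert.1 hq with e2 | hq1
        · rw [e1, e2] at hpq; omega
        · have := hD.hQ q hq1; subst e1; omega
      · rcases Finset.mem_insert.1 hq with e2 | hq1
        · have := hD.hQ p hp1; subst e2; omega
        · exact hD.decQ p hp1 q hq1 hpq
  · have hB' : x t < x B := by
      by_contra hl
      exact hB (hI.xlt mB hl)
    have hT : x T < x t := by
      by_contra hl
      refine hnr ⟨?_, hB'⟩
      by_contra hl2
      exact hl (hI.xlt mT hl2)
    have bB : x b < x B := by have := hI.side B mB; omega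
    have bT : x T < x b := by have := hI.side T mT; omega
    clear hnr hnl
    have hP0 : P = ∅ := by
      refine Finset.eq_empty_of_forall_notMem fun p hp => ?_
      have := hD.hP p hp
      have := low p (mP p hp)
      exact hI.blockedL mL mT (mP p hp) hT h1 h7 (by omega) (by omega) (by omega)
    have hQ0 : Q = ∅ := by
      refine Finset.eq_empty_of_forall_notMem fun p hp => ?_
      have := hD.hQ p hp
      have := hI.top p (mQ p hp)
      exact hI.blockedR mR (mQ p hp) mB (by omega) (by omega) (by omega) hB' h4 (by omega)
    subst hP0 hQ0
    simp only [Finset.card_empty] at hcC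
    refine ⟨t, b, R, L, {B}, {T}, Or.inr ?_⟩
    refine ⟨?_, by omega, by omega, by omega, by omega, by omega, by omega, by omega, by omega,
      ?_, ?_, ?_, ?_, by simp; omega, by simp, by simp⟩
    · intro a
      rw [hmem, hD.mem, Finset.mem_singleton, Finset.mem_singleton]
      simp only [Finset.notMem_empty]
      tauto
    · intro p hp
      rw [Finset.mem_singleton] at hp; subst hp; omega
    · intro p hp
      rw [Finset.mem_singleton] at hp; subst hp; omega
    · intro p hp q hq hpq
      rw [Finset.mem_singleton] at hp hq; subst hp; subst hq; omega
    · intro p hp q hq hpq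
      rw [Finset.mem_singleton] at hp hq; subst hp; subst hq; omega

lemma step {x y : α → ℤ} {S C : Finset α} {t b m r : α}
    (hI : Ins x y S C t b m r) (hD : Str x y C) (hx : Function.Injective x) :
    Str x y S := by
  obtain ⟨T, B, L, R, P, Q, h | h⟩ := hD
  · exact step_dec hI h hx
  · refine Str.neg (step_dec (t := t) (b := b) (m := r) (r := m) ?_ h (fun a b hab => hx (by simpa using hab)))
    refine Ins.neg ?_
    simpa using hI

lemma base4 {x y : α → ℤ} {S C : Finset α} {t b m r : α}
    (hI : Ins x y S C t b m r) (hC : C.card = 2) : Str x y S := by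
  have hmt := hI.hmt
  have hrt := hI.hrt
  have hmr : m ≠ r := by rintro rfl; omega
  have hCe : C = {m, r} := by
    symm
    apply Finset.eq_of_subset_of_card_le
    · intro a ha
      rw [Finset.mem_insert, Finset.mem_singleton] at ha
      rcases ha with rfl | rfl
      · exact hI.hm
      · exact hI.hr
    · rw [Finset.card_pair hmr, hC]
  have s1 := hI.side m hI.hm
  have s2 := hI.side r hI.hr
  have t1 := hI.top m hI.hm
  have t2 := hI.top r hI.hr
  have y1 := hI.ym
  have y2 := hI.yr
  have hc := hI.card
  refine ⟨t, b, m, r, ∅, ∅, Or.inl ?_⟩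
  refine ⟨?_, by omega, by omega, by omega, by omega, by omega, by omega, by omega, by omega,
      by simp, by simp, by simp, by simp, by simp; omega, by simp, by simp⟩
  intro a
  rw [hI.mem, hCe, Finset.mem_insert, Finset.mem_singleton]
  simp

lemma base5 {x y : α → ℤ} {S C : Finset α} {t b m r : α}
    (hx : Function.Injective x) (hy : Function.Injective y)
    (hI : Ins x y S C t b m r) (hC : C.card = 3) (hN : N x y C = 6) : Str x y S := by
  have hmt := hI.hmt
  have hrt := hI.hrt
  have hmr : m ≠ r := by rintro rfl; omega
  have hcd := card_erase2 hI.hm hI.hr hmr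
  obtain ⟨c, hc⟩ := Finset.card_eq_one.1 (show ((C.erase m).erase r).card = 1 by omega)
  have hd := N_decomp x y C m r hI.hm hI.hr hmr
  rw [hc] at hd
  have h0 : ind (Adj x y C c c) = 0 := ind_false fun h => h.1 rfl
  simp only [Finset.sum_singleton, h0] at hd
  have i1 := ind_le_one (Adj x y C m c)
  have i2 := ind_le_one (Adj x y C r c)
  have i3 := ind_le_one (Adj x y C m r)
  have a1 : Adj x y C m c := of_ind (by omega)
  have a2 : Adj x y C r c := of_ind (by omega)
  have a3 : Adj x y C m r := of_ind (by omega)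
  have hcC : c ∈ C := by
    have : c ∈ (C.erase m).erase r := by rw [hc]; simp
    exact Finset.mem_of_mem_erase (Finset.mem_of_mem_erase this)
  have hmemC : ∀ a, a ∈ C ↔ (a = m ∨ a = r ∨ a = c) := by
    intro a
    have h1 : a ∈ (C.erase m).erase r ↔ a = c := by rw [hc, Finset.mem_singleton]
    rw [Finset.mem_erase, Finset.mem_erase] at h1
    have := hI.hm
    have := hI.hr
    constructor
    · tauto
    · rintro (rfl | rfl | rfl) <;> assumption
  have t1 := hI.top m hI.hm
  have t2 := hI.top r hI.hr
  have t3 := hI.top c hcC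
  have y1 := hI.ym
  have y2 := hI.yr
  have hcS := hI.card
  have bm : x m < x b := by have := hI.side m hI.hm; omega
  have br : x b < x r := by have := hI.side r hI.hr; omega
  by_cases hcl : x c < x t
  · have n1 : x m ≠ x c := fun e => a1.1 (hx e)
    have n3 : y m ≠ y c := fun e => a1.1 (hy e)
    have k1 : x c < x m := by have := hI.imm_m c hcC hcl; omega
    have bc : x c < x b := by have := hI.side c hcC; omega
    clear n1
    have k2 := (hI.nost c hcC r hI.hr a2.symm hcl hrt).2 y2
    have k3 := a2.2 m hI.hm
    unfold Btw at k3
    by_cases hlow : y m < y c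
    · have k4 : y m < y r := by have : y m ≠ y r := fun e => a3.1 (hy e)
                                omega
      clear k3 n3
      refine ⟨t, b, c, r, {m}, ∅, Or.inl ?_⟩
      refine ⟨?_, by omega, by omega, by omega, by omega, by omega, by omega, by omega, by omega,
        ?_, by simp, by simp, by simp, by simp; omega, by simp, by simp⟩
      · intro a
        rw [hI.mem, hmemC, Finset.mem_singleton]
        simp only [Finset.notMem_empty]
        tauto
      · intro p hp
        rw [Finset.mem_singleton] at hp; subst hp; omega
    · have k5 : y c < y m := by omega
      have k4 : y r < y m := by have : y m ≠ y r := fun e => a3.1 (hy e)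
                                omega
      clear k3 n3
      refine ⟨t, b, r, c, ∅, {m}, Or.inr ?_⟩
      refine ⟨?_, by omega, by omega, by omega, by omega, by omega, by omega, by omega, by omega,
        by simp, ?_, by simp, by simp, by simp; omega, by simp, by simp⟩
      · intro a
        rw [hI.mem, hmemC, Finset.mem_singleton]
        simp only [Finset.notMem_empty]
        tauto
      · intro p hp
        rw [Finset.mem_singleton] at hp; subst hp; omega
  · have hcr : x t < x c := by
      by_contra hl
      exact hcl (hI.xlt hcC hl)
    have n1 : x r ≠ x c := fun e => a2.1 (hx e)
    have n3 : y r ≠ y c := fun e => a2.1 (hy e)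
    have k1 : x r < x c := by have := hI.imm_r c hcC hcr; omega
    have bc : x b < x c := by have := hI.side c hcC; omega
    clear n1
    have k2 := (hI.nost m hI.hm c hcC a1 hmt hcr).1 y1
    have k3 := a1.2 r hI.hr
    unfold Btw at k3
    by_cases hlow : y r < y c
    · have k4 : y r < y m := by have : y m ≠ y r := fun e => a3.1 (hy e)
                                omega
      clear k3 n3
      refine ⟨t, b, c, m, {r}, ∅, Or.inr ?_⟩
      refine ⟨?_, by omega, by omega, by omega, by omega, by omega, by omega, by omega, by omega,
        ?_, by simp, by simp, by simp, by simp; omega, by simp, by simp⟩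
      · intro a
        rw [hI.mem, hmemC, Finset.mem_singleton]
        simp only [Finset.notMem_empty]
        tauto
      · intro p hp
        rw [Finset.mem_singleton] at hp; subst hp; omega
    · have k5 : y c < y r := by omega
      have k4 : y m < y r := by have : y m ≠ y r := fun e => a3.1 (hy e)
                                omega
      clear k3 n3
      refine ⟨t, b, m, c, ∅, {r}, Or.inl ?_⟩
      refine ⟨?_, by omega, by omega, by omega, by omega, by omega, by omega, by omega, by omega,
        by simp, ?_, by simp, by simp, by simp; omega, by simp, by simp⟩
      · intro a
        rw [hI.mem, hmemC, Finset.mem_singleton]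
        simp only [Finset.notMem_empty]
        tauto
      · intro p hp
        rw [Finset.mem_singleton] at hp; subst hp; omega

theorem str_of_max (x y : α → ℤ) (hx : Function.Injective x) (hy : Function.Injective y) :
    ∀ (n : ℕ) (S : Finset α), S.card = n → 4 ≤ n → N x y S = 2 * F n → Str x y S := by
  intro n
  induction n using Nat.strong_induction_on with
  | _ n ih =>
  intro S hS hn hN
  obtain ⟨C, t, b, m, r, hI, hNC⟩ := exists_ins (S := S) hx hy (by omega) (by rw [hS]; exact hN)
  have hc := hI.card
  by_cases h4 : 4 ≤ C.card
  · exact step hI (ih C.card (by omega) C rfl h4 hNC) hx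
  · have : C.card = 2 ∨ C.card = 3 := by omega
    rcases this with h | h
    · exact base4 hI h
    · refine base5 hx hy hI h ?_
      rw [hNC, h]; decide

end ERG
namespace ERG
variable {α : Type} [DecidableEq α]

lemma N_complete (x y : α → ℤ) (C : Finset α)
    (h : ∀ u ∈ C, ∀ v ∈ C, u ≠ v → Adj x y C u v) (h2 : 2 ≤ C.card) (h3 : C.card ≤ 3) :
    2 * F C.card ≤ N x y C := by
  have h1 : N x y C = ∑ u ∈ C, (C.card - 1) := by
    unfold N
    refine Finset.sum_congr rfl fun u hu => ?_
    rw [← Finset.card_erase_of_mem hu, Finset.card_eq_sum_ones, ← Finset.add_sum_erase C _ hu,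
      ind_false (fun h => h.1 rfl), zero_add]
    refine Finset.sum_congr rfl fun v hv => ?_
    rw [Finset.mem_erase] at hv
    exact ind_true (h u hu v hv.2 hv.1.symm)
  rw [h1, Finset.sum_const, smul_eq_mul]
  have : C.card = 2 ∨ C.card = 3 := by omega
  rcases this with h | h <;> rw [h] <;> decide

lemma Dec.memC {x y : α → ℤ} {S : Finset α} {T B L R : α} {P Q : Finset α}
    (h : Dec x y S T B L R P Q) (c : α) :
    c ∈ (S.erase T).erase B ↔ (c = L ∨ c = R ∨ c ∈ P ∨ c ∈ Q) := by
  have h1 := h.xLT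
  have h2 := h.xLB
  have h3 := h.xTR
  have h4 := h.xBR
  rw [Finset.mem_erase, Finset.mem_erase, h.mem]
  constructor
  · tauto
  · rintro (e | e | e | e)
    · subst e
      exact ⟨by rintro rfl; omega, by rintro rfl; omega, by tauto⟩
    · subst e
      exact ⟨by rintro rfl; omega, by rintro rfl; omega, by tauto⟩
    · have := h.hP c e
      exact ⟨by rintro rfl; omega, by rintro rfl; omega, by tauto⟩
    · have := h.hQ c e
      exact ⟨by rintro rfl; omega, by rintro rfl; omega, by tauto⟩

lemma Dec.extr {x y : α → ℤ} {S : Finset α} {T B L R : α} {P Q : Finset α}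
    (h : Dec x y S T B L R P Q) {c : α} (hc : c ∈ (S.erase T).erase B) :
    y B < y c ∧ y c < y T := by
  have h5 := h.yBL
  have h6 := h.yBR
  have h7 := h.yLT
  have h8 := h.yRT
  rcases (h.memC c).1 hc with e | e | e | e
  · subst e; omega
  · subst e; omega
  · have := h.hP c e; omega
  · have := h.hQ c e; omega

lemma Dec.adjBP {x y : α → ℤ} {S : Finset α} {T B L R : α} {P Q : Finset α}
    (h : Dec x y S T B L R P Q) {a : α} (ha : a = L ∨ a ∈ P)
    (hm : ∀ p ∈ P, x p ≤ x a) : Adj x y S B a := by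
  have h1 := h.xLT
  have h2 := h.xLB
  have h3 := h.xTR
  have h4 := h.xBR
  have h5 := h.yBL
  have h6 := h.yBR
  have h7 := h.yLT
  have h8 := h.yRT
  have ha' : x L ≤ x a ∧ x a < x B ∧ y B < y a ∧ y a ≤ y L := by
    rcases ha with e | e
    · subst e; omega
    · have := h.hP a e; omega
  refine ⟨by rintro rfl; omega, fun w hw hbt => ?_⟩
  unfold Btw at hbt
  rcases (h.mem w).1 hw with e | e | e | e | e | e
  · subst e; omega
  · subst e; omega
  · subst e; omega
  · subst e; omega
  · have := hm w e; omega
  · have := h.hQ w e; omega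

lemma Dec.adjTQ {x y : α → ℤ} {S : Finset α} {T B L R : α} {P Q : Finset α}
    (h : Dec x y S T B L R P Q) {a : α} (ha : a = R ∨ a ∈ Q)
    (hm : ∀ p ∈ Q, x a ≤ x p) : Adj x y S T a := by
  have h1 := h.xLT
  have h2 := h.xLB
  have h3 := h.xTR
  have h4 := h.xBR
  have h5 := h.yBL
  have h6 := h.yBR
  have h7 := h.yLT
  have h8 := h.yRT
  have ha' : x T < x a ∧ x a ≤ x R ∧ y a < y T ∧ y R ≤ y a := by
    rcases ha with e | e
    · subst e; omega
    · have := h.hQ a e; omega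
  refine ⟨by rintro rfl; omega, fun w hw hbt => ?_⟩
  unfold Btw at hbt
  rcases (h.mem w).1 hw with e | e | e | e | e | e
  · subst e; omega
  · subst e; omega
  · subst e; omega
  · subst e; omega
  · have := h.hP w e; omega
  · have := hm w e; omega

lemma Dec.TB {x y : α → ℤ} {S : Finset α} {T B L R : α} {P Q : Finset α}
    (h : Dec x y S T B L R P Q) : T ≠ B := by
  have h5 := h.yBL
  have h7 := h.yLT
  rintro rfl; omega

lemma Dec.down {x y : α → ℤ} {S : Finset α} {T B L R : α} {P Q : Finset α}
    (h : Dec x y S T B L R P Q) :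
    N x y ((S.erase T).erase B) + 2 * (((S.erase T).erase B).card + 3) ≤ N x y S := by
  have hT : T ∈ S := (h.mem T).2 (by tauto)
  have hB : B ∈ S := (h.mem B).2 (by tauto)
  have hd := N_decomp x y S T B hT hB h.TB
  have hext := fun c => h.extr (c := c)
  have hmem := h.memC
  set C := (S.erase T).erase B with hC
  have h0 : ind (Adj x y S T B) = 1 := ind_true (h.adj (by tauto) (by tauto)).symm
  have h1 : N x y C ≤ ∑ u ∈ C, ∑ v ∈ C, ind (Adj x y S u v) := by
    refine Finset.sum_le_sum fun u hu => Finset.sum_le_sum fun v hv => ind_mono fun ha => ?_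
    refine ⟨ha.1, fun w hw hbt => ?_⟩
    have e1 := hext u hu
    have e2 := hext v hv
    by_cases hwC : w ∈ C
    · exact ha.2 w hwC hbt
    · have : w = T ∨ w = B := by
        rw [hC, Finset.mem_erase, Finset.mem_erase] at hwC
        tauto
      have hb := hbt.2
      unfold Btw at hb
      rcases this with rfl | rfl <;> omega
  have h3 : ∑ v ∈ C, (ind (Adj x y S T v) + ind (Adj x y S B v)) =
      ∑ v ∈ C, ind (Adj x y S T v ∨ Adj x y S B v) +
      ∑ v ∈ C, ind (Adj x y S T v ∧ Adj x y S B v) := by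
    rw [← Finset.sum_add_distrib]
    exact Finset.sum_congr rfl fun v _ => ind_add _ _
  have h4 : ∑ v ∈ C, 1 ≤ ∑ v ∈ C, ind (Adj x y S T v ∨ Adj x y S B v) := by
    refine Finset.sum_le_sum fun v hv => (ind_true ?_).ge
    rcases (hmem v).1 hv with e | e | e | e
    · exact Or.inl (h.adj (by tauto) (by tauto)).symm
    · exact Or.inr (h.adj (by tauto) (by tauto))
    · exact Or.inl (h.adj (by tauto) (by tauto)).symm
    · exact Or.inr (h.adj (by tauto) (by tauto))
  have h4c : ∑ v ∈ C, 1 = C.card := (Finset.card_eq_sum_ones _).symm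
  obtain ⟨a, ha, ham⟩ := Finset.exists_max_image (insert L P) x ⟨L, Finset.mem_insert_self _ _⟩
  obtain ⟨c, hc, hcm⟩ := Finset.exists_min_image (insert R Q) x ⟨R, Finset.mem_insert_self _ _⟩
  rw [Finset.mem_insert] at ha hc
  have a1 := h.adjBP ha (fun p hp => ham p (Finset.mem_insert_of_mem hp))
  have a2 : Adj x y S T a := (h.adj (by tauto) (by tauto)).symm
  have c1 := h.adjTQ hc (fun p hp => hcm p (Finset.mem_insert_of_mem hp))
  have c2 : Adj x y S B c := h.adj (by tauto) (by tauto)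
  have hac : a ≠ c := by
    have k1 := h.xLT
    have k3 := h.xTR
    have : x a < x T := by
      rcases ha with e | e
      · subst e; omega
      · have := h.hP a e; omega
    have : x T < x c := by
      rcases hc with e | e
      · subst e; omega
      · have := h.hQ c e; omega
    rintro rfl; omega
  have h5 : 2 ≤ ∑ v ∈ C, ind (Adj x y S T v ∧ Adj x y S B v) := by
    have hs : ({a, c} : Finset α) ⊆ C := by
      intro v hv
      rw [Finset.mem_insert, Finset.mem_singleton] at hv
      rw [hmem]
      rcases hv with rfl | rfl <;> tauto
    refine le_trans ?_ (Finset.sum_le_sum_of_subset hs)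
    rw [Finset.sum_pair hac, ind_true ⟨a2, a1⟩, ind_true ⟨c1, c2⟩]
  omega

lemma Dec.inner {x y : α → ℤ} (hx : Function.Injective x)
    {S : Finset α} {T B L R : α} {P Q : Finset α}
    (h : Dec x y S T B L R P Q) (hP : P.Nonempty) (hQ : Q.Nonempty) :
    ∃ T' B' P' Q', Dec x y ((S.erase T).erase B) T' B' L R P' Q' := by
  obtain ⟨a, ha, ham⟩ := Finset.exists_max_image P x hP
  obtain ⟨c, hc, hcm⟩ := Finset.exists_min_image Q x hQ
  have hA := h.hP a ha
  have hCc := h.hQ c hc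
  have cP := Finset.card_erase_add_one ha
  have cQ := Finset.card_erase_add_one hc
  have hcard := h.card
  have b1 := h.bal1
  have b2 := h.bal2
  have cS := card_erase2 ((h.mem T).2 (by tauto)) ((h.mem B).2 (by tauto)) h.TB
  refine ⟨c, a, P.erase a, Q.erase c, ?_⟩
  refine ⟨?_, by omega, by omega, by omega, by omega, by omega, by omega, by omega, by omega,
      ?_, ?_, ?_, ?_, by omega, by omega, by omega⟩
  · intro v
    rw [h.memC, Finset.mem_erase, Finset.mem_erase]
    constructor
    · tauto
    · rintro (rfl | rfl | e | e | e | e) <;> tauto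
  · intro p hp
    rw [Finset.mem_erase] at hp
    have k1 := h.hP p hp.2
    have k2 := ham p hp.2
    have k3 : x p ≠ x a := fun e => hp.1 (hx e)
    have k4 := h.decP p hp.2 a ha (by omega)
    omega
  · intro p hp
    rw [Finset.mem_erase] at hp
    have k1 := h.hQ p hp.2
    have k2 := hcm p hp.2
    have k3 : x p ≠ x c := fun e => hp.1 (hx e)
    have k4 := h.decQ c hc p hp.2 (by omega)
    omega
  · intro p hp q hq
    exact h.decP p (Finset.mem_of_mem_erase hp) q (Finset.mem_of_mem_erase hq)
  · intro p hp q hq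
    exact h.decQ p (Finset.mem_of_mem_erase hp) q (Finset.mem_of_mem_erase hq)

lemma Dec.small {x y : α → ℤ} 
    {S : Finset α} {T B L R : α} {P Q : Finset α}
    (h : Dec x y S T B L R P Q) (hPQ : P = ∅ ∨ Q = ∅) :
    2 * F ((S.erase T).erase B).card ≤ N x y ((S.erase T).erase B) := by
  have hcard := h.card
  have b1 := h.bal1
  have b2 := h.bal2
  have cS := card_erase2 ((h.mem T).2 (by tauto)) ((h.mem B).2 (by tauto)) h.TB
  have h1 := h.xLT
  have h3 := h.xTR
  have hle : P.card ≤ 1 ∧ Q.card ≤ 1 := by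
    rcases hPQ with e | e <;> rw [e] at b1 b2 <;> simp at b1 b2 <;> rw [e] <;> simp <;> omega
  have hle2 : P.card + Q.card ≤ 1 := by
    rcases hPQ with e | e <;> rw [e] <;> simp <;> omega
  refine N_complete x y _ ?_ (by omega) (by omega)
  intro u hu v hv huv
  refine ⟨huv, fun w hw hbt => ?_⟩
  unfold Btw at hbt
  rw [h.memC] at hu hv hw
  have hP1 : ∀ p ∈ P, ∀ q ∈ P, p = q := fun p hp q hq => Finset.card_le_one.1 hle.1 p hp q hq
  have hQ1 : ∀ p ∈ Q, ∀ q ∈ Q, p = q := fun p hp q hq => Finset.card_le_one.1 hle.2 p hp q hq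
  have hu' : x L ≤ x u ∧ x u ≤ x R := by
    rcases hu with rfl | rfl | e | e
    · omega
    · omega
    · have := h.hP u e; omega
    · have := h.hQ u e; omega
  have hv' : x L ≤ x v ∧ x v ≤ x R := by
    rcases hv with rfl | rfl | e | e
    · omega
    · omega
    · have := h.hP v e; omega
    · have := h.hQ v e; omega
  rcases hw with rfl | rfl | e | e
  · omega
  · omega
  · have k := h.hP w e
    have hQ0 : ∀ q, q ∉ Q := fun q hq => by
      have := Finset.card_pos.2 ⟨q, hq⟩
      have := Finset.card_pos.2 ⟨w, e⟩
      omega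
    rcases hu with rfl | rfl | eu | eu <;> rcases hv with rfl | rfl | ev | ev
    all_goals first
      | omega
      | exact absurd eu (hQ0 _)
      | exact absurd ev (hQ0 _)
      | (have := hP1 _ e _ eu; subst this; omega)
      | (have := hP1 _ e _ ev; subst this; omega)
  · have k := h.hQ w e
    have hQ0 : ∀ q, q ∉ P := fun q hq => by
      have := Finset.card_pos.2 ⟨q, hq⟩
      have := Finset.card_pos.2 ⟨w, e⟩
      omega
    rcases hu with rfl | rfl | eu | eu <;> rcases hv with rfl | rfl | ev | ev
    all_goals first
      | omega
      | exact absurd eu (hQ0 _)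
      | exact absurd ev (hQ0 _)
      | (have := hQ1 _ e _ eu; subst this; omega)
      | (have := hQ1 _ e _ ev; subst this; omega)

theorem Dec.N_ge {x y : α → ℤ} (hx : Function.Injective x) :
    ∀ (n : ℕ) {S : Finset α} {T B L R : α} {P Q : Finset α}, S.card = n →
    Dec x y S T B L R P Q → 2 * F S.card ≤ N x y S := by
  intro n
  induction n using Nat.strong_induction_on with
  | _ n ih =>
  intro S T B L R P Q hS h
  have hdown := h.down
  have cS := card_erase2 ((h.mem T).2 (by tauto)) ((h.mem B).2 (by tauto)) h.TB
  have hcard := h.card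
  have hF := F_step ((S.erase T).erase B).card (by omega)
  rw [cS] at hF
  suffices 2 * F ((S.erase T).erase B).card ≤ N x y ((S.erase T).erase B) by omega
  by_cases hP : P.Nonempty
  · by_cases hQ : Q.Nonempty
    · obtain ⟨T', B', P', Q', hD⟩ := h.inner hx hP hQ
      exact ih _ (by omega) rfl hD
    · exact h.small (Or.inr (Finset.not_nonempty_iff_eq_empty.1 hQ))
  · exact h.small (Or.inl (Finset.not_nonempty_iff_eq_empty.1 hP))

theorem max_iff_str (x y : α → ℤ) (hx : Function.Injective x) (hy : Function.Injective y)
    (S : Finset α) (h4 : 4 ≤ S.card) : N x y S = 2 * F S.card ↔ Str x y S := by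
  constructor
  · exact str_of_max x y hx hy _ S rfl h4
  · intro h
    refine le_antisymm (N_le x y hx hy _ S rfl (by omega)) ?_
    obtain ⟨T, B, L, R, P, Q, h | h⟩ := h
    · exact h.N_ge hx _ rfl
    · rw [← N_neg]
      exact h.N_ge (fun a b hab => hx (by simpa using hab)) _ rfl

end ERG
namespace ERG

/-- positions -/
def px {n : ℕ} (i : Fin n) : ℤ := ((i : ℕ) : ℤ)
/-- values -/
def py {n : ℕ} (π : Equiv.Perm (Fin n)) (i : Fin n) : ℤ := ((π i : ℕ) : ℤ)

lemma px_inj {n : ℕ} : Function.Injective (px (n := n)) := by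
  intro a b h
  unfold px at h
  exact Fin.ext (by exact_mod_cast h)

lemma py_inj {n : ℕ} (π : Equiv.Perm (Fin n)) : Function.Injective (py π) := by
  intro a b h
  unfold py at h
  exact π.injective (Fin.ext (by exact_mod_cast h))

lemma ind_split (i j v p q w : ℕ) (hij : i < j) (hpq : p < q) (h1 : v ≠ i) (h2 : v ≠ j)
    (h3 : w ≠ p) (h4 : w ≠ q) :
    (ind (i < v ∧ w < q) + ind (v < i ∧ q < w)) + (ind (j < v ∧ w < p) + ind (v < j ∧ p < w)) =
    (ind (i < v ∧ w < p) + ind (v < i ∧ p < w)) + (ind (j < v ∧ w < q) + ind (v < j ∧ q < w))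
      + 2 * ind ((i < v ∧ v < j) ∧ (p < w ∧ w < q)) := by
  have c1 : v < i ∨ (i < v ∧ v < j) ∨ j < v := by omega
  have c2 : w < p ∨ (p < w ∧ w < q) ∨ q < w := by omega
  rcases c1 with c1 | c1 | c1 <;> rcases c2 with c2 | c2 | c2
  all_goals
    first | rw [ind_true (p := i < v ∧ w < q) (by omega)] | rw [ind_false (p := i < v ∧ w < q) (by omega)]
    first | rw [ind_true (p := v < i ∧ q < w) (by omega)] | rw [ind_false (p := v < i ∧ q < w) (by omega)]
    first | rw [ind_true (p := j < v ∧ w < p) (by omega)] | rw [ind_false (p := j < v ∧ w < p) (by omega)]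
    first | rw [ind_true (p := v < j ∧ p < w) (by omega)] | rw [ind_false (p := v < j ∧ p < w) (by omega)]
    first | rw [ind_true (p := i < v ∧ w < p) (by omega)] | rw [ind_false (p := i < v ∧ w < p) (by omega)]
    first | rw [ind_true (p := v < i ∧ p < w) (by omega)] | rw [ind_false (p := v < i ∧ p < w) (by omega)]
    first | rw [ind_true (p := j < v ∧ w < q) (by omega)] | rw [ind_false (p := j < v ∧ w < q) (by omega)]
    first | rw [ind_true (p := v < j ∧ q < w) (by omega)] | rw [ind_false (p := v < j ∧ q < w) (by omega)]
    first
      | rw [ind_true (p := (i < v ∧ v < j) ∧ (p < w ∧ w < q)) (by omega)]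
      | rw [ind_false (p := (i < v ∧ v < j) ∧ (p < w ∧ w < q)) (by omega)]

lemma card_pairs {n : ℕ} (p : Fin n → Fin n → Prop) [DecidablePred fun z : Fin n × Fin n => p z.1 z.2] :
    (Finset.univ.filter (fun z : Fin n × Fin n => p z.1 z.2)).card = ∑ u, ∑ v, ind (p u v) := by
  rw [Finset.card_filter, ← Finset.univ_product_univ, Finset.sum_product]
  refine Finset.sum_congr rfl fun u _ => Finset.sum_congr rfl fun v _ => ?_
  by_cases h : p u v
  · rw [ind_true h, if_pos h]
  · rw [ind_false h, if_neg h]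

lemma invNum_eq {n : ℕ} (π : Equiv.Perm (Fin n)) :
    invNum π = ∑ u : Fin n, ∑ v : Fin n, ind ((u : ℕ) < v ∧ (π v : ℕ) < π u) := by
  unfold invNum
  rw [card_pairs (fun u v => u < v ∧ π v < π u)]
  rfl

lemma invNum_swap {n : ℕ} (π σ : Equiv.Perm (Fin n)) (i j : Fin n) (hij : i < j) (hp : π i < π j)
    (hi : σ i = π j) (hj : σ j = π i) (hk : ∀ k, k ≠ i → k ≠ j → σ k = π k) :
    invNum σ = invNum π + 1 + 2 * ∑ v ∈ (univ.erase i).erase j,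
      ind (((i : ℕ) < v ∧ (v : ℕ) < j) ∧ ((π i : ℕ) < π v ∧ (π v : ℕ) < π j)) := by
  have hij' : (i : ℕ) < j := hij
  have hp' : (π i : ℕ) < π j := hp
  rw [invNum_eq, invNum_eq,
    sum_pair_decomp _ univ i j (mem_univ _) (mem_univ _) hij.ne,
    sum_pair_decomp (fun u v : Fin n => ind ((u : ℕ) < v ∧ (π v : ℕ) < π u)) univ i j (mem_univ _) (mem_univ _) hij.ne]
  have e1 : ∑ u ∈ (univ.erase i).erase j, ∑ v ∈ (univ.erase i).erase j,
        ind ((u : ℕ) < v ∧ (σ v : ℕ) < σ u) =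
      ∑ u ∈ (univ.erase i).erase j, ∑ v ∈ (univ.erase i).erase j,
        ind ((u : ℕ) < v ∧ (π v : ℕ) < π u) := by
    refine Finset.sum_congr rfl fun u hu => Finset.sum_congr rfl fun v hv => ?_
    rw [Finset.mem_erase, Finset.mem_erase] at hu hv
    rw [hk u hu.2.1 hu.1, hk v hv.2.1 hv.1]
  have e2 : ∑ v ∈ (univ.erase i).erase j,
      ((ind ((i : ℕ) < v ∧ (σ v : ℕ) < σ i) + ind ((v : ℕ) < i ∧ (σ i : ℕ) < σ v)) +
        (ind ((j : ℕ) < v ∧ (σ v : ℕ) < σ j) + ind ((v : ℕ) < j ∧ (σ j : ℕ) < σ v))) =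
      ∑ v ∈ (univ.erase i).erase j,
      ((ind ((i : ℕ) < v ∧ (π v : ℕ) < π i) + ind ((v : ℕ) < i ∧ (π i : ℕ) < π v)) +
        (ind ((j : ℕ) < v ∧ (π v : ℕ) < π j) + ind ((v : ℕ) < j ∧ (π j : ℕ) < π v))) +
      2 * ∑ v ∈ (univ.erase i).erase j,
      ind (((i : ℕ) < v ∧ (v : ℕ) < j) ∧ ((π i : ℕ) < π v ∧ (π v : ℕ) < π j)) := by
    rw [Finset.mul_sum, ← Finset.sum_add_distrib]
    refine Finset.sum_congr rfl fun v hv => ?_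
    rw [Finset.mem_erase, Finset.mem_erase] at hv
    rw [hk v hv.2.1 hv.1, hi, hj]
    refine ind_split i j v (π i) (π j) (π v) hij' hp' ?_ ?_ ?_ ?_
    · exact fun e => hv.2.1 (Fin.ext e)
    · exact fun e => hv.1 (Fin.ext e)
    · exact fun e => hv.2.1 (π.injective (Fin.ext e))
    · exact fun e => hv.1 (π.injective (Fin.ext e))
  rw [e1, e2, hi, hj]
  rw [ind_true (p := (i : ℕ) < j ∧ (π i : ℕ) < π j) (by omega)]
  rw [ind_false (p := (j : ℕ) < i ∧ (π j : ℕ) < π i) (by omega)]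
  rw [ind_false (p := (i : ℕ) < i ∧ (π j : ℕ) < π j) (by omega)]
  rw [ind_false (p := (j : ℕ) < j ∧ (π i : ℕ) < π i) (by omega)]
  rw [ind_false (p := (i : ℕ) < j ∧ (π j : ℕ) < π i) (by omega)]
  rw [ind_false (p := (j : ℕ) < i ∧ (π i : ℕ) < π j) (by omega)]
  rw [ind_false (p := (i : ℕ) < i ∧ (π i : ℕ) < π i) (by omega)]
  rw [ind_false (p := (j : ℕ) < j ∧ (π j : ℕ) < π j) (by omega)]
  ring

lemma swap_sum_zero {n : ℕ} (π : Equiv.Perm (Fin n)) (i j : Fin n) (hij : i < j) (hp : π i < π j) :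
    (∑ v ∈ (univ.erase i).erase j,
      ind (((i : ℕ) < v ∧ (v : ℕ) < j) ∧ ((π i : ℕ) < π v ∧ (π v : ℕ) < π j))) = 0 ↔
    Adj px (py π) univ i j := by
  have hij' : (i : ℕ) < j := hij
  have hp' : (π i : ℕ) < π j := hp
  rw [Finset.sum_eq_zero_iff]
  constructor
  · intro h
    refine ⟨hij.ne, fun w _ hb => ?_⟩
    unfold Btw px py at hb
    have hw : w ∈ (univ.erase i).erase j := by
      rw [Finset.mem_erase, Finset.mem_erase]
      refine ⟨?_, ?_, mem_univ _⟩ <;> rintro rfl <;> omega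
    have := h w hw
    rw [ind_true (by omega)] at this
    omega
  · intro h v _
    refine ind_false fun hv => h.2 v (mem_univ _) ?_
    unfold Btw px py
    omega

lemma adj_change {n : ℕ} (π σ : Equiv.Perm (Fin n)) (i j : Fin n)
    (h : Adj px (py π) univ i j) 
    (hi : σ i = π j) (hj : σ j = π i) (hk : ∀ k, k ≠ i → k ≠ j → σ k = π k) :
    Adj px (py σ) univ j i := by
  refine ⟨h.1.symm, fun w _ hb => h.2 w (mem_univ _) ?_⟩
  have hw1 : w ≠ i := by rintro rfl; unfold Btw at hb; omega
  have hw2 : w ≠ j := by rintro rfl; unfold Btw at hb; omega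
  unfold Btw py at hb ⊢
  rw [hi, hj, hk w hw1 hw2] at hb
  omega

lemma cond_iff {n : ℕ} (π : Equiv.Perm (Fin n)) (a b : Fin n) (hab : a < b) :
    (invNum (Equiv.swap a b * π) + 1 = invNum π ∨ invNum (Equiv.swap a b * π) = invNum π + 1) ↔
    Adj px (py π) univ (π.symm a) (π.symm b) := by
  set i := π.symm a with hi
  set j := π.symm b with hj
  have ia : π i = a := by simp [hi]
  have jb : π j = b := by simp [hj]
  have hne : i ≠ j := by rintro e; rw [e, jb] at ia; exact hab.ne ia.symm
  set σ := Equiv.swap a b * π with hσ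
  have si : σ i = π j := by rw [hσ, Equiv.Perm.mul_apply, ia, jb, Equiv.swap_apply_left]
  have sj : σ j = π i := by rw [hσ, Equiv.Perm.mul_apply, ia, jb, Equiv.swap_apply_right]
  have sk : ∀ k, k ≠ i → k ≠ j → σ k = π k := by
    intro k h1 h2
    rw [hσ, Equiv.Perm.mul_apply, Equiv.swap_apply_of_ne_of_ne]
    · rw [← ia]; exact fun e => h1 (π.injective e)
    · rw [← jb]; exact fun e => h2 (π.injective e)
  have hp : π i < π j := by rw [ia, jb]; exact hab
  rcases lt_or_gt_of_ne hne with h | h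
  · have k1 := invNum_swap π σ i j h hp si sj sk
    have k2 := swap_sum_zero π i j h hp
    rw [← k2]
    omega
  · have k1 := invNum_swap σ π j i h (by rw [si, sj]; exact hp) si.symm sj.symm
      (fun k h1 h2 => (sk k h2 h1).symm)
    have k2 := swap_sum_zero σ j i h (by rw [si, sj]; exact hp)
    have k3 : Adj px (py π) univ i j ↔ Adj px (py σ) univ j i := by
      constructor
      · intro h; exact adj_change π σ i j h si sj sk
      · intro h
        exact adj_change σ π j i h si.symm sj.symm (fun k h1 h2 => (sk k h2 h1).symm)
    rw [k3, ← k2]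
    omega

theorem totalDeg_eq {n : ℕ} (π : Equiv.Perm (Fin n)) : N px (py π) univ = 2 * totalDeg π := by
  unfold totalDeg
  rw [card_pairs (fun a b => a < b ∧ (invNum (Equiv.swap a b * π) + 1 = invNum π ∨
    invNum (Equiv.swap a b * π) = invNum π + 1))]
  have e1 : ∀ a b : Fin n, ind (a < b ∧ (invNum (Equiv.swap a b * π) + 1 = invNum π ∨
    invNum (Equiv.swap a b * π) = invNum π + 1)) =
      ind (a < b ∧ Adj px (py π) univ (π.symm a) (π.symm b)) := by
    intro a b
    exact ind_congr (and_congr_right fun h => cond_iff π a b h)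
  simp only [e1]
  have e2 : N px (py π) univ = ∑ a, ∑ b, ind (Adj px (py π) univ (π.symm a) (π.symm b)) := by
    unfold N
    rw [← Equiv.sum_comp π.symm]
    refine Finset.sum_congr rfl fun a _ => ?_
    rw [← Equiv.sum_comp π.symm]
  have e3 : ∀ a b : Fin n, ind (Adj px (py π) univ (π.symm a) (π.symm b)) =
      ind (a < b ∧ Adj px (py π) univ (π.symm a) (π.symm b)) +
      ind (b < a ∧ Adj px (py π) univ (π.symm b) (π.symm a)) := by
    intro a b
    rw [adj_comm (u := π.symm b)]
    rcases lt_trichotomy a b with h | h | h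
    · rw [ind_false (p := b < a ∧ _) (fun k => absurd k.1 h.asymm), add_zero]
      exact ind_congr ⟨fun k => ⟨h, k⟩, fun k => k.2⟩
    · subst h
      rw [ind_false (fun k => k.1 rfl), ind_false (fun k => lt_irrefl _ k.1)]
    · rw [ind_false (p := a < b ∧ _) (fun k => absurd k.1 h.asymm), zero_add]
      exact ind_congr ⟨fun k => ⟨h, k⟩, fun k => k.2⟩
  rw [e2]
  simp only [e3, Finset.sum_add_distrib]
  rw [Finset.sum_comm (f := fun a b => ind (b < a ∧ Adj px (py π) univ (π.symm b) (π.symm a)))]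
  ring

theorem deg_max_iff {n : ℕ} (h4 : 4 ≤ n) (π : Equiv.Perm (Fin n)) :
    totalDeg π = n ^ 2 / 4 + n - 2 ↔ Str px (py π) univ := by
  have h := max_iff_str px (py π) px_inj (py_inj π) univ (by simpa using h4)
  rw [totalDeg_eq, Finset.card_univ, Fintype.card_fin] at h
  rw [← h]
  unfold F
  omega

end ERG
namespace ERG

section rot
variable {α : Type} [DecidableEq α]

lemma Dec.rot {x x' y y' : α → ℤ} {S : Finset α} {T B L R : α} {P Q : Finset α} {c : ℤ}
    (h : Dec x y S T B L R P Q) (hx : ∀ a, x' a = - x a) (hy : ∀ a, y' a = c - y a) :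
    Dec x' y' S B T R L Q P := by
  have h1 := h.xLT
  have h2 := h.xLB
  have h3 := h.xTR
  have h4 := h.xBR
  have h5 := h.yBL
  have h6 := h.yBR
  have h7 := h.yLT
  have h8 := h.yRT
  have h9 := h.card
  have h10 := h.bal1
  have h11 := h.bal2
  constructor
  · intro a
    rw [h.mem]
    tauto
  · rw [hx, hx]; omega
  · rw [hx, hx]; omega
  · rw [hx, hx]; omega
  · rw [hx, hx]; omega
  · rw [hy, hy]; omega
  · rw [hy, hy]; omega
  · rw [hy, hy]; omega
  · rw [hy, hy]; omega
  · intro p hp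
    have := h.hQ p hp
    simp only [hx, hy]
    omega
  · intro p hp
    have := h.hP p hp
    simp only [hx, hy]
    omega
  · intro p hp q hq hpq
    have := h.decQ q hq p hp
    simp only [hx, hy] at hpq ⊢
    omega
  · intro p hp q hq hpq
    have := h.decP q hq p hp
    simp only [hx, hy] at hpq ⊢
    omega
  · omega
  · omega
  · omega

lemma Dec.bounds {x y : α → ℤ} {S : Finset α} {T B L R : α} {P Q : Finset α}
    (h : Dec x y S T B L R P Q) {a : α} (ha : a ∈ S) :
    x L ≤ x a ∧ x a ≤ x R ∧ y B ≤ y a ∧ y a ≤ y T := by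
  have h1 := h.xLT
  have h2 := h.xLB
  have h3 := h.xTR
  have h4 := h.xBR
  have h5 := h.yBL
  have h6 := h.yBR
  have h7 := h.yLT
  have h8 := h.yRT
  rcases (h.mem a).1 ha with e | e | e | e | e | e
  · subst e; omega
  · subst e; omega
  · subst e; omega
  · subst e; omega
  · have := h.hP a e; omega
  · have := h.hQ a e; omega

lemma Dec.mem4 {x y : α → ℤ} {S : Finset α} {T B L R : α} {P Q : Finset α}
    (h : Dec x y S T B L R P Q) : T ∈ S ∧ B ∈ S ∧ L ∈ S ∧ R ∈ S := by
  simp only [h.mem]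
  tauto

lemma Dec.memP {x y : α → ℤ} {S : Finset α} {T B L R : α} {P Q : Finset α}
    (h : Dec x y S T B L R P Q) (a : α) :
    a ∈ P ↔ (a ∈ S ∧ a ≠ L ∧ x a < x T ∧ x a < x B) := by
  have h1 := h.xLT
  have h2 := h.xLB
  have h3 := h.xTR
  have h4 := h.xBR
  constructor
  · intro ha
    have := h.hP a ha
    exact ⟨(h.mem a).2 (by tauto), by rintro rfl; omega, by omega, by omega⟩
  · rintro ⟨ha, hL, k1, k2⟩
    rcases (h.mem a).1 ha with e | e | e | e | e | e
    · subst e; omega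
    · subst e; omega
    · exact absurd e hL
    · subst e; omega
    · exact e
    · have := h.hQ a e; omega

lemma Dec.memQ {x y : α → ℤ} {S : Finset α} {T B L R : α} {P Q : Finset α}
    (h : Dec x y S T B L R P Q) (a : α) :
    a ∈ Q ↔ (a ∈ S ∧ a ≠ R ∧ x T < x a ∧ x B < x a) := by
  have h1 := h.xLT
  have h2 := h.xLB
  have h3 := h.xTR
  have h4 := h.xBR
  constructor
  · intro ha
    have := h.hQ a ha
    exact ⟨(h.mem a).2 (by tauto), by rintro rfl; omega, by omega, by omega⟩
  · rintro ⟨ha, hL, k1, k2⟩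
    rcases (h.mem a).1 ha with e | e | e | e | e | e
    · subst e; omega
    · subst e; omega
    · subst e; omega
    · exact absurd e hL
    · have := h.hP a e; omega
    · exact e

lemma Dec.not_both {x y : α → ℤ} (hx : Function.Injective x) (hy : Function.Injective y)
    {S : Finset α} {T B L R T' B' L' R' : α} {P Q P' Q' : Finset α}
    (h : Dec x y S T B L R P Q) (h' : Dec (fun a => - x a) y S T' B' L' R' P' Q')
    (h5 : 5 ≤ S.card) : False := by
  obtain ⟨mT, mB, mL, mR⟩ := h.mem4
  obtain ⟨mT', mB', mL', mR'⟩ := h'.mem4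
  have eT : T = T' := hy (le_antisymm (h'.bounds mT).2.2.2 (h.bounds mT').2.2.2)
  have eB : B = B' := hy (le_antisymm (h.bounds mB').2.2.1 (h'.bounds mB).2.2.1)
  have eL : L = R' := hx (le_antisymm (h.bounds mR').1 (by have := (h'.bounds mL).2.1; omega))
  have eR : R = L' := hx (le_antisymm (by have := (h'.bounds mR).1; omega) (h.bounds mL').2.1)
  subst eT eB eL eR
  have hc := h.card
  have : P.Nonempty ∨ Q.Nonempty := by
    rw [← Finset.card_pos, ← Finset.card_pos]; omega
  rcases this with ⟨p, hp⟩ | ⟨p, hp⟩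
  · have k := h.hP p hp
    rcases (h'.mem p).1 ((h.mem p).2 (by tauto)) with e | e | e | e | e | e
    · subst e; omega
    · subst e; omega
    · subst e; omega
    · subst e; omega
    · have := h'.hP p e; omega
    · have := h'.hQ p e; omega
  · have k := h.hQ p hp
    rcases (h'.mem p).1 ((h.mem p).2 (by tauto)) with e | e | e | e | e | e
    · subst e; omega
    · subst e; omega
    · subst e; omega
    · subst e; omega
    · have := h'.hP p e; omega
    · have := h'.hQ p e; omega

/-- comparisons are determined -/
lemma Dec.mono {x y y' : α → ℤ} (hx : Function.Injective x) {S : Finset α} {T B L R : α}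
    {P Q : Finset α}
    (h : Dec x y S T B L R P Q) (h' : Dec x y' S T B L R P Q) (hlr : y L < y R ↔ y' L < y' R)
    (hne' : y' L ≠ y' R)
    {a c : α} (ha : a ∈ S) (hc : c ∈ S) (hac : y a < y c) : y' a < y' c := by
  have b1 := h.bounds ha
  have b2 := h.bounds hc
  have b1' := h'.bounds ha
  have b2' := h'.bounds hc
  have h5 := h.yBL
  have h6 := h.yBR
  have h7 := h.yLT
  have h8 := h.yRT
  have h5' := h'.yBL
  have h6' := h'.yBR
  have h7' := h'.yLT
  have h8' := h'.yRT
  rcases (h.mem a).1 ha with e | e | e | e | e | e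
  · subst e; omega
  · rcases (h.mem c).1 hc with f | f | f | f | f | f
    · subst e f; omega
    · subst e f; omega
    · subst e f; omega
    · subst e f; omega
    · have := h'.hP c f; subst e; omega
    · have := h'.hQ c f; subst e; omega
  · rcases (h.mem c).1 hc with f | f | f | f | f | f
    · subst e f; omega
    · subst e f; omega
    · subst e f; omega
    · subst e f; omega
    · have := h.hP c f; subst e; omega
    · have := h'.hQ c f; subst e; omega
  · rcases (h.mem c).1 hc with f | f | f | f | f | f
    · subst e f; omega
    · subst e f; omega
    · subst e f; omega
    · subst e f; omega
    · have := h.hP c f; subst e; omega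
    · have := h'.hQ c f; subst e; omega
  · have k := h'.hP a e
    have k' := h.hP a e
    rcases (h.mem c).1 hc with f | f | f | f | f | f
    · subst f; omega
    · subst f; omega
    · subst f; omega
    · subst f; omega
    · rcases lt_trichotomy (x a) (x c) with g | g | g
      · have := h.decP a e c f g; omega
      · rw [hx g] at hac; omega
      · exact h'.decP c f a e g
    · have := h'.hQ c f; omega
  · have k := h'.hQ a e
    have k' := h.hQ a e
    rcases (h.mem c).1 hc with f | f | f | f | f | f
    · subst f; omega
    · subst f; omega
    · subst f; omega
    · subst f; omega
    · have := h.hP c f; omega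
    · rcases lt_trichotomy (x a) (x c) with g | g | g
      · have := h.decQ a e c f g; omega
      · rw [hx g] at hac; omega
      · exact h'.decQ c f a e g

end rot

/-- permutations of decreasing type with given parameters -/
def Code {n : ℕ} (π : Equiv.Perm (Fin n)) (p : ℕ × Bool × Bool) : Prop :=
  ∃ T B L R P Q, Dec px (py π) univ T B L R P Q ∧ P.card = p.1 ∧
    (p.2.1 = true ↔ px T < px B) ∧ (p.2.2 = true ↔ py π L < py π R)

def IsD {n : ℕ} (π : Equiv.Perm (Fin n)) : Prop :=
  ∃ T B L R P Q, Dec px (py π) univ T B L R P Q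

def IsI {n : ℕ} (π : Equiv.Perm (Fin n)) : Prop :=
  ∃ T B L R P Q, Dec (fun a => - px a) (py π) univ T B L R P Q

lemma isI_iff {n : ℕ} (π : Equiv.Perm (Fin n)) : IsI π ↔ IsD (Fin.revPerm * π) := by
  have hy : ∀ a, py (Fin.revPerm * π) a = ((n : ℤ) - 1) - py π a := by
    intro a
    unfold py
    rw [Equiv.Perm.mul_apply, Fin.revPerm_apply, Fin.val_rev]
    have := (π a).2
    omega
  constructor
  · rintro ⟨T, B, L, R, P, Q, h⟩
    exact ⟨B, T, R, L, Q, P, h.rot (c := (n : ℤ) - 1) (by simp) hy⟩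
  · rintro ⟨T, B, L, R, P, Q, h⟩
    exact ⟨B, T, R, L, Q, P, h.rot (c := (n : ℤ) - 1) (by simp) (fun a => by rw [hy]; omega)⟩

lemma str_iff {n : ℕ} (π : Equiv.Perm (Fin n)) : Str px (py π) univ ↔ IsD π ∨ IsI π := by
  unfold Str IsD IsI
  constructor
  · rintro ⟨T, B, L, R, P, Q, h | h⟩
    · exact Or.inl ⟨T, B, L, R, P, Q, h⟩
    · exact Or.inr ⟨T, B, L, R, P, Q, h⟩
  · rintro (⟨T, B, L, R, P, Q, h⟩ | ⟨T, B, L, R, P, Q, h⟩)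
    · exact ⟨T, B, L, R, P, Q, Or.inl h⟩
    · exact ⟨T, B, L, R, P, Q, Or.inr h⟩

lemma not_isD_isI {n : ℕ} (hn : 5 ≤ n) (π : Equiv.Perm (Fin n)) (h1 : IsD π) (h2 : IsI π) :
    False := by
  obtain ⟨T, B, L, R, P, Q, h⟩ := h1
  obtain ⟨T', B', L', R', P', Q', h'⟩ := h2
  exact h.not_both px_inj (py_inj π) h' (by simpa using hn)

lemma Dec.params {n : ℕ} {y : Fin n → ℤ} {T B L R : Fin n} {P Q : Finset (Fin n)}
    (h : Dec px y univ T B L R P Q) :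
    (L : ℕ) = 0 ∧ (R : ℕ) + 1 = n ∧ (px T < px B → (T : ℕ) = P.card + 1 ∧ (B : ℕ) = P.card + 2) ∧
    (¬ px T < px B → (B : ℕ) = P.card + 1 ∧ (T : ℕ) = P.card + 2) := by
  have hL : L ∉ P := fun hp => by have := h.hP L hp; omega
  have hT : T ∉ insert L P := by
    rw [Finset.mem_insert]
    rintro (e | e)
    · subst e; exact absurd h.xLT (lt_irrefl _)
    · have := h.hP T e; omega
  have hB : B ∉ insert L P := by
    rw [Finset.mem_insert]
    rintro (e | e)
    · subst e; exact absurd h.xLB (lt_irrefl _)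
    · have := h.hP B e; omega
  have cL := Finset.card_insert_of_notMem hL
  have cT := Finset.card_insert_of_notMem hT
  have cB := Finset.card_insert_of_notMem hB
  have h1 := h.xLT
  have h2 := h.xLB
  have h3 := h.xTR
  have h4 := h.xBR
  have mem : ∀ a, a = T ∨ a = B ∨ a = L ∨ a = R ∨ a ∈ P ∨ a ∈ Q := fun a => (h.mem a).1 (mem_univ _)
  have hlt : ∀ a b : Fin n, a < b ↔ px a < px b := by
    intro a b; unfold px; rw [Fin.lt_def]; omega
  have low : ∀ m, (m = T ∨ m = B) → px m ≤ px T → px m ≤ px B → Finset.Iio m = insert L P := by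
    intro m hm k1 k2
    ext a
    rw [Finset.mem_Iio, Finset.mem_insert, hlt]
    constructor
    · intro ha
      rcases mem a with e | e | e | e | e | e
      · subst e; omega
      · subst e; omega
      · exact Or.inl e
      · subst e; omega
      · exact Or.inr e
      · have := h.hQ a e; omega
    · rintro (e | e)
      · subst e; rcases hm with rfl | rfl <;> omega
      · have := h.hP a e; rcases hm with rfl | rfl <;> omega
  refine ⟨?_, ?_, ?_, ?_⟩
  · have := (h.bounds (mem_univ (⟨0, by have := L.2; omega⟩ : Fin n))).1
    unfold px at this
    simpa using this
  · have := (h.bounds (mem_univ (⟨n - 1, by have := L.2; omega⟩ : Fin n))).2.1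
    unfold px at this
    have := R.2
    simp at *
    omega
  · intro hTB
    have e1 := congrArg Finset.card (low T (by tauto) le_rfl hTB.le)
    rw [Fin.card_Iio] at e1
    have e2 : Finset.Iio B = insert T (insert L P) := by
      rw [← low T (by tauto) le_rfl hTB.le]
      ext a
      rw [Finset.mem_Iio, Finset.mem_insert, Finset.mem_Iio, hlt, hlt]
      constructor
      · intro ha
        rcases mem a with e | e | e | e | e | e
        · exact Or.inl e
        · subst e; omega
        · subst e; omega
        · subst e; omega
        · have := h.hP a e; omega
        · have := h.hQ a e; omega
      · rintro (e | e)
        · subst e; omega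
        · omega
    have e3 := congrArg Finset.card e2
    rw [Fin.card_Iio] at e3
    omega
  · intro hTB
    have hne : px T ≠ px B := fun e => h.TB (px_inj e)
    have hBT : px B < px T := by omega
    have e1 := congrArg Finset.card (low B (by tauto) hBT.le le_rfl)
    rw [Fin.card_Iio] at e1
    have e2 : Finset.Iio T = insert B (insert L P) := by
      rw [← low B (by tauto) hBT.le le_rfl]
      ext a
      rw [Finset.mem_Iio, Finset.mem_insert, Finset.mem_Iio, hlt, hlt]
      constructor
      · intro ha
        rcases mem a with e | e | e | e | e | e
        · subst e; omega
        · exact Or.inl e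
        · subst e; omega
        · subst e; omega
        · have := h.hP a e; omega
        · have := h.hQ a e; omega
      · rintro (e | e)
        · subst e; omega
        · omega
    have e3 := congrArg Finset.card e2
    rw [Fin.card_Iio] at e3
    omega

lemma perm_eq_of_mono {n : ℕ} (π σ : Equiv.Perm (Fin n)) (h : ∀ a c, π a < π c → σ a < σ c) :
    π = σ := by
  have h1 : StrictMono (fun a => σ (π.symm a)) := by
    intro a c hac
    exact h _ _ (by simpa using hac)
  have h2 : (fun a => σ (π.symm a)) = id := by
    exact le_antisymm h1.le_id h1.id_le
  ext a
  have := congrFun h2 (π a)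
  simp at this
  rw [this]

lemma Code.unique_perm {n : ℕ} {π σ : Equiv.Perm (Fin n)} {p : ℕ × Bool × Bool}
    (h1 : Code π p) (h2 : Code σ p) : π = σ := by
  obtain ⟨T, B, L, R, P, Q, h, c1, c2, c3⟩ := h1
  obtain ⟨T', B', L', R', P', Q', h', c1', c2', c3'⟩ := h2
  obtain ⟨k1, k2, k3, k4⟩ := h.params
  obtain ⟨l1, l2, l3, l4⟩ := h'.params
  have hc : P.card = P'.card := by omega
  have hiff : px T < px B ↔ px T' < px B' := by rw [← c2, ← c2']
  have eL : L = L' := Fin.ext (by omega)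
  have eR : R = R' := Fin.ext (by omega)
  have eTB : T = T' ∧ B = B' := by
    by_cases hh : px T < px B
    · have a1 := k3 hh
      have a2 := l3 (hiff.1 hh)
      exact ⟨Fin.ext (by omega), Fin.ext (by omega)⟩
    · have a1 := k4 hh
      have a2 := l4 (fun e => hh (hiff.2 e))
      exact ⟨Fin.ext (by omega), Fin.ext (by omega)⟩
  obtain ⟨eT, eB⟩ := eTB
  subst eL eR eT eB
  have eP : P = P' := by ext a; rw [h.memP, h'.memP]
  have eQ : Q = Q' := by ext a; rw [h.memQ, h'.memQ]
  subst eP eQ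
  have hne : py σ L ≠ py σ R := by
    intro e
    have := py_inj σ e
    have := h.xLT
    have := h.xTR
    subst L
    omega
  refine perm_eq_of_mono π σ fun a c hac => ?_
  have := h.mono px_inj h' (by rw [← c3, ← c3']) hne (mem_univ a) (mem_univ c) 
    (by unfold py; exact_mod_cast hac)
  unfold py at this
  exact_mod_cast this

lemma Code.unique_code {n : ℕ} {π : Equiv.Perm (Fin n)} {p q : ℕ × Bool × Bool}
    (h1 : Code π p) (h2 : Code π q) : p = q := by
  obtain ⟨T, B, L, R, P, Q, h, c1, c2, c3⟩ := h1
  obtain ⟨T', B', L', R', P', Q', h', c1', c2', c3'⟩ := h2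
  obtain ⟨mT, mB, mL, mR⟩ := h.mem4
  obtain ⟨mT', mB', mL', mR'⟩ := h'.mem4
  have eT : T = T' := py_inj π (le_antisymm (h'.bounds mT).2.2.2 (h.bounds mT').2.2.2)
  have eB : B = B' := py_inj π (le_antisymm (h.bounds mB').2.2.1 (h'.bounds mB).2.2.1)
  have eL : L = L' := px_inj (le_antisymm (h.bounds mL').1 (h'.bounds mL).1)
  have eR : R = R' := px_inj (le_antisymm (h'.bounds mR).2.1 (h.bounds mR').2.1)
  subst eL eR eT eB
  have eP : P = P' := by ext a; rw [h.memP, h'.memP]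
  subst eP
  obtain ⟨k, s, t⟩ := p
  obtain ⟨k', s', t'⟩ := q
  simp only at *
  have e1 : s = s' := by rw [Bool.eq_iff_iff, c2, c2']
  have e2 : t = t' := by rw [Bool.eq_iff_iff, c3, c3']
  rw [e1, e2, ← c1, ← c1']

lemma Code.isD {n : ℕ} {π : Equiv.Perm (Fin n)} {p : ℕ × Bool × Bool} (h : Code π p) : IsD π := by
  obtain ⟨T, B, L, R, P, Q, h, -⟩ := h
  exact ⟨T, B, L, R, P, Q, h⟩

/-- admissible values of the first parameter -/
def KK (n : ℕ) : Finset ℕ := (Finset.range n).filter (fun k => 2 * k + 3 ≤ n ∧ n ≤ 2 * k + 5 ∧ k + 4 ≤ n)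

lemma IsD.code {n : ℕ} {π : Equiv.Perm (Fin n)} (h : IsD π) :
    ∃ p ∈ KK n ×ˢ (univ : Finset (Bool × Bool)), Code π p := by
  obtain ⟨T, B, L, R, P, Q, h⟩ := h
  refine ⟨(P.card, decide (px T < px B), decide (py π L < py π R)), ?_,
    ⟨T, B, L, R, P, Q, h, rfl, by simp, by simp⟩⟩
  have h1 := h.card
  have h2 := h.bal1
  have h3 := h.bal2
  rw [Finset.card_univ, Fintype.card_fin] at h1
  simp only [KK, Finset.mem_product, Finset.mem_univ, and_true, Finset.mem_filter, Finset.mem_range]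
  omega

end ERG
namespace ERG

/-- explicit extremal permutation -/
def gfun (n k l r tp bp i : ℕ) : ℕ :=
  if i = 0 then l else if i ≤ k then k + 1 - i else if i = tp then n - 1 else if i = bp then 0
    else if i = n - 1 then r else n + k + 1 - i

lemma exists_g {n k l r tp bp : ℕ} (hk : k + 4 ≤ n)
    (hl : (l = k + 1 ∧ r = k + 2) ∨ (l = k + 2 ∧ r = k + 1))
    (ht : (tp = k + 1 ∧ bp = k + 2) ∨ (tp = k + 2 ∧ bp = k + 1)) :
    ∃ π : Equiv.Perm (Fin n), ∀ i, (π i : ℕ) = gfun n k l r tp bp i := by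
  have hlt : ∀ i, i < n → gfun n k l r tp bp i < n := by
    intro i hi
    unfold gfun
    split_ifs <;> omega
  have hinj : ∀ i j, i < n → j < n → gfun n k l r tp bp i = gfun n k l r tp bp j → i = j := by
    intro i j hi hj
    unfold gfun
    split_ifs <;> omega
  let f : Fin n → Fin n := fun i => ⟨gfun n k l r tp bp i, hlt i i.2⟩
  have hf : Function.Injective f := by
    intro i j hij
    exact Fin.ext (hinj i j i.2 j.2 (congrArg Fin.val hij))
  exact ⟨Equiv.ofBijective f (Finite.injective_iff_bijective.1 hf), fun i => rfl⟩

lemma exists_dec {n k l r tp bp : ℕ} (hk : k + 4 ≤ n) (hk1 : 2 * k + 3 ≤ n) (hk2 : n ≤ 2 * k + 5)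
    (hl : (l = k + 1 ∧ r = k + 2) ∨ (l = k + 2 ∧ r = k + 1))
    (ht : (tp = k + 1 ∧ bp = k + 2) ∨ (tp = k + 2 ∧ bp = k + 1)) :
    ∃ π : Equiv.Perm (Fin n), ∃ T B L R P Q, Dec px (py π) univ T B L R P Q ∧ P.card = k ∧
      px T = tp ∧ px B = bp ∧ py π L = l ∧ py π R = r := by
  obtain ⟨π, hπ⟩ := exists_g hk hl ht
  have htn : tp < n := by omega
  have hbn : bp < n := by omega
  have eT : py π ⟨tp, htn⟩ = n - 1 := by
    unfold py; rw [hπ]; unfold gfun; simp only; split_ifs <;> omega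
  have eB : py π ⟨bp, hbn⟩ = 0 := by
    unfold py; rw [hπ]; unfold gfun; simp only; split_ifs <;> omega
  have eL : py π ⟨0, by omega⟩ = l := by
    unfold py; rw [hπ]; unfold gfun; simp only; split_ifs <;> omega
  have eR : py π ⟨n - 1, by omega⟩ = r := by
    unfold py; rw [hπ]; unfold gfun; simp only; split_ifs <;> omega
  have eP : ∀ p : Fin n, 1 ≤ (p : ℕ) → (p : ℕ) ≤ k → py π p = k + 1 - px p := by
    intro p h1 h2
    unfold py px; rw [hπ]; unfold gfun; split_ifs <;> omega
  have eQ : ∀ p : Fin n, k + 3 ≤ (p : ℕ) → (p : ℕ) ≤ n - 2 → py π p = n + k + 1 - px p := by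
    intro p h1 h2
    unfold py px; rw [hπ]; unfold gfun; split_ifs <;> omega
  have mP : ∀ p : Fin n, p ∈ Finset.Icc (⟨1, by omega⟩ : Fin n) ⟨k, by omega⟩ ↔
      1 ≤ (p : ℕ) ∧ (p : ℕ) ≤ k := by
    intro p; rw [Finset.mem_Icc, Fin.le_def, Fin.le_def]
  have mQ : ∀ p : Fin n, p ∈ Finset.Icc (⟨k + 3, by omega⟩ : Fin n) ⟨n - 2, by omega⟩ ↔
      k + 3 ≤ (p : ℕ) ∧ (p : ℕ) ≤ n - 2 := by
    intro p; rw [Finset.mem_Icc, Fin.le_def, Fin.le_def]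
  have cP : (Finset.Icc (⟨1, by omega⟩ : Fin n) ⟨k, by omega⟩).card = k := by
    rw [Fin.card_Icc]; simp
  have cQ : (Finset.Icc (⟨k + 3, by omega⟩ : Fin n) ⟨n - 2, by omega⟩).card = n - 4 - k := by
    rw [Fin.card_Icc]; simp only; omega
  have xT : px (⟨tp, htn⟩ : Fin n) = tp := rfl
  have xB : px (⟨bp, hbn⟩ : Fin n) = bp := rfl
  have xL : px (⟨0, by omega⟩ : Fin n) = 0 := rfl
  have xR : px (⟨n - 1, by omega⟩ : Fin n) = n - 1 := by unfold px; simp only; omega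
  refine ⟨π, ⟨tp, htn⟩, ⟨bp, hbn⟩, ⟨0, by omega⟩, ⟨n - 1, by omega⟩,
    Finset.Icc (⟨1, by omega⟩ : Fin n) ⟨k, by omega⟩,
    Finset.Icc (⟨k + 3, by omega⟩ : Fin n) ⟨n - 2, by omega⟩, ?_, cP, xT, xB, eL, eR⟩
  refine ⟨?_, ?_, ?_, ?_, ?_, ?_, ?_, ?_, ?_, ?_, ?_, ?_, ?_, ?_, ?_, ?_⟩
  · intro a
    rw [mP, mQ]
    simp only [mem_univ, true_iff, Fin.ext_iff]
    have := a.2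
    omega
  · rw [xL, xT]; omega
  · rw [xL, xB]; omega
  · rw [xR, xT]; omega
  · rw [xR, xB]; omega
  · rw [eL, eB]; omega
  · rw [eR, eB]; omega
  · rw [eL, eT]; omega
  · rw [eR, eT]; omega
  · intro p hp
    rw [mP] at hp
    rw [eP p hp.1 hp.2, xL, xT, xB, eB, eL, eR]
    unfold px
    omega
  · intro p hp
    rw [mQ] at hp
    rw [eQ p hp.1 hp.2, xR, xT, xB, eT, eL, eR]
    unfold px
    omega
  · intro p hp q hq hpq
    rw [mP] at hp hq
    rw [eP p hp.1 hp.2, eP q hq.1 hq.2]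
    omega
  · intro p hp q hq hpq
    rw [mQ] at hp hq
    rw [eQ p hp.1 hp.2, eQ q hq.1 hq.2]
    omega
  · rw [cP, cQ, Finset.card_univ, Fintype.card_fin]; omega
  · rw [cP, cQ]; omega
  · rw [cP, cQ]; omega

lemma exists_code {n : ℕ} (p : ℕ × Bool × Bool)
    (hp : p ∈ KK n ×ˢ (univ : Finset (Bool × Bool))) : ∃ π : Equiv.Perm (Fin n), Code π p := by
  obtain ⟨k, s, t⟩ := p
  simp only [KK, Finset.mem_product, Finset.mem_univ, and_true, Finset.mem_filter,
    Finset.mem_range] at hp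
  obtain ⟨π, T, B, L, R, P, Q, h, h1, h2, h3, h4, h5⟩ := exists_dec (n := n) (k := k)
    (l := if t then k + 1 else k + 2) (r := if t then k + 2 else k + 1)
    (tp := if s then k + 1 else k + 2) (bp := if s then k + 2 else k + 1)
    (by omega) (by omega) (by omega) (by cases t <;> simp) (by cases s <;> simp)
  refine ⟨π, T, B, L, R, P, Q, h, h1, ?_, ?_⟩
  · rw [h2, h3]; cases s <;> simp
  · rw [h4, h5]; cases t <;> simp

open Classical in
lemma card_isD (n : ℕ) :
    ((univ : Finset (Equiv.Perm (Fin n))).filter IsD).card = (KK n).card * 4 := by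
  have h : (KK n ×ˢ (univ : Finset (Bool × Bool))).card = (KK n).card * 4 := by
    rw [Finset.card_product]; rfl
  rw [← h]
  symm
  refine Finset.card_bij (fun p hp => (exists_code p hp).choose) ?_ ?_ ?_
  · intro p hp
    rw [Finset.mem_filter]
    exact ⟨mem_univ _, (exists_code p hp).choose_spec.isD⟩
  · intro p hp q hq hpq
    have h1 := (exists_code p hp).choose_spec
    have h2 := (exists_code q hq).choose_spec
    rw [hpq] at h1
    exact h1.unique_code h2
  · intro π hπ
    rw [Finset.mem_filter] at hπ
    obtain ⟨p, hp, hc⟩ := hπ.2.code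
    exact ⟨p, hp, (exists_code p hp).choose_spec.unique_perm hc⟩

open Classical in
lemma card_isI (n : ℕ) :
    ((univ : Finset (Equiv.Perm (Fin n))).filter IsI).card = (KK n).card * 4 := by
  rw [← card_isD]
  refine Finset.card_bij (fun π _ => Fin.revPerm * π) ?_ ?_ ?_
  · intro π hπ
    rw [Finset.mem_filter] at hπ ⊢
    exact ⟨mem_univ _, (isI_iff π).1 hπ.2⟩
  · intro π _ σ _ h
    exact mul_left_cancel h
  · intro σ hσ
    rw [Finset.mem_filter] at hσ
    refine ⟨Fin.revPerm⁻¹ * σ, ?_, by simp⟩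
    rw [Finset.mem_filter, isI_iff]
    exact ⟨mem_univ _, by simpa using hσ.2⟩

lemma card_KK (n : ℕ) (hn : 5 ≤ n) : (KK n).card = if n % 2 = 0 then 1 else 2 := by
  split_ifs with h
  · have : KK n = {n / 2 - 2} := by
      ext k
      simp only [KK, Finset.mem_filter, Finset.mem_range, Finset.mem_singleton]
      omega
    rw [this, Finset.card_singleton]
  · have : KK n = {n / 2 - 2, n / 2 - 1} := by
      ext k
      simp only [KK, Finset.mem_filter, Finset.mem_range, Finset.mem_singleton, Finset.mem_insert]
      omega
    rw [this, Finset.card_pair (by omega)]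

theorem card_max_large {n : ℕ} (hn : 5 ≤ n) :
    (Finset.univ.filter
        (fun π : Equiv.Perm (Fin n) => totalDeg π = n ^ 2 / 4 + n - 2)).card =
      if n % 2 = 0 then 8 else 16 := by
  classical
  have h : (Finset.univ.filter
        (fun π : Equiv.Perm (Fin n) => totalDeg π = n ^ 2 / 4 + n - 2)) =
      (univ : Finset (Equiv.Perm (Fin n))).filter IsD ∪ univ.filter IsI := by
    ext π
    rw [Finset.mem_union, Finset.mem_filter, Finset.mem_filter, Finset.mem_filter,
      deg_max_iff (by omega), str_iff]
    tauto
  rw [h, Finset.card_union_of_disjoint]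
  · have h1 := card_isD n
    have h2 := card_isI n
    have h3 := card_KK n hn
    split_ifs at h3 ⊢ <;> rw [h3] at h1 h2 <;> convert congrArg₂ (· + ·) h1 h2 using 1
  · rw [Finset.disjoint_left]
    intro π h1 h2
    rw [Finset.mem_filter] at h1 h2
    exact not_isD_isI hn π h1.2 h2.2

end ERG

theorem card_max_totalDeg {n : ℕ} (hn : 2 ≤ n) :
    (Finset.univ.filter
        (fun π : Equiv.Perm (Fin n) => totalDeg π = n ^ 2 / 4 + n - 2)).card =
      if n = 2 then 2 else if n ≤ 4 then 4 else if n % 2 = 0 then 8 else 16 := by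
  by_cases h5 : 5 ≤ n
  · rw [ERG.card_max_large h5, if_neg (show ¬ n = 2 by omega), if_neg (show ¬ n ≤ 4 by omega)]
  · have : n = 2 ∨ n = 3 ∨ n = 4 := by omega
    rcases this with rfl | rfl | rfl
    · decide +kernel
    · decide +kernel
    · decide +kernel
end
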